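/- Let n ≥ 2 and let k be an integer with 1 ≤ k ≤ n. Let u^1,…,u^k ∈ C^2(S^n) be such that u^i > 0 and W_{u^i}(x) ∈ Γ_k for every x ∈ S^n and i = 1,…,k. Then for any v ∈ C^2(S^n) the Alexandrov–Fenchel inequality holds: V_{k+1}(v, u^1, u^2,…,u^k)² ≥ V_{k+1}(v, v, u^2,…,u^k) · V_{k+1}(u^1, u^1, u^2,…,u^k), with equality if and only if v = a·u^1 + Σ_{l=1}^{n+1} a_l x_l on S^n for some constants a, a_1,…,a_{n+1} (i.e. v differs from a·u^1 by the restriction to S^n of a linear function of R^{n+1}). -/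

import Mathlib

open MeasureTheory Filter
open scoped RealInnerProductSpace Topology

noncomputable section

/-- Euclidean ambient space `ℝ^{n+1}`. -/
abbrev Eu (n : ℕ) : Type := EuclideanSpace ℝ (Fin (n + 1))

/-- The unit sphere `S^n ⊆ ℝ^{n+1}`. -/
def sph (n : ℕ) : Set (Eu n) := Metric.sphere (0 : Eu n) 1

/-- The 1-homogeneous extension `U(y) = |y|·u(y/|y|)` of a function on the sphere. -/
def homExt {n : ℕ} (u : Eu n → ℝ) (y : Eu n) : ℝ := ‖y‖ * u (‖y‖⁻¹ • y)

/-- The (Euclidean) Hessian of the 1-homogeneous extension, as an operator. -/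
def hessOp {n : ℕ} (u : Eu n → ℝ) (x : Eu n) : Eu n →L[ℝ] Eu n :=
  fderiv ℝ (gradient (homExt u)) x

/-- The `k`-th elementary symmetric function of the eigenvalues of an endomorphism of
`ℝ^{n+1}`, read off from the coefficients of the characteristic polynomial. -/
def esymmOp (n k : ℕ) (T : Eu n →ₗ[ℝ] Eu n) : ℝ :=
  (-1 : ℝ) ^ k * (LinearMap.charpoly T).coeff (n + 1 - k)

/-- `σ_k`, the `k`-th elementary symmetric function of the principal curvature radii,
i.e. of the eigenvalues of `W_u(x)`; since the Hessian of the 1-homogeneous extension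
kills the radial direction, this agrees with the `k`-th elementary symmetric function of
all its eigenvalues. -/
def sigmaK (n k : ℕ) (u : Eu n → ℝ) (x : Eu n) : ℝ :=
  esymmOp n k (hessOp u x).toLinearMap

/-- Smoothness on the sphere, expressed via the 1-homogeneous extension. -/
def SmoothOnSphere {n : ℕ} (u : Eu n → ℝ) : Prop :=
  ContDiffOn ℝ (⊤ : ℕ∞) (homExt u) {(0 : Eu n)}ᶜ

def PosOnSphere {n : ℕ} (u : Eu n → ℝ) : Prop := ∀ x ∈ sph n, 0 < u x

/-- Uniform convexity: `W_u(x)` is positive definite on the tangent hyperplane `x^⊥`. -/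
def UnifConvex {n : ℕ} (u : Eu n → ℝ) : Prop :=
  ∀ x ∈ sph n, ∀ v : Eu n, ⟪x, v⟫ = 0 → v ≠ 0 → 0 < ⟪v, hessOp u x v⟫

/-- `u` is the support function of a smooth, closed, uniformly convex hypersurface
enclosing the origin. -/
def GoodSph {n : ℕ} (u : Eu n → ℝ) : Prop :=
  SmoothOnSphere u ∧ PosOnSphere u ∧ UnifConvex u

/-- Integration over the sphere with respect to the surface (n-dimensional Hausdorff)
measure. -/
def sphInt (n : ℕ) (g : Eu n → ℝ) : ℝ :=
  ∫ x in sph n, g x ∂(Measure.hausdorffMeasure (n : ℝ))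

/-- `|S^n|`. -/
def sphVol (n : ℕ) : ℝ := (Measure.hausdorffMeasure (n : ℝ) (sph n)).toReal

/-- The spherical gradient `∇u(x) = DU(x) − u(x)·x`. -/
def sphGrad {n : ℕ} (u : Eu n → ℝ) (x : Eu n) : Eu n :=
  gradient (homExt u) x - u x • x

/-- The (unnormalised) anisotropic expanding flow `∂_t u = f u^α σ_k^β` on the time set `s`. -/
def ExpFlow (n k : ℕ) (α β : ℝ) (f : Eu n → ℝ) (s : Set ℝ) (u : ℝ → Eu n → ℝ) : Prop :=
  (∀ t ∈ s, GoodSph (u t)) ∧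
  ∀ x ∈ sph n, ∀ t ∈ s,
    HasDerivWithinAt (fun r => u r x)
      (f x * u t x ^ α * sigmaK n k (u t) x ^ β) s t

/-- The global term `η(t) = |S^n|⁻¹ ∫ f u^α σ_k^{1+β}` of the normalised anisotropic flow. -/
def eta (n k : ℕ) (α β : ℝ) (f v : Eu n → ℝ) : ℝ :=
  (sphVol n)⁻¹ * sphInt n (fun x => f x * v x ^ α * sigmaK n k v x ^ (1 + β))

/-- The normalised anisotropic flow `∂_t u = f u^α σ_k^β − η(t) u` on the time set `s`,
with the initial normalisation `∫ u σ_k = |S^n|`. -/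
def NormFlow (n k : ℕ) (α β : ℝ) (f : Eu n → ℝ) (s : Set ℝ) (u : ℝ → Eu n → ℝ) : Prop :=
  (∀ t ∈ s, GoodSph (u t)) ∧
  sphInt n (fun x => u 0 x * sigmaK n k (u 0) x) = sphVol n ∧
  ∀ x ∈ sph n, ∀ t ∈ s,
    HasDerivWithinAt (fun r => u r x)
      (f x * u t x ^ α * sigmaK n k (u t) x ^ β - eta n k α β f (u t) * u t x) s t

/-- The normalised isotropic (`f ≡ 1`) flow `∂_t u = u^α σ_k^β − γ u`, where
`γ = C(n,k)^β`. -/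
def IsoNormFlow (n k : ℕ) (α β : ℝ) (s : Set ℝ) (u : ℝ → Eu n → ℝ) : Prop :=
  (∀ t ∈ s, GoodSph (u t)) ∧
  ∀ x ∈ sph n, ∀ t ∈ s,
    HasDerivWithinAt (fun r => u r x)
      (u t x ^ α * sigmaK n k (u t) x ^ β - (n.choose k : ℝ) ^ β * u t x) s t

/-- The complete polarization `σ_k[A_1,…,A_k]` of the `k`-th elementary symmetric function,
via the polarization formula for homogeneous polynomials of degree `k`. -/
def polarEsymm (n k : ℕ) (T : Fin k → (Eu n →ₗ[ℝ] Eu n)) : ℝ :=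
  (k.factorial : ℝ)⁻¹ *
    ∑ S : Finset (Fin k), (-1 : ℝ) ^ (k - S.card) * esymmOp n k (∑ i ∈ S, T i)

/-- The mixed volume `V_{k+1}(v, w_1, …, w_k) = ∫_{S^n} v σ_k[W_{w_1},…,W_{w_k}] dμ`. -/
def mixedVol (n k : ℕ) (v : Eu n → ℝ) (w : Fin k → Eu n → ℝ) : ℝ :=
  sphInt n (fun x => v x * polarEsymm n k (fun i => (hessOp (w i) x).toLinearMap))

/-! ### Mixed discriminants -/

/-- mixed discriminant -/
def mdisc (R : Type*) [CommRing R] (N : ℕ) :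
    MultilinearMap R (fun _ : Fin N => Matrix (Fin N) (Fin N) R) R :=
  ∑ σ : Equiv.Perm (Fin N), MultilinearMap.domDomCongr σ
    ((Matrix.detRowAlternating (n := Fin N) (R := R)).toMultilinearMap.compLinearMap
      (fun i => (LinearMap.proj i : (Fin N → Fin N → R) →ₗ[R] (Fin N → R))))

section
variable {R : Type*} [CommRing R] {N : ℕ}

theorem mdisc_apply (A : Fin N → Matrix (Fin N) (Fin N) R) :
    mdisc R N A = ∑ σ : Equiv.Perm (Fin N), Matrix.det (Matrix.of fun i => A (σ i) i) := by
  simp only [mdisc, MultilinearMap.sum_apply]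
  rfl

theorem mdisc_perm (A : Fin N → Matrix (Fin N) (Fin N) R) (τ : Equiv.Perm (Fin N)) :
    mdisc R N (A ∘ τ) = mdisc R N A := by
  rw [mdisc_apply, mdisc_apply]
  exact Fintype.sum_equiv (Equiv.mulLeft τ) _ _ (fun σ => rfl)

theorem mdisc_diag (A : Matrix (Fin N) (Fin N) R) :
    mdisc R N (fun _ => A) = N.factorial * A.det := by
  rw [mdisc_apply]
  simp only [Finset.sum_const, Finset.card_univ, Fintype.card_perm, Fintype.card_fin, nsmul_eq_mul]
  rfl

theorem mdisc_map {S : Type*} [CommRing S] (φ : R →+* S) (A : Fin N → Matrix (Fin N) (Fin N) R) :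
    mdisc S N (fun i => (A i).map φ) = φ (mdisc R N A) := by
  rw [mdisc_apply, mdisc_apply, map_sum]
  refine Finset.sum_congr rfl fun σ _ => ?_
  rw [RingHom.map_det]
  rfl

/-- alternating in rank one directions -/
theorem mdisc_vecMul_zero (A : Fin N → Matrix (Fin N) (Fin N) R) {i j : Fin N} (hij : i ≠ j)
    {x y z : Fin N → R} (hi : A i = Matrix.vecMulVec x y) (hj : A j = Matrix.vecMulVec z y) :
    mdisc R N A = 0 := by
  rw [mdisc_apply]
  refine Finset.sum_eq_zero fun σ _ => ?_
  set p := σ.symm i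
  set q := σ.symm j
  have hpq : p ≠ q := fun h => hij (σ.symm.injective h)
  set M : Matrix (Fin N) (Fin N) R := Matrix.of fun i => A (σ i) i
  have hp : M p = x p • y := by
    ext l; simp [M, p, hi, Matrix.vecMulVec_apply]
  have hq : M q = z q • y := by
    ext l; simp [M, q, hj, Matrix.vecMulVec_apply]
  have h1 : M = (M.updateRow p (x p • y)).updateRow q (z q • y) := by
    rw [← hp, ← hq, Matrix.updateRow_eq_self, Matrix.updateRow_eq_self]
  rw [h1, Matrix.det_updateRow_smul, Matrix.updateRow_comm _ hpq, Matrix.det_updateRow_smul]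
  rw [Matrix.det_zero_of_row_eq hpq]
  · simp
  · simp [Matrix.updateRow_self, Matrix.updateRow_ne hpq, Matrix.updateRow_ne hpq.symm]

/-- first `j` slots are `Z`, others `a` -/
def tup {M : Type*} (j : ℕ) (Z : M) (a : Fin N → M) : Fin N → M := fun i => if (i : ℕ) < j then Z else a i

theorem tup_binom (Z A : Matrix (Fin N) (Fin N) R) (z : R) (j : ℕ) (hj : j ≤ N) :
    ∀ a : Fin N → Matrix (Fin N) (Fin N) R,
    mdisc R N (tup j (Z + z • A) a) =
      ∑ m ∈ Finset.range (j + 1), (j.choose m : R) * z ^ m * mdisc R N (tup (j - m) Z (tup j A a)) := by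
  induction j with
  | zero => intro a; simp; congr 1
  | succ j ih =>
    intro a
    have ih := ih (by omega)
    let J : Fin N := ⟨j, by omega⟩
    have e0 : ∀ Y : Matrix (Fin N) (Fin N) R, ∀ b, tup (j+1) Y b = tup j Y (Function.update b J Y) := by
      intro Y b; funext i
      simp only [tup, Function.update_apply, J, Fin.ext_iff]
      split_ifs <;> first | rfl | omega
    have e1 : ∀ Y W : Matrix (Fin N) (Fin N) R, tup j Y (Function.update a J W)
        = Function.update (tup j Y a) J W := by
      intro Y W; funext i
      simp only [tup, Function.update_apply, J, Fin.ext_iff]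
      split_ifs <;> first | rfl | omega
    rw [e0, e1, MultilinearMap.map_update_add, MultilinearMap.map_update_smul, ← e1, ← e1, ih, ih]
    have s1 : ∀ m ∈ Finset.range (j+1), mdisc R N (tup (j - m) Z (tup j A (Function.update a J Z)))
        = mdisc R N (tup (j + 1 - m) Z (tup (j+1) A a)) := by
      intro m hm
      rw [Finset.mem_range] at hm
      let I : Fin N := ⟨j - m, by omega⟩
      rw [← mdisc_perm _ (Equiv.swap I J)]
      congr 1
      funext i
      simp only [Function.comp, tup, Function.update_apply, Equiv.swap_apply_def, J, I, Fin.ext_iff]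
      split_ifs <;> first | rfl | omega | (exfalso; simp_all; done) | (exfalso; simp_all; omega)
    have s2 : ∀ m ∈ Finset.range (j+1), mdisc R N (tup (j - m) Z (tup j A (Function.update a J A)))
        = mdisc R N (tup (j + 1 - (m + 1)) Z (tup (j+1) A a)) := by
      intro m hm
      rw [e0 A a, Nat.add_sub_add_right]
    set d : ℕ → R := fun m => mdisc R N (tup (j + 1 - m) Z (tup (j+1) A a))
    have t1 : ∑ m ∈ Finset.range (j+1), (j.choose m : R) * z ^ m *
        mdisc R N (tup (j - m) Z (tup j A (Function.update a J Z)))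
        = ∑ m ∈ Finset.range (j+1), (j.choose m : R) * z ^ m * d m :=
      Finset.sum_congr rfl (fun m hm => by rw [s1 m hm])
    have t2 : ∑ m ∈ Finset.range (j+1), (j.choose m : R) * z ^ m *
        mdisc R N (tup (j - m) Z (tup j A (Function.update a J A)))
        = ∑ m ∈ Finset.range (j+1), (j.choose m : R) * z ^ m * d (m+1) :=
      Finset.sum_congr rfl (fun m hm => by rw [s2 m hm])
    rw [t1, t2]
    change ∑ m ∈ Finset.range (j+1), (j.choose m : R) * z ^ m * d m
      + z • ∑ m ∈ Finset.range (j+1), (j.choose m : R) * z ^ m * d (m+1)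
      = ∑ m ∈ Finset.range (j+1+1), ((j+1).choose m : R) * z ^ m * d m
    rw [Finset.sum_range_succ' _ (j+1)]
    simp only [Nat.choose_succ_succ, Nat.cast_add, add_mul, Finset.sum_add_distrib]
    have := Finset.sum_range_succ' (fun m => (j.choose m : R) * z ^ m * d m) (j+1)
    have h2 := Finset.sum_range_succ (fun m => (j.choose m : R) * z ^ m * d m) (j+1)
    simp only [Nat.choose_succ_self, Nat.cast_zero, zero_mul, add_zero] at h2
    rw [← h2, this, smul_eq_mul, Finset.mul_sum]
    have h3 : ∑ i ∈ Finset.range (j+1), z * ((j.choose i : R) * z ^ i * d (i+1))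
      = ∑ i ∈ Finset.range (j+1), (j.choose i : R) * z ^ (i+1) * d (i+1) :=
      Finset.sum_congr rfl fun i _ => by ring
    rw [h3]; simp only [Nat.choose_zero_right]; ring

end

/-- polarization -/
theorem sym_polar {R V : Type*} [CommRing R] [AddCommGroup V] [Module R V] (m : ℕ)
    (f : MultilinearMap R (fun _ : Fin m => V) R)
    (hf : ∀ (A : Fin m → V) (τ : Equiv.Perm (Fin m)), f (A ∘ τ) = f A) (T : Fin m → V) :
    ∑ S : Finset (Fin m), (-1 : R) ^ (m - S.card) * f (fun _ => ∑ i ∈ S, T i)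
      = m.factorial * f T := by
  classical
  have h1 : ∀ S : Finset (Fin m), f (fun _ => ∑ i ∈ S, T i) =
      ∑ r : Fin m → Fin m, if (∀ i, r i ∈ S) then f (fun i => T (r i)) else 0 := by
    intro S
    rw [f.map_sum_finset (fun _ i => T i) (fun _ => S), ← Finset.sum_filter]
    refine Finset.sum_congr ?_ fun _ _ => rfl
    ext r; simp [Fintype.mem_piFinset]
  simp_rw [h1, Finset.mul_sum]
  rw [Finset.sum_comm]
  have h2 : ∀ r : Fin m → Fin m, ∑ S : Finset (Fin m), (-1 : R) ^ (m - S.card) *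
      (if (∀ i, r i ∈ S) then f (fun i => T (r i)) else 0)
      = if Function.Bijective r then f T else 0 := by
    intro r
    have e : ∀ S : Finset (Fin m), (∀ i, r i ∈ S) ↔ Sᶜ ∈ (Finset.image r Finset.univ)ᶜ.powerset := by
      intro S
      rw [Finset.mem_powerset, Finset.compl_subset_compl]
      simp [Finset.subset_iff]
    have : ∑ S : Finset (Fin m), (-1 : R) ^ (m - S.card) *
      (if (∀ i, r i ∈ S) then f (fun i => T (r i)) else 0)
      = (∑ S ∈ (Finset.image r Finset.univ)ᶜ.powerset, (-1 : R) ^ S.card) * f (fun i => T (r i)) := by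
      rw [Finset.sum_mul, ← Finset.sum_filter_add_sum_filter_not Finset.univ
        (fun S : Finset (Fin m) => ∀ i, r i ∈ S)]
      rw [Finset.sum_congr rfl (g := fun S => (-1 : R) ^ (m - S.card) * f (fun i => T (r i)))
        (fun S hS => by rw [if_pos (Finset.mem_filter.1 hS).2])]
      rw [Finset.sum_eq_zero (s := Finset.filter (fun S => ¬ _) _)
        (fun S hS => by rw [if_neg (Finset.mem_filter.1 hS).2, mul_zero]), add_zero]
      refine Finset.sum_nbij' (fun S => Sᶜ) (fun S => Sᶜ) ?_ ?_ ?_ ?_ ?_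
      · intro S hS; exact (e S).1 (Finset.mem_filter.1 hS).2
      · intro S hS; refine Finset.mem_filter.2 ⟨Finset.mem_univ _, (e _).2 ?_⟩
        rwa [compl_compl]
      · intro S _; exact compl_compl S
      · intro S _; exact compl_compl S
      · intro S _; rw [Finset.card_compl, Fintype.card_fin]
    rw [this]
    split_ifs with hr
    · have : (Finset.image r Finset.univ)ᶜ = ∅ := by
        rw [Finset.image_univ_of_surjective hr.2]; simp
      rw [this]
      simp only [Finset.powerset_empty, Finset.sum_singleton, Finset.card_empty, pow_zero, one_mul]
      exact hf T (Equiv.ofBijective r hr)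
    · have : ((Finset.image r Finset.univ)ᶜ).Nonempty := by
        rw [Finset.nonempty_iff_ne_empty]
        intro h
        apply hr
        rw [Finset.compl_eq_empty_iff] at h
        have : Function.Surjective r := by
          intro y; have := Finset.mem_univ y; rw [← h] at this; simpa using this
        exact ⟨Finite.injective_iff_surjective.2 this, this⟩
      have h0 := Finset.sum_powerset_neg_one_pow_card_of_nonempty this
      have h0' : ((∑ S ∈ (Finset.image r Finset.univ)ᶜ.powerset, (-1 : ℤ) ^ S.card : ℤ) : R) = 0 := by
        rw [h0]; simp
      push_cast at h0'
      rw [h0', zero_mul]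
  rw [Finset.sum_congr rfl fun r _ => h2 r, ← Finset.sum_filter, Finset.sum_const, nsmul_eq_mul]
  congr 2
  rw [← Fintype.card_subtype]
  have := Fintype.card_perm (α := Fin m)
  rw [Fintype.card_fin] at this
  rw [← this]
  exact Fintype.card_congr Equiv.bijectiveEquiv

abbrev Mt (N : ℕ) := Matrix (Fin N) (Fin N) ℝ

theorem sym_of_swap {R V : Type*} [CommRing R] [AddCommGroup V] [Module R V] {m : ℕ}
    (f : MultilinearMap R (fun _ : Fin m => V) R)
    (hf : ∀ (A : Fin m → V) (i j : Fin m), i ≠ j → f (A ∘ Equiv.swap i j) = f A)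
    (A : Fin m → V) (τ : Equiv.Perm (Fin m)) : f (A ∘ τ) = f A := by
  induction τ using Equiv.Perm.swap_induction_on generalizing A with
  | one => rfl
  | swap_mul g x y hxy ih =>
    rw [Equiv.Perm.coe_mul, ← Function.comp_assoc, ih, hf _ _ _ hxy]

theorem sym_ext {V : Type*} [AddCommGroup V] [Module ℝ V] (m : ℕ)
    (f g : MultilinearMap ℝ (fun _ : Fin m => V) ℝ)
    (hf : ∀ (A : Fin m → V) (τ : Equiv.Perm (Fin m)), f (A ∘ τ) = f A)
    (hg : ∀ (A : Fin m → V) (τ : Equiv.Perm (Fin m)), g (A ∘ τ) = g A)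
    (h : ∀ v, f (fun _ => v) = g (fun _ => v)) (T : Fin m → V) : f T = g T := by
  have h1 := sym_polar m f hf T
  have h2 := sym_polar m g hg T
  simp_rw [h] at h1
  rw [h1] at h2
  have : (m.factorial : ℝ) ≠ 0 := by positivity
  exact mul_left_cancel₀ this h2

theorem mdisc_conj {N : ℕ} (P Q : Mt N) (A : Fin N → Mt N) :
    mdisc ℝ N (fun i => P * A i * Q) = P.det * Q.det * mdisc ℝ N A := by
  let l : Mt N →ₗ[ℝ] Mt N :=
    (LinearMap.mulRight ℝ Q).comp (LinearMap.mulLeft ℝ P)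
  have := sym_ext N ((mdisc ℝ N).compLinearMap (fun _ => l)) ((P.det * Q.det) • mdisc ℝ N)
    (fun A τ => mdisc_perm (fun i => l (A i)) τ)
    (fun A τ => by simp only [MultilinearMap.smul_apply, mdisc_perm])
    (fun v => by
      change mdisc ℝ N (fun _ => P * v * Q) = P.det * Q.det * mdisc ℝ N (fun _ => v)
      rw [mdisc_diag, mdisc_diag, Matrix.det_mul, Matrix.det_mul]; ring) A
  exact this

/-- radial degeneracy -/
theorem mdisc_rad {N : ℕ} (A : Fin N → Mt N) (i : Fin N) (a x : Fin N → ℝ)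
    (hx : x ⬝ᵥ x = 1) (hax : a ⬝ᵥ x = 0) (hi : A i = Matrix.vecMulVec a x)
    (h : ∀ j, j ≠ i → A j = 1 ∨ ((A j).IsSymm ∧ (A j).mulVec x = 0)) : mdisc ℝ N A = 0 := by
  set P : Mt N := 1 - (2:ℝ) • Matrix.vecMulVec x x with hP
  have hPP : P * P = 1 := by
    rw [hP, sub_mul, mul_sub, mul_sub]
    simp only [Matrix.mul_one, Matrix.one_mul, Matrix.smul_mul, Matrix.mul_smul,
      Matrix.vecMulVec_mul_vecMulVec, hx, one_smul]
    module
  have hdet : P.det * P.det = 1 := by rw [← Matrix.det_mul, hPP, Matrix.det_one]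
  have h1 := mdisc_conj P P A
  rw [hdet, one_mul] at h1
  have h2 : (fun j => P * A j * P) = Function.update A i (-(A i)) := by
    funext j
    by_cases hj : j = i
    · subst hj
      rw [Function.update_self, hi, hP]
      simp only [Matrix.sub_mul, Matrix.mul_sub, Matrix.mul_one, Matrix.one_mul, Matrix.smul_mul, Matrix.mul_smul,
        Matrix.vecMulVec_mul_vecMulVec, hx, one_smul, dotProduct_comm x a, hax, zero_smul,
        Matrix.zero_vecMulVec]
      simp
      module
    · rw [Function.update_of_ne hj]
      rcases h j hj with h | ⟨hs, hk⟩
      · rw [h, Matrix.mul_one, hPP]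
      · have e1 : A j * Matrix.vecMulVec x x = 0 := by
          rw [Matrix.mul_vecMulVec, hk, Matrix.zero_vecMulVec]
        have e2 : Matrix.vecMulVec x x * A j = 0 := by
          rw [Matrix.vecMulVec_mul, ← Matrix.mulVec_transpose, hs.eq, hk, Matrix.vecMulVec_zero]
        rw [hP, sub_mul, mul_sub, sub_mul]
        simp [e1, e2]
  rw [h2] at h1
  have h3 := (mdisc ℝ N).map_update_smul A i (-1 : ℝ) (A i)
  simp only [neg_smul, one_smul, Function.update_eq_self] at h3
  linarith

theorem mdisc_two {N : ℕ} (hN : 2 ≤ N) : ∃ c : ℝ, 0 < c ∧ ∀ A : Fin N → Mt N,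
    (∀ i : Fin N, 2 ≤ (i:ℕ) → A i = 1) → mdisc ℝ N A =
      c * ((A ⟨0, by omega⟩).trace * (A ⟨1, by omega⟩).trace - (A ⟨0, by omega⟩ * A ⟨1, by omega⟩).trace) := by
  classical
  let i0 : Fin N := ⟨0, by omega⟩
  let i1 : Fin N := ⟨1, by omega⟩
  have h01 : i0 ≠ i1 := by simp [i0, i1]
  let F : Fin N → Fin N → Finset (Equiv.Perm (Fin N)) := fun p q =>
    Finset.univ.filter fun σ => σ.symm i0 = p ∧ σ.symm i1 = q
  have hF : ∀ p q, p ≠ q → (F p q).card = (F i0 i1).card := by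
    intro p q hpq
    obtain ⟨τ, h1, h2⟩ : ∃ τ : Equiv.Perm (Fin N), τ i0 = p ∧ τ i1 = q := by
      refine ⟨(Equiv.swap (Equiv.swap i0 p i1) q) * (Equiv.swap i0 p), ?_, ?_⟩
      · simp only [Equiv.Perm.mul_apply, Equiv.swap_apply_left]
        rw [Equiv.swap_apply_of_ne_of_ne _ hpq]
        intro h
        have := (Equiv.swap i0 p).injective ((Equiv.swap_apply_left i0 p).trans h)
        exact h01 this
      · simp
    refine Finset.card_bij' (fun σ _ => σ * τ) (fun σ _ => σ * τ⁻¹) ?_ ?_ ?_ ?_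
    · intro σ hσ
      simp only [F, Finset.mem_filter, Finset.mem_univ, true_and, Equiv.symm_apply_eq,
        Equiv.Perm.mul_apply] at hσ ⊢
      rw [h1, h2]; exact hσ
    · intro σ hσ
      simp only [F, Finset.mem_filter, Finset.mem_univ, true_and, Equiv.symm_apply_eq,
        Equiv.Perm.mul_apply] at hσ ⊢
      rw [← h1, ← h2]; simpa using hσ
    · intro σ _; simp
    · intro σ _; simp
  refine ⟨(F i0 i1).card, ?_, ?_⟩
  · have : (1 : Equiv.Perm (Fin N)) ∈ F i0 i1 := by simp [F]; exact ⟨rfl, rfl⟩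
    exact_mod_cast Finset.card_pos.2 ⟨_, this⟩
  intro A hA
  set B := A i0
  set C := A i1
  have key : ∀ σ : Equiv.Perm (Fin N), Matrix.det (Matrix.of fun i => A (σ i) i)
      = B (σ.symm i0) (σ.symm i0) * C (σ.symm i1) (σ.symm i1)
        - B (σ.symm i0) (σ.symm i1) * C (σ.symm i1) (σ.symm i0) := by
    intro σ
    set p := σ.symm i0
    set q := σ.symm i1
    have hpq : p ≠ q := fun h => h01 (σ.symm.injective h)
    let U : Matrix (Fin N) (Fin 2) ℝ := Matrix.of fun i => ![if i = p then 1 else 0, if i = q then 1 else 0]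
    let V : Matrix (Fin 2) (Fin N) ℝ := Matrix.of ![fun j => B p j - (1:Mt N) p j, fun j => C q j - (1 : Mt N) q j]
    have e : (Matrix.of fun i => A (σ i) i) = 1 + U * V := by
      ext i j
      simp only [Matrix.of_apply, Matrix.add_apply, Matrix.mul_apply, Fin.sum_univ_two, U, V,
        Matrix.cons_val_zero, Matrix.cons_val_one]
      by_cases hip : i = p
      · have : σ i = i0 := by rw [hip]; simp [p]
        rw [this, hip]; simp [hpq, B]
      · by_cases hiq : i = q
        · have : σ i = i1 := by rw [hiq]; simp [q]
          rw [this, hiq]; simp [hpq.symm, C]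
        · rw [hA]
          · simp [hip, hiq]
          · have a1 : σ i ≠ i0 := fun h => hip (by simp [p, ← h])
            have a2 : σ i ≠ i1 := fun h => hiq (by simp [q, ← h])
            simp only [i0, i1, ne_eq, Fin.ext_iff] at a1 a2
            omega
    rw [e, Matrix.det_one_add_mul_comm, Matrix.det_fin_two]
    have f1 : ∀ f : Fin N → ℝ, ∑ x, f x * (if x = p then 1 else 0) = f p := by intro f; simp
    have f2 : ∀ f : Fin N → ℝ, ∑ x, f x * (if x = q then 1 else 0) = f q := by intro f; simp
    have v00 : (V * U) 0 0 = B p p - 1 := by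
      rw [Matrix.mul_apply]; exact (f1 _).trans (by simp [V])
    have v01 : (V * U) 0 1 = B p q := by
      rw [Matrix.mul_apply]; exact (f2 _).trans (by simp [V, Matrix.one_apply, hpq])
    have v10 : (V * U) 1 0 = C q p := by
      rw [Matrix.mul_apply]; exact (f1 _).trans (by simp [V, Matrix.one_apply, hpq.symm])
    have v11 : (V * U) 1 1 = C q q - 1 := by
      rw [Matrix.mul_apply]; exact (f2 _).trans (by simp [V])
    simp only [Matrix.add_apply, v00, v01, v10, v11, Matrix.one_apply]
    norm_num
  rw [mdisc_apply]
  simp_rw [key]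
  have : ∑ σ : Equiv.Perm (Fin N), (B (σ.symm i0) (σ.symm i0) * C (σ.symm i1) (σ.symm i1)
        - B (σ.symm i0) (σ.symm i1) * C (σ.symm i1) (σ.symm i0))
      = ∑ p, ∑ q, ∑ σ ∈ F p q, (B p p * C q q - B p q * C q p) := by
    rw [← Finset.sum_fiberwise (s := Finset.univ) (g := fun σ : Equiv.Perm (Fin N) => σ.symm i0)]
    refine Finset.sum_congr rfl fun p _ => ?_
    rw [← Finset.sum_fiberwise (s := Finset.filter _ _) (g := fun σ : Equiv.Perm (Fin N) => σ.symm i1)]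
    refine Finset.sum_congr rfl fun q _ => ?_
    rw [Finset.filter_filter]
    refine Finset.sum_congr rfl fun σ hσ => ?_
    obtain ⟨-, h1, h2⟩ := Finset.mem_filter.1 hσ
    rw [h1, h2]
  rw [this]
  have h2 : ∀ p q, ∑ σ ∈ F p q, (B p p * C q q - B p q * C q p)
      = (F i0 i1).card * (B p p * C q q - B p q * C q p) := by
    intro p q
    rw [Finset.sum_const, nsmul_eq_mul]
    by_cases h : p = q
    · subst h; ring
    · rw [hF p q h]
  simp_rw [h2, ← Finset.mul_sum]
  congr 1
  simp only [Finset.sum_sub_distrib, Matrix.trace, Matrix.diag_apply, Matrix.mul_apply,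
    Finset.sum_mul_sum]

theorem tup_tup {N : ℕ} {M : Type*} (j l : ℕ) (h : l ≤ j) (Z A : M) (a : Fin N → M) :
    tup j Z (tup l A a) = tup j Z a := by
  funext i; simp only [tup]; split_ifs <;> first | rfl | omega

theorem tup_full {N : ℕ} {M : Type*} (Z : M) (a : Fin N → M) : tup N Z a = fun _ => Z := by
  funext i; simp [tup]

theorem mdisc_tup_smul {R : Type*} [CommRing R] {N : ℕ} (j : ℕ) (hj : j ≤ N) (c : R)
    (Z : Matrix (Fin N) (Fin N) R) (a) :
    mdisc R N (tup j (c • Z) a) = c ^ j * mdisc R N (tup j Z a) := by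
  have := (mdisc R N).map_smul_univ (fun i : Fin N => if (i:ℕ) < j then c else 1) (tup j Z a)
  rw [smul_eq_mul, Finset.prod_ite] at this
  simp only [Finset.prod_const, one_pow, mul_one] at this
  have hc : (Finset.univ.filter fun i : Fin N => (i:ℕ) < j).card = j := by
    rw [Fin.card_filter_val_lt]; omega
  rw [hc] at this
  rw [← this]
  congr 1
  funext i; simp only [tup]; split_ifs <;> simp

theorem charpoly_coeff_mdisc {N k : ℕ} (hk : k ≤ N) (A : Mt N) :
    (N.factorial : ℝ) * ((-1) ^ k * A.charpoly.coeff (N - k)) =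
      N.choose k * mdisc ℝ N (tup k A 1) := by
  have h1 := mdisc_diag A.charmatrix
  have h0 : A.charmatrix = (-(A.map Polynomial.C)) + (Polynomial.X : Polynomial ℝ) • (1 : Matrix (Fin N) (Fin N) (Polynomial ℝ)) := by
    rw [Matrix.charmatrix]
    refine Matrix.ext fun i j => ?_
    simp only [Matrix.sub_apply, Matrix.add_apply, Matrix.neg_apply, Matrix.smul_apply, Matrix.map_apply,
      Matrix.scalar_apply, Matrix.diagonal_apply, Matrix.one_apply, RingHom.mapMatrix_apply]
    split_ifs <;> simp
    ring
  rw [← tup_full A.charmatrix 1, h0, tup_binom _ _ _ _ le_rfl, ← h0, ← Matrix.charpoly] at h1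
  have h2 : ∀ m, mdisc (Polynomial ℝ) N (tup (N - m) (-(A.map Polynomial.C)) (tup N 1 1))
      = Polynomial.C (mdisc ℝ N (tup (N - m) (-A) 1)) := by
    intro m
    rw [← mdisc_map]
    congr 1
    funext i
    simp only [tup]
    split_ifs
    · refine Matrix.ext fun a b => ?_
      simp [Matrix.map_apply, Matrix.neg_apply]
    · exact (Matrix.map_one _ (map_zero _) (map_one _)).symm
    · exact (Matrix.map_one _ (map_zero _) (map_one _)).symm
  simp_rw [h2] at h1
  have h3 := congrArg (fun p => p.coeff (N - k)) h1
  simp only [Polynomial.finsetSum_coeff] at h3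
  have h4 : ∀ m, ((N.choose m : Polynomial ℝ) * Polynomial.X ^ m * Polynomial.C (mdisc ℝ N (tup (N - m) (-A) 1))).coeff (N - k)
     = if m = N - k then (N.choose m : ℝ) * mdisc ℝ N (tup (N - m) (-A) 1) else 0 := by
    intro m
    rw [← Polynomial.C_eq_natCast, mul_assoc, Polynomial.coeff_C_mul, Polynomial.coeff_mul_C, Polynomial.coeff_X_pow]
    simp [eq_comm]
  simp_rw [h4] at h3
  rw [Finset.sum_ite_eq' (Finset.range (N+1)) (N-k), if_pos (Finset.mem_range.2 (by omega)), Nat.choose_symm hk,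
    Nat.sub_sub_self hk, ← Polynomial.C_eq_natCast, Polynomial.coeff_C_mul] at h3
  have h5 := mdisc_tup_smul k hk (-1 : ℝ) A 1
  rw [neg_one_smul] at h5
  rw [h5] at h3
  have : ((-1:ℝ)^k) * (-1)^k = 1 := by rw [← mul_pow]; simp
  linear_combination (-(-1:ℝ)^k) * h3 + N.choose k * mdisc ℝ N (tup k A 1) * this

/-- matrix tuple with identities appended -/
def app1 {N k : ℕ} (T : Fin k → Mt N) : Fin N → Mt N := fun i => if h : (i:ℕ) < k then T ⟨i, h⟩ else 1

theorem app1_update {N k : ℕ} (hk : k ≤ N) (T : Fin k → Mt N) [DecidableEq (Fin k)] (i : Fin k) (B : Mt N) :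
    app1 (Function.update T i B) = Function.update (app1 T) (Fin.castLE hk i) B := by
  funext j
  simp only [app1, Function.update_apply, Fin.ext_iff, Fin.val_castLE]
  split_ifs <;> first | rfl | omega

def mdiscK {N k : ℕ} (hk : k ≤ N) : MultilinearMap ℝ (fun _ : Fin k => Mt N) ℝ where
  toFun T := mdisc ℝ N (app1 T)
  map_update_add' T i x y := by simp only [app1_update hk, MultilinearMap.map_update_add]
  map_update_smul' T i x y := by simp only [app1_update hk, MultilinearMap.map_update_smul]

theorem mdiscK_perm {N k : ℕ} (hk : k ≤ N) (T : Fin k → Mt N) (τ : Equiv.Perm (Fin k)) :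
    mdiscK hk (T ∘ τ) = mdiscK hk T := by
  refine sym_of_swap _ (fun A i j _ => ?_) T τ
  change mdisc ℝ N _ = mdisc ℝ N _
  rw [← mdisc_perm (app1 A) (Equiv.swap (Fin.castLE hk i) (Fin.castLE hk j))]
  congr 1
  funext l
  simp only [app1, Function.comp, Equiv.swap_apply_def, Fin.ext_iff, Fin.val_castLE]
  split_ifs <;> first | rfl | omega | skip
  all_goals (exfalso; simp_all)

/-- matrix of an operator -/
def opM {n : ℕ} (T : Eu n →ₗ[ℝ] Eu n) : Mt (n+1) :=
  LinearMap.toMatrix (EuclideanSpace.basisFun (Fin (n+1)) ℝ).toBasis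
    (EuclideanSpace.basisFun (Fin (n+1)) ℝ).toBasis T

theorem opM_apply {n : ℕ} (T : Eu n →ₗ[ℝ] Eu n) (i j) : opM T i j = T (EuclideanSpace.single j 1) i := by
  simp [opM, LinearMap.toMatrix_apply]

theorem esymmOp_eq {n k : ℕ} (hk : k ≤ n+1) (T : Eu n →ₗ[ℝ] Eu n) :
    esymmOp n k T = ((n+1).choose k / (n+1).factorial : ℝ) * mdisc ℝ (n+1) (tup k (opM T) 1) := by
  have := charpoly_coeff_mdisc hk (opM T)
  rw [opM, LinearMap.charpoly_toMatrix] at this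
  rw [esymmOp]
  have hf : ((n+1).factorial : ℝ) ≠ 0 := by positivity
  field_simp
  rw [mul_comm]
  exact this

theorem polarEsymm_eq {n k : ℕ} (hk : k ≤ n+1) (T : Fin k → (Eu n →ₗ[ℝ] Eu n)) :
    polarEsymm n k T = ((n+1).choose k / (n+1).factorial : ℝ) *
      mdisc ℝ (n+1) (app1 fun i => opM (T i)) := by
  have h := sym_polar k (mdiscK hk) (mdiscK_perm hk) (fun i => opM (T i))
  have e : ∀ S : Finset (Fin k), esymmOp n k (∑ i ∈ S, T i) =
      ((n+1).choose k / (n+1).factorial : ℝ) * mdiscK hk (fun _ => ∑ i ∈ S, opM (T i)) := by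
    intro S
    rw [esymmOp_eq hk]
    congr 1
    change _ = mdisc ℝ (n+1) _
    congr 1
    funext i
    simp only [tup, app1, opM, map_sum]
    split_ifs <;> rfl
  rw [polarEsymm]
  simp_rw [e]
  have : ∀ S : Finset (Fin k), (-1:ℝ)^(k - S.card) * (((n+1).choose k / (n+1).factorial : ℝ) * mdiscK hk (fun _ => ∑ i ∈ S, opM (T i)))
     = ((n+1).choose k / (n+1).factorial : ℝ) * ((-1:ℝ)^(k - S.card) * mdiscK hk (fun _ => ∑ i ∈ S, opM (T i))) := by
    intro S; ring
  simp_rw [this, ← Finset.mul_sum]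
  rw [h]
  have hf : (k.factorial : ℝ) ≠ 0 := by positivity
  field_simp
  rfl

/-! ### Garding theory -/

theorem mdisc_continuous {R X : Type*} [CommRing R] [TopologicalSpace R] [IsTopologicalRing R]
    [TopologicalSpace X] {N : ℕ} (A : X → Fin N → Matrix (Fin N) (Fin N) R)
    (hA : ∀ i, Continuous fun x => A x i) : Continuous fun x => mdisc R N (A x) := by
  simp only [mdisc_apply]
  refine continuous_finsetSum _ fun σ _ => Continuous.matrix_det ?_
  refine continuous_matrix fun i j => ?_
  exact (hA (σ i)).matrix_elem i j

theorem tup_continuous {X M : Type*} [TopologicalSpace X] [TopologicalSpace M] {N : ℕ} {j : ℕ}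
    {Z : X → M} {a : X → Fin N → M} (hZ : Continuous Z) (ha : ∀ i, Continuous fun x => a x i) (i : Fin N) :
    Continuous fun x => tup j (Z x) (a x) i := by
  simp only [tup]; split_ifs
  · exact hZ
  · exact ha i

abbrev Mc (N : ℕ) := Matrix (Fin N) (Fin N) ℂ

/-- complexification -/
def cm {N : ℕ} (A : Mt N) : Mc N := A.map (algebraMap ℝ ℂ)

theorem cm_add {N : ℕ} (A B : Mt N) : cm (A + B) = cm A + cm B := by
  ext; simp [cm]
theorem cm_smul {N : ℕ} (r : ℝ) (B : Mt N) : cm (r • B) = (r : ℂ) • cm B := by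
  ext; simp [cm]
theorem cm_one {N : ℕ} : cm (1 : Mt N) = 1 := by
  simp [cm]
theorem cm_zero {N : ℕ} : cm (0 : Mt N) = 0 := by
  simp [cm]

theorem cm_tup {N j : ℕ} (A : Mt N) (a : Fin N → Mt N) : tup j (cm A) (fun i => cm (a i)) = fun i => cm (tup j A a i) := by
  funext i; simp only [tup]; split_ifs <;> rfl

theorem mdisc_cm {N : ℕ} (a : Fin N → Mt N) : mdisc ℂ N (fun i => cm (a i)) = (mdisc ℝ N a : ℂ) :=
  mdisc_map (algebraMap ℝ ℂ) a

theorem tup_self {N j : ℕ} {M : Type*} (a : M) : tup (N := N) j a (fun _ => a) = fun _ => a := by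
  funext i; simp [tup]

def gpoly {N : ℕ} (j : ℕ) (Z A : Mc N) (a : Fin N → Mc N) : Polynomial ℂ :=
  ∑ m ∈ Finset.range (j+1), Polynomial.C ((j.choose m : ℂ) * mdisc ℂ N (tup (j - m) Z (tup j A a))) * Polynomial.X ^ m

theorem gpoly_eval {N : ℕ} (j : ℕ) (hj : j ≤ N) (Z A : Mc N) (a : Fin N → Mc N) (z : ℂ) :
    (gpoly j Z A a).eval z = mdisc ℂ N (tup j (Z + z • A) a) := by
  rw [tup_binom Z A z j hj, gpoly, Polynomial.eval_finsetSum]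
  refine Finset.sum_congr rfl fun m _ => ?_
  simp; ring

theorem gpoly_coeff {N : ℕ} (j m : ℕ) (Z A : Mc N) (a : Fin N → Mc N) (hm : m ≤ j) :
    (gpoly j Z A a).coeff m = (j.choose m : ℂ) * mdisc ℂ N (tup (j - m) Z (tup j A a)) := by
  rw [gpoly, Polynomial.finsetSum_coeff]
  simp only [Polynomial.coeff_C_mul_X_pow]
  rw [Finset.sum_ite_eq, if_pos (Finset.mem_range.2 (by omega))]

theorem gpoly_natDegree_le {N : ℕ} (j : ℕ) (Z A : Mc N) (a : Fin N → Mc N) :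
    (gpoly j Z A a).natDegree ≤ j := by
  rw [gpoly]
  refine Polynomial.natDegree_sum_le_of_forall_le _ _ fun m hm => ?_
  exact (Polynomial.natDegree_C_mul_X_pow_le _ _).trans (by rw [Finset.mem_range] at hm; omega)

theorem tup_zero {N : ℕ} {M : Type*} (Z : M) (a : Fin N → M) : tup 0 Z a = a := by
  funext i; simp [tup]

theorem GLstep {N j : ℕ} (hj1 : 1 ≤ j) (hj : j ≤ N) (Z A : Mc N) (a : Fin N → Mc N)
    (h1 : ∀ z : ℂ, 0 ≤ z.im → mdisc ℂ N (tup j (Z + z • A) a) ≠ 0)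
    (h2 : mdisc ℂ N (tup j A a) ≠ 0) : mdisc ℂ N (tup (j-1) Z (tup j A a)) ≠ 0 := by
  set p := gpoly j Z A a with hp
  have hcj : p.coeff j ≠ 0 := by
    rw [hp, gpoly_coeff j j _ _ _ le_rfl, Nat.sub_self, tup_zero]; simpa using h2
  have hdj : p.natDegree = j :=
    le_antisymm (gpoly_natDegree_le _ _ _ _) (Polynomial.le_natDegree_of_ne_zero hcj)
  intro h
  have h0 : p.derivative.eval 0 = 0 := by
    rw [← Polynomial.coeff_zero_eq_eval_zero, Polynomial.coeff_derivative, zero_add,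
      hp, gpoly_coeff j 1 _ _ _ hj1, h]; simp
  have hd : p.derivative ≠ 0 := by
    intro hd
    have := Polynomial.natDegree_eq_zero_of_derivative_eq_zero hd
    omega
  have hmem : (0:ℂ) ∈ p.derivative.rootSet ℂ := by
    rw [Polynomial.mem_rootSet]; exact ⟨hd, by simpa using h0⟩
  have hpd : 0 < p.degree := Polynomial.natDegree_pos_iff_degree_pos.1 (by omega)
  have hcv := Polynomial.rootSet_derivative_subset_convexHull_rootSet hpd hmem
  have hsub : convexHull ℝ (p.rootSet ℂ) ⊆ {z : ℂ | z.im < 0} := by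
    refine convexHull_min ?_ (convex_halfSpace_im_lt 0)
    intro z hz
    rw [Polynomial.mem_rootSet] at hz
    by_contra hn
    refine h1 z (not_lt.1 hn) ?_
    rw [← gpoly_eval j hj]; simpa using hz.2
  exact absurd (hsub hcv) (by simp)

theorem det_herm_ne {N : ℕ} (X : Mt N) (hX : X.IsSymm) (z : ℂ) (hz : z.im ≠ 0) :
    (cm X + z • (1 : Mc N)).det ≠ 0 := by
  have hH : (cm X).IsHermitian := by
    ext i j
    simp only [cm, Matrix.conjTranspose_apply, Matrix.map_apply]
    rw [← hX.apply i j]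
    simp
  have h1 := Matrix.eval_charpoly (cm X) (-z)
  rw [hH.charpoly_eq, Polynomial.eval_prod] at h1
  have h2 : (Matrix.scalar (Fin N) (-z) - cm X) = - (cm X + z • (1 : Mc N)) := by
    rw [Matrix.scalar_apply, ← Matrix.smul_one_eq_diagonal]; module
  rw [h2] at h1
  intro h0
  rw [Matrix.det_neg, h0, mul_zero] at h1
  obtain ⟨i, _, hi⟩ := Finset.prod_eq_zero_iff.1 h1
  apply hz
  have := congrArg Complex.im hi
  simpa using this

theorem ek_ne {N : ℕ} (j : ℕ) (hj : j ≤ N) : ∀ (X : Mt N), X.IsSymm → ∀ z : ℂ, 0 < z.im →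
    mdisc ℂ N (tup j (cm X + z • (1 : Mc N)) (fun _ => 1)) ≠ 0 := by
  induction hj using Nat.decreasingInduction with
  | self =>
    intro X hX z hz
    rw [tup_full, mdisc_diag]
    exact mul_ne_zero (by exact_mod_cast N.factorial_ne_zero) (det_herm_ne X hX z hz.ne')
  | of_succ j hj ih =>
    intro X hX z hz
    have := GLstep (N := N) (j := j+1) (by omega) hj (cm X + z • (1 : Mc N)) 1 (fun _ => 1) ?_ ?_
    · rwa [tup_self, Nat.add_sub_cancel] at this
    · intro w hw
      have e : cm X + z • (1 : Mc N) + w • (1 : Mc N) = cm X + (z + w) • (1 : Mc N) := by module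
      rw [e]
      exact ih X hX _ (by simp; linarith)
    · rw [tup_self, mdisc_diag, Matrix.det_one, mul_one]
      exact_mod_cast N.factorial_ne_zero

/-- the Garding cone -/
def Gam (N k : ℕ) : Set (Mt N) :=
  {A | A.IsSymm ∧ ∀ j, 1 ≤ j → j ≤ k → 0 < mdisc ℝ N (tup j A (fun _ => 1))}

theorem mdisc_one_pos {N : ℕ} : 0 < mdisc ℝ N (fun _ => 1) := by
  rw [mdisc_diag, Matrix.det_one, mul_one]; positivity

theorem Gam.pos {N k : ℕ} {A : Mt N} (hA : A ∈ Gam N k) (j : ℕ) (hj : j ≤ k) :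
    0 < mdisc ℝ N (tup j A (fun _ => 1)) := by
  rcases Nat.eq_zero_or_pos j with h | h
  · subst h; rw [tup_zero]; exact mdisc_one_pos
  · exact hA.2 j h hj

theorem Gam.mono {N j k : ℕ} (h : j ≤ k) : Gam N k ⊆ Gam N j :=
  fun _ hA => ⟨hA.1, fun i h1 h2 => hA.2 i h1 (h2.trans h)⟩

theorem Gam.one {N k : ℕ} : (1 : Mt N) ∈ Gam N k :=
  ⟨Matrix.isSymm_one, fun j _ _ => by rw [tup_self]; exact mdisc_one_pos⟩

theorem Gam.smul {N k : ℕ} (hk : k ≤ N) {A : Mt N} (hA : A ∈ Gam N k) {c : ℝ} (hc : 0 < c) : c • A ∈ Gam N k :=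
  ⟨hA.1.smul c, fun j h1 h2 => by
    rw [mdisc_tup_smul j (h2.trans hk)]; exact mul_pos (pow_pos hc _) (hA.2 j h1 h2)⟩

theorem Gam.root {N k : ℕ} (hk : k ≤ N) {A : Mt N} (hA : A ∈ Gam N k) (z : ℂ)
    (hz : mdisc ℂ N (tup k (cm A + z • (1 : Mc N)) (fun _ => 1)) = 0) : z.im = 0 ∧ z.re < 0 := by
  have h1 : z.im = 0 := by
    rcases lt_trichotomy z.im 0 with h | h | h
    · exfalso
      refine ek_ne k hk (-A) hA.1.neg (-z) (by simpa using h) ?_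
      have e : cm (-A) + (-z) • (1 : Mc N) = (-1 : ℂ) • (cm A + z • (1 : Mc N)) := by
        have := cm_smul (-1) A
        rw [neg_one_smul] at this
        rw [this]; push_cast; module
      rw [e, mdisc_tup_smul k hk, hz, mul_zero]
    · exact h
    · exact absurd hz (ek_ne k hk A hA.1 z h)
  refine ⟨h1, ?_⟩
  by_contra hn
  push Not at hn
  have hz' : z = (z.re : ℂ) := Complex.ext (by simp) (by simpa using h1)
  rw [hz', ← cm_one, ← cm_smul, ← cm_add, cm_tup, mdisc_cm, Complex.ofReal_eq_zero,
    tup_binom _ _ _ _ hk] at hz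
  have : 0 < ∑ m ∈ Finset.range (k + 1), (k.choose m : ℝ) * z.re ^ m *
      mdisc ℝ N (tup (k - m) A (tup k 1 fun _ => 1)) := by
    rw [tup_self, Finset.sum_range_succ']
    refine add_pos_of_nonneg_of_pos (Finset.sum_nonneg fun m _ => ?_) ?_
    · have := Gam.pos hA (k - (m+1)) (by omega)
      positivity
    · simpa using Gam.pos hA k le_rfl
  exact absurd hz this.ne'

theorem root_bound (p : Polynomial ℂ) (hp : p ≠ 0) (h : ∀ z, p.eval z = 0 → z.im < 0) (t : ℂ) (ht : 0 < t.im) :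
    ‖p.leadingCoeff‖ * t.im ^ p.natDegree ≤ ‖p.eval t‖ := by
  have hs := IsAlgClosed.splits p
  rw [hs.eval_eq_prod_roots, norm_mul]
  refine mul_le_mul_of_nonneg_left ?_ (norm_nonneg _)
  rw [hs.natDegree_eq_card_roots]
  have : ∀ s : Multiset ℂ, (∀ z ∈ s, z.im < 0) → t.im ^ s.card ≤ ‖(s.map (fun a => t - a)).prod‖ := by
    intro s
    induction s using Multiset.induction_on with
    | empty => simp
    | cons a s ih =>
      intro hs
      rw [Multiset.card_cons, Multiset.map_cons, Multiset.prod_cons, norm_mul, pow_succ, mul_comm]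
      refine mul_le_mul ?_ (ih fun z hz => hs z (Multiset.mem_cons_of_mem hz)) (by positivity) (norm_nonneg _)
      have h1 := hs a (Multiset.mem_cons_self a s)
      have h2 := Complex.abs_im_le_norm (t - a)
      rw [Complex.sub_im] at h2
      have := le_abs_self (t.im - a.im)
      linarith
  exact this _ fun z hz => h z (Polynomial.mem_roots'.1 hz).2

theorem cone_step {N k : ℕ} (hk1 : 1 ≤ k) (hk : k ≤ N) {A : Mt N} (hA : A ∈ Gam N k) (α : ℝ) (hα : 0 < α) (W : Mc N)
    (h : ∀ s : ℝ, 0 ≤ s → s ≤ 1 → ∀ t : ℝ,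
      mdisc ℂ N (tup k (((s : ℂ) • W + (α * Complex.I) • (1 : Mc N)) + (t : ℂ) • cm A) (fun _ => 1)) ≠ 0) :
    mdisc ℂ N (tup k ((W + (α * Complex.I) • (1 : Mc N)) + Complex.I • cm A) (fun _ => 1)) ≠ 0 := by
  let Zs : ℝ → Mc N := fun s => (s : ℂ) • W + (α * Complex.I) • (1 : Mc N)
  let E : ℝ → ℂ → ℂ := fun s t => mdisc ℂ N (tup k (Zs s + t • cm A) (fun _ => 1))
  have hZc : Continuous Zs := by fun_prop
  have hAk : mdisc ℂ N (tup k (cm A) (fun _ => 1)) ≠ 0 := by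
    have := cm_tup (N := N) (j := k) A (fun _ => 1)
    simp only [cm_one] at this
    rw [this, mdisc_cm]
    exact_mod_cast (Gam.pos hA k le_rfl).ne'
  let G : Set (Set.Icc (0:ℝ) 1) := {s | ∀ t : ℂ, 0 ≤ t.im → E s t ≠ 0}
  -- bad set closed
  have hGo : IsOpen G := by
    rw [← isClosed_compl_iff]
    let Ω : Set (Set.Icc (0:ℝ) 1 × (Set.Icc (0:ℝ) 1 × Metric.closedBall (0:ℂ) 1)) :=
      {q | 0 ≤ (q.2.2 : ℂ).im ∧ (q.2.1 : ℝ) + ‖(q.2.2 : ℂ)‖ = 1 ∧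
        mdisc ℂ N (tup k ((((q.2.1 : ℝ)) : ℂ) • Zs q.1 + (q.2.2 : ℂ) • cm A) (fun _ => 1)) = 0}
    have hΩ : IsClosed Ω := by
      refine IsClosed.inter ?_ (IsClosed.inter ?_ ?_)
      · exact isClosed_le continuous_const (Complex.continuous_im.comp (by fun_prop))
      · exact isClosed_eq (by fun_prop) continuous_const
      · refine isClosed_eq (mdisc_continuous _ fun i => tup_continuous ?_ (fun _ => continuous_const) i) continuous_const
        fun_prop
    have : Gᶜ = Prod.fst '' Ω := by
      ext s
      simp only [G, Set.mem_compl_iff, Set.mem_setOf_eq, Set.mem_image, not_forall, not_not]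
      constructor
      · rintro ⟨t, ht, h0⟩
        have hp : 0 < 1 + ‖t‖ := by positivity
        have hle : ((1 + ‖t‖)⁻¹) ≤ 1 := inv_le_one_of_one_le₀ (by linarith [norm_nonneg t])
        refine ⟨⟨s, ⟨(1 + ‖t‖)⁻¹, by positivity, hle⟩, ⟨((1 + ‖t‖)⁻¹ : ℝ) • t, ?_⟩⟩, ⟨?_, ?_, ?_⟩, rfl⟩
        · rw [mem_closedBall_zero_iff, norm_smul, Real.norm_of_nonneg (by positivity)]
          rw [inv_mul_le_iff₀ hp]; linarith
        · simp only [Complex.smul_im, smul_eq_mul]; positivity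
        · simp only [norm_smul]
          rw [Real.norm_of_nonneg (by positivity)]; field_simp
        · simp only
          have e : (((1 + ‖t‖)⁻¹ : ℝ) : ℂ) • Zs s + ((((1 + ‖t‖)⁻¹ : ℝ) • t : ℂ)) • cm A
            = (((1 + ‖t‖)⁻¹ : ℝ) : ℂ) • (Zs s + t • cm A) := by
            rw [smul_add _ (Zs s), smul_smul _ t, Complex.real_smul]
          rw [e, mdisc_tup_smul k hk]
          rw [show mdisc ℂ N (tup k (Zs s + t • cm A) (fun _ => 1)) = 0 from h0, mul_zero]
      · rintro ⟨⟨s', l, t⟩, ⟨h1, h2, h3⟩, rfl⟩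
        simp only at h1 h2 h3 ⊢
        have hl : (l : ℝ) ≠ 0 := by
          intro hl
          rw [hl] at h3 h2
          simp only [Complex.ofReal_zero, zero_smul, zero_add] at h3 h2
          rw [mdisc_tup_smul k hk] at h3
          have : (t : ℂ) ≠ 0 := by intro h; rw [h] at h2; simp at h2
          exact mul_ne_zero (pow_ne_zero _ this) hAk h3
        have hlp : 0 < (l : ℝ) := lt_of_le_of_ne l.2.1 hl.symm
        have hlc : ((l : ℝ) : ℂ) ≠ 0 := by exact_mod_cast hl
        refine ⟨((l : ℝ)⁻¹ : ℝ) • (t : ℂ), ?_, ?_⟩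
        · simp only [Complex.smul_im, smul_eq_mul]; positivity
        · have e : ((l : ℝ) : ℂ) • Zs s' + (t : ℂ) • cm A
            = ((l : ℝ) : ℂ) • (Zs s' + (((l : ℝ)⁻¹ : ℝ) • (t : ℂ)) • cm A) := by
            rw [smul_add _ (Zs s'), smul_smul _ (_ : ℂ) (cm A), Complex.real_smul]
            push_cast
            rw [mul_inv_cancel_left₀ hlc]
          rw [e, mdisc_tup_smul k hk] at h3
          exact (mul_eq_zero.1 h3).resolve_left (pow_ne_zero _ hlc)
    rw [this]
    exact isClosedMap_fst_of_compactSpace _ hΩ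
  have hGc : IsClosed G := by
    let G' : Set (Set.Icc (0:ℝ) 1) := {s | ∀ t : ℂ, 0 < t.im → ‖mdisc ℂ N (tup k (cm A) (fun _ => 1))‖ * t.im ^ k ≤ ‖E s t‖}
    have hG' : IsClosed G' := by
      simp only [G', Set.setOf_forall]
      refine isClosed_iInter fun t => isClosed_iInter fun ht => isClosed_le continuous_const ?_
      refine Continuous.norm ?_
      refine mdisc_continuous _ fun i => tup_continuous ?_ (fun _ => continuous_const) i
      fun_prop
    have : G = G' := by
      ext s
      constructor
      · intro hs t ht
        have hcj : (gpoly k (Zs s) (cm A) fun _ => 1).coeff k = mdisc ℂ N (tup k (cm A) (fun _ => 1)) := by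
          rw [gpoly_coeff k k _ _ _ le_rfl, Nat.sub_self, tup_zero]; simp
        have hdj : (gpoly k (Zs s) (cm A) fun _ => 1).natDegree = k :=
          le_antisymm (gpoly_natDegree_le _ _ _ _) (Polynomial.le_natDegree_of_ne_zero (by rw [hcj]; exact hAk))
        have := root_bound (gpoly k (Zs s) (cm A) fun _ => 1)
          (by intro h0; rw [h0] at hcj; exact hAk (by simpa using hcj.symm)) (by
            intro z hz
            by_contra hn
            rw [gpoly_eval k hk] at hz
            exact hs z (not_lt.1 hn) hz) t ht
        rw [Polynomial.leadingCoeff, hdj, hcj, gpoly_eval k hk] at this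
        exact this
      · intro hs t ht
        rcases ht.eq_or_lt with h0 | h0
        · have : t = (t.re : ℂ) := Complex.ext (by simp) (by simpa using h0.symm)
          rw [this]
          exact h s s.2.1 s.2.2 t.re
        · have := hs t h0
          intro hE
          rw [hE, norm_zero] at this
          have : 0 < ‖mdisc ℂ N (tup k (cm A) (fun _ => 1))‖ * t.im ^ k :=
            mul_pos (norm_pos_iff.2 hAk) (pow_pos h0 _)
          linarith
    rw [this]; exact hG'
  have h0G : (⟨0, by simp⟩ : Set.Icc (0:ℝ) 1) ∈ G := by
    intro t ht hE
    have e0 : Zs 0 = (α * Complex.I) • (1 : Mc N) := by simp [Zs]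
    simp only [E, e0] at hE
    have ht0 : t ≠ 0 := by
      intro h0
      rw [h0, zero_smul, add_zero, mdisc_tup_smul k hk, tup_self, mdisc_diag, Matrix.det_one, mul_one] at hE
      have : (α : ℂ) * Complex.I ≠ 0 := by simp [hα.ne']
      exact mul_ne_zero (pow_ne_zero _ this) (by exact_mod_cast N.factorial_ne_zero) hE
    have e1 : (α * Complex.I) • (1 : Mc N) + t • cm A = t • (cm A + (α * Complex.I / t) • (1 : Mc N)) := by
      rw [smul_add, smul_smul, mul_div_cancel₀ _ ht0, add_comm]
    rw [e1, mdisc_tup_smul k hk] at hE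
    obtain ⟨h1, h2⟩ := Gam.root hk hA _ ((mul_eq_zero.1 hE).resolve_left (pow_ne_zero _ ht0))
    set ζ := (α * Complex.I / t : ℂ) with hζ
    have h3 : ζ * t = α * Complex.I := div_mul_cancel₀ _ ht0
    have h4 := congrArg Complex.im h3
    simp [h1] at h4
    nlinarith
  have huniv : G = Set.univ := IsClopen.eq_univ ⟨hGc, hGo⟩ ⟨_, h0G⟩
  have h1 : (⟨1, by simp⟩ : Set.Icc (0:ℝ) 1) ∈ G := by rw [huniv]; trivial
  have := h1 Complex.I (by simp)
  simpa [E, Zs] using this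

theorem cone_closure {N k : ℕ} (hk1 : 1 ≤ k) (hk : k ≤ N) (Y : Mt N) (hY : Y ∈ AddSubmonoid.closure (Gam N k)) :
    ∀ X : Mt N, X.IsSymm → ∀ α : ℝ, 0 < α →
    mdisc ℂ N (tup k ((cm X + Complex.I • cm Y) + (α * Complex.I) • (1 : Mc N)) (fun _ => 1)) ≠ 0 := by
  induction hY using AddSubmonoid.closure_induction_left with
  | zero =>
    intro X hX α hα
    rw [cm_zero, smul_zero, add_zero]
    exact ek_ne k hk X hX _ (by simpa using hα)
  | add_left A hA Y hY ih =>
    intro X hX α hα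
    have e : cm X + Complex.I • cm (A + Y) + (α * Complex.I) • (1 : Mc N)
      = ((cm X + Complex.I • cm Y) + (α * Complex.I) • (1 : Mc N)) + Complex.I • cm A := by
      rw [cm_add]; module
    rw [e]
    refine cone_step hk1 hk hA α hα _ ?_
    intro s hs0 hs1 t
    rcases hs0.eq_or_lt with h0 | h0
    · subst h0
      have := ek_ne k hk (t • A) (hA.1.smul t) (α * Complex.I) (by simpa using hα)
      rw [cm_smul] at this
      simpa [add_comm] using this
    · have := ih (X + (t / s) • A) (hX.add (hA.1.smul _)) (α / s) (by positivity)
      have hsc : (s : ℂ) ≠ 0 := by exact_mod_cast h0.ne'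
      have e2 : ((s : ℂ) • (cm X + Complex.I • cm Y) + (α * Complex.I) • (1 : Mc N)) + (t : ℂ) • cm A
        = (s : ℂ) • (cm (X + (t / s) • A) + Complex.I • cm Y + ((α / s : ℝ) * Complex.I) • (1 : Mc N)) := by
        rw [cm_add, cm_smul]
        push_cast
        rw [smul_add, smul_add, smul_add, smul_add, smul_smul _ _ (cm A), mul_div_cancel₀ _ hsc,
          smul_smul _ _ (1 : Mc N)]
        have : (s:ℂ) * (α / s * Complex.I) = α * Complex.I := by field_simp
        rw [this]; abel
      rw [e2, mdisc_tup_smul k hk]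
      exact mul_ne_zero (pow_ne_zero _ hsc) this

/-- open cone generated -/
def KK (N k : ℕ) : Set (Mt N) := {Y | ∃ η : ℝ, 0 < η ∧ Y - η • (1 : Mt N) ∈ AddSubmonoid.closure (Gam N k)}

theorem gamcl_symm {N k : ℕ} {Y : Mt N} (hY : Y ∈ AddSubmonoid.closure (Gam N k)) : Y.IsSymm := by
  induction hY using AddSubmonoid.closure_induction with
  | mem x hx => exact hx.1
  | zero => exact Matrix.isSymm_zero
  | add x y _ _ h1 h2 => exact h1.add h2

theorem gamcl_smul {N k : ℕ} (hk : k ≤ N) {Y : Mt N} (hY : Y ∈ AddSubmonoid.closure (Gam N k)) (c : ℝ) (hc : 0 ≤ c) :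
    c • Y ∈ AddSubmonoid.closure (Gam N k) := by
  rcases hc.eq_or_lt with h0 | h0
  · rw [← h0, zero_smul]; exact AddSubmonoid.zero_mem _
  induction hY using AddSubmonoid.closure_induction with
  | mem x hx => exact AddSubmonoid.subset_closure (Gam.smul hk hx h0)
  | zero => rw [smul_zero]; exact AddSubmonoid.zero_mem _
  | add x y _ _ h1 h2 => rw [smul_add]; exact AddSubmonoid.add_mem _ h1 h2

theorem Gam.sub_eps {N k : ℕ} {A : Mt N} (hA : A ∈ Gam N k) : ∃ η : ℝ, 0 < η ∧ A - η • (1 : Mt N) ∈ Gam N k := by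
  have : ∀ᶠ η in 𝓝 (0:ℝ), ∀ j ∈ Finset.Icc 1 k, 0 < mdisc ℝ N (tup j (A - η • (1 : Mt N)) (fun _ => 1)) := by
    rw [Filter.eventually_all_finset]
    intro j hj
    rw [Finset.mem_Icc] at hj
    have hc : Continuous fun η : ℝ => mdisc ℝ N (tup j (A - η • (1 : Mt N)) (fun _ => 1)) := by
      refine mdisc_continuous _ fun i => tup_continuous ?_ (fun _ => continuous_const) i
      fun_prop
    refine hc.continuousAt.eventually (lt_mem_nhds ?_)
    simpa using hA.2 j hj.1 hj.2
  obtain ⟨ε, hε, h⟩ := Metric.eventually_nhds_iff.1 this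
  refine ⟨ε / 2, by positivity, hA.1.sub (Matrix.isSymm_one.smul _), fun j h1 h2 => ?_⟩
  refine h ?_ j (Finset.mem_Icc.2 ⟨h1, h2⟩)
  rw [dist_zero_right, Real.norm_of_nonneg (by positivity)]; linarith

theorem Gam.subK {N k : ℕ} : Gam N k ⊆ KK N k := fun A hA => by
  obtain ⟨η, h1, h2⟩ := Gam.sub_eps hA
  exact ⟨η, h1, AddSubmonoid.subset_closure h2⟩

theorem KK.symm {N k : ℕ} {A : Mt N} (hA : A ∈ KK N k) : A.IsSymm := by
  obtain ⟨η, h1, h2⟩ := hA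
  have := (gamcl_symm h2).add (Matrix.isSymm_one.smul η)
  rwa [sub_add_cancel] at this

theorem KK.add_smul {N k : ℕ} (hk : k ≤ N) {A B : Mt N} (hA : A ∈ KK N k) (hB : B ∈ KK N k) {c d : ℝ} (hc : 0 ≤ c)
    (hd : 0 ≤ d) (hcd : 0 < c + d) : c • A + d • B ∈ KK N k := by
  obtain ⟨η, h1, h2⟩ := hA
  obtain ⟨ε, h3, h4⟩ := hB
  refine ⟨c * η + d * ε, ?_, ?_⟩
  · rcases hc.eq_or_lt with h | h
    · subst h; rw [zero_add] at hcd; simpa using mul_pos hcd h3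
    · have := mul_pos h h1; positivity
  · have e : c • A + d • B - (c * η + d * ε) • (1 : Mt N) = c • (A - η • (1 : Mt N)) + d • (B - ε • (1 : Mt N)) := by module
    rw [e]
    exact AddSubmonoid.add_mem _ (gamcl_smul hk h2 c hc) (gamcl_smul hk h4 d hd)

theorem KK.ne {N k : ℕ} (hk1 : 1 ≤ k) (hk : k ≤ N) {Y : Mt N} (hY : Y ∈ KK N k) {X : Mt N} (hX : X.IsSymm) :
    mdisc ℂ N (tup k (cm X + Complex.I • cm Y) (fun _ => 1)) ≠ 0 := by
  obtain ⟨η, h1, h2⟩ := hY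
  have := cone_closure hk1 hk _ h2 X hX η h1
  have e : cm X + Complex.I • cm (Y - η • (1 : Mt N)) + (η * Complex.I) • (1 : Mc N) = cm X + Complex.I • cm Y := by
    have h : cm Y = cm (Y - η • (1 : Mt N)) + (η:ℂ) • (1 : Mc N) := by
      rw [← cm_one, ← cm_smul, ← cm_add, sub_add_cancel]
    rw [h]; module
  rwa [e] at this

theorem KK.nej {N k : ℕ} (hk1 : 1 ≤ k) (hk : k ≤ N) (j : ℕ) (hj : j ≤ k) : ∀ (a : Fin N → Mt N),
    (∀ i : Fin N, j ≤ (i:ℕ) → (i:ℕ) < k → a i ∈ KK N k) → (∀ i : Fin N, k ≤ (i:ℕ) → a i = 1) →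
    ∀ (Y : Mt N), Y ∈ KK N k → ∀ X : Mt N, X.IsSymm →
    mdisc ℂ N (tup j (cm X + Complex.I • cm Y) (fun i => cm (a i))) ≠ 0 := by
  induction hj using Nat.decreasingInduction with
  | self =>
    intro a _ h2 Y hY X hX
    convert KK.ne hk1 hk hY hX using 2
    funext i; simp only [tup]; split_ifs with h
    · rfl
    · rw [h2 i (by omega), cm_one]
  | of_succ j hj ih =>
    intro a h1 h2 Y hY X hX
    let A := a ⟨j, by omega⟩
    have hA : A ∈ KK N k := h1 _ le_rfl hj
    have ih' := ih a (fun i hi => h1 i (by omega)) h2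
    have := GLstep (N := N) (j := j+1) (by omega) (by omega) (cm X + Complex.I • cm Y) (cm A) (fun i => cm (a i)) ?_ ?_
    · convert this using 2
      funext i; simp only [tup]
      split_ifs with h3 h4 h5 <;> first | rfl | omega | skip
      have : i = ⟨j, by omega⟩ := Fin.ext (by simp only; omega)
      rw [this]
    · intro z hz
      have e : cm X + Complex.I • cm Y + z • cm A = cm (X + z.re • A) + Complex.I • cm ((1:ℝ) • Y + z.im • A) := by
        rw [cm_add, cm_add, cm_smul, cm_smul, cm_smul]
        nth_rewrite 1 [← Complex.re_add_im z]
        push_cast; module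
      rw [e]
      exact ih' _ (KK.add_smul hk hY hA zero_le_one hz (by linarith)) _ (hX.add ((KK.symm hA).smul _))
    · have := ih' A hA 0 Matrix.isSymm_zero
      rw [cm_zero, zero_add, mdisc_tup_smul _ (by omega)] at this
      exact right_ne_zero_of_mul this

theorem KK.pos {N k : ℕ} (hk1 : 1 ≤ k) (hk : k ≤ N) (a : Fin N → Mt N)
    (h1 : ∀ i : Fin N, (i:ℕ) < k → a i ∈ KK N k) (h2 : ∀ i : Fin N, k ≤ (i:ℕ) → a i = 1) : 0 < mdisc ℝ N a := by
  let b : ℝ → Fin N → Mt N := fun t i => (1 - t) • a i + t • (1 : Mt N)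
  have hb : Continuous fun t => mdisc ℝ N (b t) := mdisc_continuous _ fun i => by fun_prop
  have hne : ∀ t ∈ Set.Icc (0:ℝ) 1, mdisc ℝ N (b t) ≠ 0 := by
    intro t ht
    have := KK.nej hk1 hk 0 (by omega) (b t) (fun i _ hi => KK.add_smul hk (h1 i hi) (Gam.subK Gam.one)
      (by linarith [ht.2]) ht.1 (by linarith)) (fun i hi => by
        simp only [b, h2 i hi]; module) 1 (Gam.subK Gam.one) 0 Matrix.isSymm_zero
    rw [tup_zero, mdisc_cm] at this
    exact_mod_cast this
  have e0 : b 0 = a := by funext i; simp [b]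
  have e1 : b 1 = fun _ => 1 := by funext i; simp [b]
  by_contra hn
  push Not at hn
  have := intermediate_value_Icc (zero_le_one (α := ℝ)) hb.continuousOn
  rw [e0, e1] at this
  obtain ⟨t, ht, h0⟩ := this ⟨hn, mdisc_one_pos.le⟩
  exact hne t ht h0

theorem Gam.mpos {N k : ℕ} (hk : k ≤ N) (a : Fin N → Mt N)
    (h1 : ∀ i : Fin N, (i:ℕ) < k → a i ∈ Gam N k) (h2 : ∀ i : Fin N, k ≤ (i:ℕ) → a i = 1) : 0 < mdisc ℝ N a := by
  rcases Nat.eq_zero_or_pos k with h | h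
  · have : a = fun _ => 1 := by funext i; exact h2 i (by omega)
    rw [this]; exact mdisc_one_pos
  · exact KK.pos h hk a (fun i hi => Gam.subK (h1 i hi)) h2

theorem Gam.add {N k : ℕ} (hk : k ≤ N) {A B : Mt N} (hA : A ∈ Gam N k) (hB : B ∈ Gam N k) : A + B ∈ Gam N k := by
  refine ⟨hA.1.add hB.1, fun j h1 h2 => ?_⟩
  have := tup_binom A B 1 j (h2.trans hk) (fun _ => 1)
  rw [one_smul] at this
  rw [this]
  refine Finset.sum_pos (fun m hm => ?_) ⟨0, by simp⟩
  rw [Finset.mem_range] at hm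
  rw [one_pow, mul_one]
  refine mul_pos (by exact_mod_cast Nat.choose_pos (by omega)) ?_
  refine Gam.mpos (h2.trans hk) _ (fun i hi => ?_) (fun i hi => ?_)
  · simp only [tup]; split_ifs
    · exact Gam.mono h2 hA
    · exact Gam.mono h2 hB
  · simp only [tup]; split_ifs <;> first | rfl | omega

theorem Gam.add_smul {N k : ℕ} (hk : k ≤ N) {A B : Mt N} (hA : A ∈ Gam N k) (hB : B ∈ Gam N k) {c d : ℝ} (hc : 0 ≤ c)
    (hd : 0 ≤ d) (hcd : 0 < c + d) : c • A + d • B ∈ Gam N k := by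
  rcases hc.eq_or_lt with h | h
  · subst h; rw [zero_smul, zero_add]; exact Gam.smul hk hB (by linarith)
  · rcases hd.eq_or_lt with h' | h'
    · subst h'; rw [zero_smul, add_zero]; exact Gam.smul hk hA h
    · exact Gam.add hk (Gam.smul hk hA h) (Gam.smul hk hB h')

/-- bilinear form with the remaining slots fixed -/
def bq {N : ℕ} (a : Fin N → Mt N) (B C : Mt N) : ℝ := mdisc ℝ N (tup 1 B (tup 2 C a))

theorem bq_upd {N : ℕ} (hN : 2 ≤ N) (a : Fin N → Mt N) (B C : Mt N) :
    tup 1 B (tup 2 C a) = Function.update (Function.update a ⟨1, by omega⟩ C) ⟨0, by omega⟩ B := by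
  funext i
  simp only [tup, Function.update_apply, Fin.ext_iff]
  split_ifs <;> first | rfl | omega

theorem bq_symm {N : ℕ} (hN : 2 ≤ N) (a : Fin N → Mt N) (B C : Mt N) : bq a B C = bq a C B := by
  rw [bq, ← mdisc_perm _ (Equiv.swap (⟨0, by omega⟩ : Fin N) ⟨1, by omega⟩)]
  congr 1
  funext i
  simp only [Function.comp, tup, Equiv.swap_apply_def, Fin.ext_iff]
  split_ifs <;> first | rfl | omega | skip
  all_goals (exfalso; simp_all)

theorem bq_add_left {N : ℕ} (hN : 2 ≤ N) (a : Fin N → Mt N) (B B' C : Mt N) :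
    bq a (B + B') C = bq a B C + bq a B' C := by
  simp only [bq, bq_upd hN, MultilinearMap.map_update_add]

theorem bq_smul_left {N : ℕ} (hN : 2 ≤ N) (a : Fin N → Mt N) (r : ℝ) (B C : Mt N) :
    bq a (r • B) C = r * bq a B C := by
  simp only [bq, bq_upd hN, MultilinearMap.map_update_smul, smul_eq_mul]

theorem bq_add_right {N : ℕ} (hN : 2 ≤ N) (a : Fin N → Mt N) (B B' C : Mt N) :
    bq a C (B + B') = bq a C B + bq a C B' := by
  rw [bq_symm hN, bq_add_left hN, bq_symm hN a B, bq_symm hN a B']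

theorem bq_smul_right {N : ℕ} (hN : 2 ≤ N) (a : Fin N → Mt N) (r : ℝ) (B C : Mt N) :
    bq a C (r • B) = r * bq a C B := by
  rw [bq_symm hN, bq_smul_left hN, bq_symm hN a B]

structure Sl (N k : ℕ) (a : Fin N → Mt N) : Prop where
  h1 : ∀ i : Fin N, 2 ≤ (i:ℕ) → (i:ℕ) < k → a i ∈ Gam N k
  h2 : ∀ i : Fin N, k ≤ (i:ℕ) → a i = 1

section
variable {N k : ℕ} (hk1 : 2 ≤ k) (hk : k ≤ N) {a : Fin N → Mt N} (ha : Sl N k a)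
include hk1 hk ha

theorem bq_pos {A B : Mt N} (hA : A ∈ Gam N k) (hB : B ∈ Gam N k) : 0 < bq a A B := by
  refine Gam.mpos hk _ (fun i hi => ?_) (fun i hi => ?_)
  · simp only [tup]; split_ifs
    · exact hA
    · exact hB
    · exact ha.h1 i (by omega) hi
  · simp only [tup]; rw [if_neg (by omega), if_neg (by omega)]; exact ha.h2 i hi

theorem bq_lorentz {A B : Mt N} (hA : A ∈ Gam N k) (hB : B.IsSymm) (h0 : bq a B A = 0) : bq a B B ≤ 0 := by
  by_contra hn
  push Not at hn
  have hAA := bq_pos hk1 hk ha hA hA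
  set s := Real.sqrt (bq a A A / bq a B B)
  have hs : s ^ 2 * bq a B B = bq a A A := by
    rw [Real.sq_sqrt (by positivity)]; field_simp
  have := KK.nej (by omega) hk 2 hk1 a (fun i h1 h2 => Gam.subK (ha.h1 i h1 h2)) ha.h2 A (Gam.subK hA) (s • B) (hB.smul _)
  apply this
  rw [tup_binom _ _ _ _ (by omega)]
  simp only [Finset.sum_range_succ, Finset.sum_range_zero]
  have e1 : mdisc ℂ N (tup (2 - 0) (cm (s • B)) (tup 2 (cm A) fun i => cm (a i))) = ((s ^ 2 * bq a B B : ℝ) : ℂ) := by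
    rw [tup_tup _ _ (by omega), cm_tup, mdisc_cm, mdisc_tup_smul _ (by omega)]
    congr 3
    funext i; simp only [tup]; split_ifs <;> first | rfl | omega
  have e2 : mdisc ℂ N (tup (2 - 1) (cm (s • B)) (tup 2 (cm A) fun i => cm (a i))) = 0 := by
    have : bq a (s • B) A = 0 := by rw [bq_smul_left (by omega), h0, mul_zero]
    rw [cm_tup, cm_tup, mdisc_cm]
    rw [bq] at this
    exact_mod_cast this
  have e3 : mdisc ℂ N (tup (2 - 2) (cm (s • B)) (tup 2 (cm A) fun i => cm (a i))) = ((bq a A A : ℝ) : ℂ) := by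
    rw [cm_tup, cm_tup, mdisc_cm, tup_zero, bq]
    congr 2
    funext i; simp only [tup]; split_ifs <;> first | rfl | omega
  rw [e1, e2, e3, hs]
  simp

theorem bq_kernel {A B : Mt N} (hA : A ∈ Gam N k) (hB : B.IsSymm) (h0 : bq a B A = 0) (h1 : bq a B B = 0)
    (C : Mt N) (hC : C.IsSymm) : bq a B C = 0 := by
  have hN : 2 ≤ N := by omega
  have hAA := bq_pos hk1 hk ha hA hA
  have step : ∀ C : Mt N, C.IsSymm → bq a C A = 0 → bq a B C = 0 := by
    intro C hC hCA
    have hs : ∀ s : ℝ, 2 * s * bq a B C + s ^ 2 * bq a C C ≤ 0 := by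
      intro s
      have := bq_lorentz hk1 hk ha hA (hB.add (hC.smul s)) (by
        rw [bq_add_left hN, bq_smul_left hN, h0, hCA]; ring)
      rw [bq_add_left hN, bq_smul_left hN, bq_add_right hN, bq_add_right hN, bq_smul_right hN, bq_smul_right hN,
        h1, bq_symm hN a C B] at this
      linarith
    by_contra hne
    have hCC := bq_lorentz hk1 hk ha hA hC hCA
    have hden : 0 < 1 - bq a C C := by linarith
    have := hs (bq a B C / (1 - bq a C C))
    have e : 2 * (bq a B C / (1 - bq a C C)) * bq a B C + (bq a B C / (1 - bq a C C)) ^ 2 * bq a C C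
       = (bq a B C)^2 * (2 - bq a C C) / (1 - bq a C C)^2 := by field_simp; ring
    rw [e] at this
    have : 0 < (bq a B C)^2 * (2 - bq a C C) / (1 - bq a C C)^2 := by
      have : 0 < 2 - bq a C C := by linarith
      positivity
    linarith
  have := step (C + (-(bq a C A / bq a A A)) • A) (hC.add (hA.1.smul _)) (by
    rw [bq_add_left hN, bq_smul_left hN]; field_simp; ring)
  rw [bq_add_right hN, bq_smul_right hN, h0] at this
  linarith
end

theorem bq_swap_slot {N : ℕ} (hN : 2 ≤ N) (a : Fin N → Mt N) (r : Fin N) (hr : 2 ≤ (r:ℕ)) (B C D : Mt N) :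
    bq (Function.update a r D) B C = bq (Function.update a r C) B D := by
  rw [bq, ← mdisc_perm _ (Equiv.swap (⟨1, by omega⟩ : Fin N) r)]
  congr 1
  funext i
  simp only [Function.comp, tup, Equiv.swap_apply_def, Function.update_apply, Fin.ext_iff]
  split_ifs <;> first | rfl | omega | skip
  all_goals (exfalso; simp_all; try omega)

theorem bq_nondeg {N k : ℕ} (hk1 : 2 ≤ k) (hk : k ≤ N) (r : ℕ) (hr : 2 ≤ r) (hrk : r ≤ k) : ∀ a : Fin N → Mt N,
    Sl N k a → (∀ i : Fin N, r ≤ (i:ℕ) → a i = 1) → ∀ B : Mt N, B.IsSymm →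
    (∀ C : Mt N, C.IsSymm → bq a B C = 0) → B = 0 := by
  have hN : 2 ≤ N := by omega
  induction r, hr using Nat.le_induction with
  | base =>
    intro a ha h1 B hB h
    obtain ⟨c, hc, hD⟩ := mdisc_two hN
    have h2 : ∀ C : Mt N, C.IsSymm → B.trace * C.trace - (B * C).trace = 0 := by
      intro C hC
      have h3 := h C hC
      rw [bq, hD _ (fun i hi => by
        simp only [tup]; rw [if_neg (by omega), if_neg (by omega)]; exact h1 i hi)] at h3
      have := (mul_eq_zero.1 h3).resolve_left hc.ne'
      simpa [tup] using this
    have h3 := h2 1 Matrix.isSymm_one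
    have h4 : B.trace = 0 := by
      rw [Matrix.mul_one, Matrix.trace_one, Fintype.card_fin] at h3
      have : (2:ℝ) ≤ N := by exact_mod_cast hN
      have h5 : B.trace * ((N:ℝ) - 1) = 0 := by linarith
      exact (mul_eq_zero.1 h5).resolve_right (by linarith)
    have h5 := h2 B hB
    rw [h4, zero_mul, zero_sub, neg_eq_zero] at h5
    have h6 : (Matrix.conjTranspose B * B).trace = 0 := by
      rw [Matrix.conjTranspose_eq_transpose_of_trivial, hB.eq]; exact h5
    exact Matrix.trace_conjTranspose_mul_self_eq_zero_iff.1 h6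
  | succ r hr ih =>
    intro a ha h1 B hB h
    let R : Fin N := ⟨r, by omega⟩
    have hA : a R ∈ Gam N k := ha.h1 R hr (by simp only [R]; omega)
    have hsl : ∀ A ∈ Gam N k, Sl N k (Function.update a R A) := by
      intro A hA
      refine ⟨fun i h2 h3 => ?_, fun i h2 => ?_⟩
      · rw [Function.update_apply]; split_ifs
        · exact hA
        · exact ha.h1 i h2 h3
      · rw [Function.update_of_ne]
        · exact ha.h2 i h2
        · rw [ne_eq, Fin.ext_iff]; simp only [R]; omega
    have hsw : ∀ A : Mt N, A.IsSymm → bq (Function.update a R A) B (a R) = 0 := by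
      intro A hAs
      rw [bq_swap_slot hN a R hr, Function.update_eq_self]
      exact h A hAs
    obtain ⟨η, hη, hAη⟩ := Gam.sub_eps hA
    have i1 := bq_lorentz hk1 hk (hsl _ hAη) hA hB (hsw _ hAη.1)
    have i2 := bq_lorentz hk1 hk (hsl _ Gam.one) hA hB (hsw _ Matrix.isSymm_one)
    have e : bq (Function.update a R (a R - η • (1 : Mt N))) B B = bq (Function.update a R (a R)) B B - η * bq (Function.update a R 1) B B := by
      rw [bq_swap_slot hN a R hr, sub_eq_add_neg, ← neg_smul, bq_add_right hN, bq_smul_right hN,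
        bq_swap_slot hN a R hr _ _ 1, bq_swap_slot hN a R hr _ _ (a R)]; ring
    rw [e, Function.update_eq_self, h B hB] at i1
    have i3 : bq (Function.update a R 1) B B = 0 := by
      refine le_antisymm i2 ?_
      by_contra hn
      push Not at hn
      nlinarith
    refine ih (by omega) (Function.update a R 1) (hsl _ Gam.one) (fun i hi => ?_) B hB ?_
    · rw [Function.update_apply]; split_ifs with h'
      · rfl
      · refine h1 i ?_
        rw [Fin.ext_iff] at h'; simp only [R] at h'; omega
    · intro C hC
      exact bq_kernel hk1 hk (hsl _ Gam.one) hA hB (hsw _ Matrix.isSymm_one) i3 C hC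

section
variable {N k : ℕ} (hk1 : 2 ≤ k) (hk : k ≤ N) {a : Fin N → Mt N} (ha : Sl N k a)
include hk1 hk ha

theorem bq_strict {A B : Mt N} (hA : A ∈ Gam N k) (hB : B.IsSymm) (h0 : bq a B A = 0) (h1 : 0 ≤ bq a B B) : B = 0 :=
  bq_nondeg hk1 hk k hk1 le_rfl a ha ha.h2 B hB
    (bq_kernel hk1 hk ha hA hB h0 (le_antisymm (bq_lorentz hk1 hk ha hA hB h0) h1))

theorem bq_cs {A B : Mt N} (hA : A ∈ Gam N k) (hB : B.IsSymm) : bq a B B * bq a A A ≤ bq a B A ^ 2 := by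
  have hN : 2 ≤ N := by omega
  have hAA := bq_pos hk1 hk ha hA hA
  have := bq_lorentz hk1 hk ha hA (hB.add (hA.1.smul (-(bq a B A / bq a A A)))) (by
    rw [bq_add_left hN, bq_smul_left hN]; field_simp; ring)
  rw [bq_add_left hN, bq_smul_left hN, bq_add_right hN, bq_add_right hN, bq_smul_right hN, bq_smul_right hN,
        bq_symm hN a A B] at this
  have e : bq a B B + -(bq a B A / bq a A A) * bq a B A + -(bq a B A / bq a A A) * (bq a B A + -(bq a B A / bq a A A) * bq a A A)
    = (bq a B B * bq a A A - bq a B A ^ 2) / bq a A A := by field_simp; ring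
  rw [e] at this
  have h2 := (div_le_iff₀ hAA).1 this
  linarith

theorem bq_ell {A : Mt N} (hA : A ∈ Gam N k) (y : Fin N → ℝ) (hy : y ≠ 0) : 0 < bq a (Matrix.vecMulVec y y) A := by
  have hN : 2 ≤ N := by omega
  set P := Matrix.vecMulVec y y with hP
  have hPs : P.IsSymm := by ext i j; simp [P, Matrix.vecMulVec_apply, mul_comm]
  have htr : 0 < P.trace := by
    rw [hP, Matrix.trace_vecMulVec]
    exact lt_of_le_of_ne (Finset.sum_nonneg fun i _ => mul_self_nonneg _) (fun h => hy (dotProduct_self_eq_zero.1 h.symm))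
  have hG : ∀ ε : ℝ, 0 < ε → P + ε • (1 : Mt N) ∈ Gam N k := by
    intro ε hε
    refine ⟨hPs.add (Matrix.isSymm_one.smul _), fun j h1 h2 => ?_⟩
    rw [tup_binom _ _ _ _ (h2.trans hk)]
    refine Finset.sum_pos' (fun m hm => ?_) ⟨j, by simp, ?_⟩
    · rw [Finset.mem_range] at hm
      refine mul_nonneg (by positivity) ?_
      rw [tup_self]
      rcases Nat.lt_or_ge (j - m) 2 with h3 | h3
      · rcases Nat.lt_or_ge (j - m) 1 with h4 | h4
        · rw [show j - m = 0 by omega, tup_zero]; exact mdisc_one_pos.le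
        · rw [show j - m = 1 by omega]
          obtain ⟨c, hc, hD⟩ := mdisc_two hN
          rw [hD _ (fun i hi => by simp only [tup]; rw [if_neg (by omega)])]
          simp only [tup]
          norm_num
          refine mul_nonneg hc.le ?_
          have : (2:ℝ) ≤ N := by exact_mod_cast hN
          nlinarith
      · rw [mdisc_vecMul_zero (i := ⟨0, by omega⟩) (j := ⟨1, by omega⟩) (x := y) (y := y) (z := y)]
        · simp
        · simp only [tup]; rw [if_pos (by omega)]
        · simp only [tup]; rw [if_pos (by omega)]
    · rw [Nat.sub_self, tup_zero, tup_self]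
      have := mdisc_one_pos (N := N)
      simp only [Nat.choose_self, Nat.cast_one, one_mul]
      positivity
  have hge : 0 ≤ bq a P A := by
    by_contra hn
    push Not at hn
    have h1 := bq_pos hk1 hk ha (Gam.one (k := k)) hA
    have := bq_pos hk1 hk ha (hG (-(bq a P A) / (bq a 1 A)) (div_pos (by linarith) h1)) hA
    rw [bq_add_left hN, bq_smul_left hN, div_mul_cancel₀ _ h1.ne'] at this
    linarith
  rcases hge.eq_or_lt with h | h
  · exfalso
    have hPP : bq a P P = 0 := by
      rw [bq, mdisc_vecMul_zero (i := ⟨0, by omega⟩) (j := ⟨1, by omega⟩) (x := y) (y := y) (z := y)]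
      · simp
      · simp only [tup]; rfl
      · simp only [tup]; rfl
    have := bq_strict hk1 hk ha hA hPs h.symm hPP.ge
    rw [this] at htr
    simp at htr
  · exact h
end

/-- the surface measure -/
def muS (n : ℕ) : Measure (Eu n) := (Measure.hausdorffMeasure (n : ℝ)).restrict (sph n)

theorem sphInt_def (n : ℕ) (g : Eu n → ℝ) : sphInt n g = ∫ x, g x ∂(muS n) := rfl

theorem sph_compact (n : ℕ) : IsCompact (sph n) := isCompact_sphere _ _

theorem sph_meas (n : ℕ) : MeasurableSet (sph n) := (sph_compact n).isClosed.measurableSet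

theorem mem_sph {n : ℕ} {x : Eu n} : x ∈ sph n ↔ ‖x‖ = 1 := by simp [sph]

theorem sph_ne {n : ℕ} {x : Eu n} (hx : x ∈ sph n) : x ≠ 0 := by
  rintro rfl; simp [mem_sph] at hx

theorem finrank_perp {n : ℕ} {v : Eu n} (hv : ‖v‖ = 1) : Module.finrank ℝ (ℝ ∙ v)ᗮ = n := by
  haveI : Fact (Module.finrank ℝ (Eu n) = n + 1) := ⟨by simp⟩
  exact Submodule.finrank_orthogonal_span_singleton (by rintro rfl; simp at hv)

theorem hemi_finite {n : ℕ} {v : Eu n} (hv : ‖v‖ = 1) :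
    Measure.hausdorffMeasure (n : ℝ) {x | x ∈ sph n ∧ ⟪v, x⟫ ≤ 0} < ⊤ := by
  set K := (ℝ ∙ v)ᗮ
  have h1 : ContDiffOn ℝ 1 (fun w : K => stereoInvFunAux v (w : Eu n)) (Metric.closedBall 0 2) :=
    (contDiff_stereoInvFunAux.comp K.subtypeL.contDiff).contDiffOn
  obtain ⟨C, hC⟩ := h1.exists_lipschitzOnWith one_ne_zero (convex_closedBall _ _)
    (isCompact_closedBall _ _)
  have h2 := hC.hausdorffMeasure_image_le (d := n) (by positivity)
  have h3 : Measure.hausdorffMeasure (n : ℝ) (Metric.closedBall (0 : K) 2) < ⊤ := by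
    have := (isAddHaarMeasure_hausdorffMeasure (E := K)).lt_top_of_isCompact
      (isCompact_closedBall (0 : K) 2)
    rwa [finrank_perp hv] at this
  refine lt_of_le_of_lt (measure_mono ?_) (lt_of_le_of_lt h2 (ENNReal.mul_lt_top ?_ h3))
  · rintro x ⟨hx, hx2⟩
    have hne : x ≠ v := by
      rintro rfl
      rw [real_inner_self_eq_norm_sq, hv] at hx2; norm_num at hx2
    refine ⟨stereoToFun v x, ?_, ?_⟩
    · rw [mem_closedBall_zero_iff, stereoToFun_apply, norm_smul, innerSL_apply_apply, Real.norm_eq_abs,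
        abs_of_pos (by apply div_pos <;> linarith)]
      have h4 : ‖(ℝ ∙ v)ᗮ.orthogonalProjectionOnto x‖ ≤ 1 := by
        have := (ℝ ∙ v)ᗮ.norm_orthogonalProjectionOnto_apply_le x
        rwa [mem_sph.1 hx] at this
      have h5 : 2 / (1 - ⟪v, x⟫) ≤ 2 := by
        rw [div_le_iff₀ (by linarith)]; linarith
      have h6 : 0 < 2 / (1 - ⟪v, x⟫) := by apply div_pos <;> linarith
      nlinarith [norm_nonneg ((ℝ ∙ v)ᗮ.orthogonalProjectionOnto x)]
    · have := stereo_left_inv hv (x := ⟨x, hx⟩) hne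
      exact congrArg Subtype.val this
  · exact ENNReal.rpow_lt_top_of_nonneg (by positivity) ENNReal.coe_ne_top

instance muS_finite (n : ℕ) : IsFiniteMeasure (muS n) := by
  constructor
  rw [muS, Measure.restrict_apply_univ]
  set v : Eu n := EuclideanSpace.single 0 1
  have hv : ‖v‖ = 1 := by simp [v]
  have : sph n ⊆ {x | x ∈ sph n ∧ ⟪v, x⟫ ≤ 0} ∪ {x | x ∈ sph n ∧ ⟪-v, x⟫ ≤ 0} := by
    intro x hx
    rcases le_total ⟪v, x⟫ 0 with h | h
    · exact Or.inl ⟨hx, h⟩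
    · exact Or.inr ⟨hx, by rw [inner_neg_left]; linarith⟩
  refine lt_of_le_of_lt (measure_mono this) (lt_of_le_of_lt (measure_union_le _ _) ?_)
  exact ENNReal.add_lt_top.2 ⟨hemi_finite hv, hemi_finite (by rwa [norm_neg])⟩

theorem muS_ae {n : ℕ} {p : Eu n → Prop} (h : ∀ x ∈ sph n, p x) : ∀ᵐ x ∂(muS n), p x := by
  rw [muS, ae_restrict_iff' (sph_meas n)]
  exact Eventually.of_forall h

theorem muS_pos {n : ℕ} {U : Set (Eu n)} (hU : IsOpen U) {x : Eu n} (hx : x ∈ sph n) (hxU : x ∈ U) :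
    0 < muS n U := by
  rw [muS, Measure.restrict_apply hU.measurableSet]
  have hv := mem_sph.1 hx
  set K := (ℝ ∙ x)ᗮ
  have h1 := hausdorffMeasure_orthogonalProjectionOnto_le K (n : ℝ) (U ∩ sph n) (by positivity)
  refine lt_of_lt_of_le ?_ h1
  set φ : K → Eu n := fun w => (w : Eu n) + √(1 - ‖w‖ ^ 2) • x
  have hφ : Continuous φ := by fun_prop
  set V : Set K := φ ⁻¹' U ∩ Metric.ball 0 1
  have hV : IsOpen V := (hU.preimage hφ).inter Metric.isOpen_ball
  have h0 : (0 : K) ∈ V := by simp [V, φ, hxU]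
  have h2 : 0 < Measure.hausdorffMeasure (n : ℝ) V := by
    have := (isAddHaarMeasure_hausdorffMeasure (E := K)).toIsOpenPosMeasure.open_pos V hV ⟨0, h0⟩
    rw [finrank_perp hv] at this
    exact pos_iff_ne_zero.2 this
  refine lt_of_lt_of_le h2 (measure_mono ?_)
  rintro w ⟨hw, hw1⟩
  rw [mem_ball_zero_iff] at hw1
  have hwx : ⟪(w : Eu n), x⟫ = 0 := Submodule.mem_orthogonal_singleton_iff_inner_left.1 w.2
  refine ⟨φ w, ⟨hw, ?_⟩, ?_⟩
  · rw [mem_sph]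
    have : ‖φ w‖ ^ 2 = 1 := by
      simp only [φ]
      rw [norm_add_sq_real, norm_smul, inner_smul_right, hwx, hv, mul_one, Real.norm_eq_abs, sq_abs,
        Real.sq_sqrt (by nlinarith [norm_nonneg w])]
      simp
    nlinarith [norm_nonneg (φ w)]
  · simp only [φ, map_add, map_smul]
    rw [Submodule.orthogonalProjectionOnto_orthogonalComplement_singleton_eq_zero]
    simp [K]

/-- continuous on the sphere -/
abbrev CS {n : ℕ} (f : Eu n → ℝ) : Prop := ContinuousOn f (sph n)

theorem CS.int {n : ℕ} {f : Eu n → ℝ} (hf : CS f) : Integrable f (muS n) := by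
  obtain ⟨C, hC⟩ := (sph_compact n).exists_bound_of_continuousOn hf
  refine Integrable.of_bound (hf.aestronglyMeasurable (sph_meas n)) C (muS_ae hC)

theorem sphInt_add {n : ℕ} {f g : Eu n → ℝ} (hf : CS f) (hg : CS g) :
    sphInt n (fun x => f x + g x) = sphInt n f + sphInt n g := integral_add hf.int hg.int

theorem sphInt_sub {n : ℕ} {f g : Eu n → ℝ} (hf : CS f) (hg : CS g) :
    sphInt n (fun x => f x - g x) = sphInt n f - sphInt n g := integral_sub hf.int hg.int

theorem sphInt_smul {n : ℕ} (c : ℝ) (f : Eu n → ℝ) :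
    sphInt n (fun x => c * f x) = c * sphInt n f := integral_const_mul _ _

theorem sphInt_congr {n : ℕ} {f g : Eu n → ℝ} (h : ∀ x ∈ sph n, f x = g x) :
    sphInt n f = sphInt n g := integral_congr_ae (muS_ae h)

theorem sphInt_mono {n : ℕ} {f g : Eu n → ℝ} (hf : CS f) (hg : CS g) (h : ∀ x ∈ sph n, f x ≤ g x) :
    sphInt n f ≤ sphInt n g := integral_mono_ae hf.int hg.int (muS_ae h)

theorem sphInt_nonneg {n : ℕ} {f : Eu n → ℝ} (h : ∀ x ∈ sph n, 0 ≤ f x) :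
    0 ≤ sphInt n f := integral_nonneg_of_ae (muS_ae h)

theorem sphInt_pos {n : ℕ} {f : Eu n → ℝ} (hf : CS f) (h : ∀ x ∈ sph n, 0 ≤ f x) {x : Eu n}
    (hx : x ∈ sph n) (hfx : 0 < f x) : 0 < sphInt n f := by
  have h1 : sphInt n f ≠ 0 := by
    intro h0
    have h2 := (integral_eq_zero_iff_of_nonneg_ae (muS_ae h) hf.int).1 h0
    obtain ⟨U, hU, hxU, hUf⟩ := mem_nhdsWithin.1
      ((hf x hx).eventually (lt_mem_nhds hfx))
    have h3 := muS_pos hU hx hxU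
    have h4 : ∀ᵐ y ∂(muS n), y ∉ U := by
      filter_upwards [h2, muS_ae (fun y hy => hy)] with y hy hyS hyU
      have : 0 < f y := hUf ⟨hyU, hyS⟩
      exact this.ne' hy
    exact h3.ne' (measure_eq_zero_iff_ae_notMem.2 h4)
  exact lt_of_le_of_ne (sphInt_nonneg h) (Ne.symm h1)

theorem sphInt_eq_zero {n : ℕ} {f : Eu n → ℝ} (hf : CS f) (h : ∀ x ∈ sph n, 0 ≤ f x)
    (h0 : sphInt n f = 0) : ∀ x ∈ sph n, f x = 0 := by
  intro x hx
  by_contra hne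
  exact absurd h0 (sphInt_pos hf h hx (lt_of_le_of_ne (h x hx) (Ne.symm hne))).ne'

theorem sph_nonempty (n : ℕ) : (EuclideanSpace.single 0 1 : Eu n) ∈ sph n := by simp [mem_sph]

/-- rotation flow -/
def rotF {n : ℕ} (B : Eu n →L[ℝ] Eu n) (s : ℝ) : Eu n →L[ℝ] Eu n := NormedSpace.exp (s • B)

theorem rotF_deriv {n : ℕ} (B : Eu n →L[ℝ] Eu n) (s : ℝ) (x : Eu n) :
    HasDerivAt (fun t => rotF B t x) (B (rotF B s x)) s := by
  have h := hasDerivAt_exp_smul_const' (𝕂 := ℝ) B s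
  exact (h.clm_apply (hasDerivAt_const s x)).congr_deriv (by simp [rotF])

theorem rotF_zero {n : ℕ} (B : Eu n →L[ℝ] Eu n) (x : Eu n) : rotF B 0 x = x := by
  have h : (0 : ℝ) • B = 0 := zero_smul ℝ B
  have h2 : rotF B 0 = ContinuousLinearMap.id ℝ (Eu n) := by
    rw [rotF, h, NormedSpace.exp_zero]; rfl
  rw [h2]; rfl

theorem rotF_norm {n : ℕ} (B : Eu n →L[ℝ] Eu n) (hB : ∀ x, ⟪B x, x⟫ = 0) (s : ℝ) (x : Eu n) :
    ‖rotF B s x‖ = ‖x‖ := by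
  have h1 : ∀ t, HasDerivAt (fun t => ‖rotF B t x‖ ^ 2) 0 t := by
    intro t
    have := (rotF_deriv B t x).norm_sq
    rwa [real_inner_comm, hB, mul_zero] at this
  have h2 := is_const_of_deriv_eq_zero (fun t => (h1 t).differentiableAt) (fun t => (h1 t).deriv) s 0
  simp only [rotF_zero] at h2
  exact (sq_eq_sq₀ (norm_nonneg _) (norm_nonneg _)).1 h2

theorem rotF_mp {n : ℕ} (B : Eu n →L[ℝ] Eu n) (hB : ∀ x, ⟪B x, x⟫ = 0) (s : ℝ)
    (g : Eu n → ℝ) : ∫ x, g (rotF B s x) ∂(muS n) = ∫ x, g x ∂(muS n) := by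
  let L : Eu n →ₗᵢ[ℝ] Eu n := ⟨(rotF B s).toLinearMap, rotF_norm B hB s⟩
  let e := (L.toLinearIsometryEquiv rfl).toIsometryEquiv
  have he : ∀ x, e x = rotF B s x := fun x => rfl
  have h1 := e.measurePreserving_hausdorffMeasure (n : ℝ)
  have h2 := h1.restrict_preimage_emb e.toHomeomorph.measurableEmbedding (sph n)
  have h3 : e ⁻¹' (sph n) = sph n := by
    ext x
    rw [Set.mem_preimage, mem_sph, mem_sph, he, rotF_norm B hB]
  rw [h3] at h2
  exact h2.integral_comp e.toHomeomorph.measurableEmbedding g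

theorem rot_int {n : ℕ} (B : Eu n →L[ℝ] Eu n) (hB : ∀ x, ⟪B x, x⟫ = 0) (h : Eu n → ℝ)
    (hh : ContDiffOn ℝ 1 h {0}ᶜ) : sphInt n (fun x => fderiv ℝ h x (B x)) = 0 := by
  have hopen : IsOpen ({0}ᶜ : Set (Eu n)) := isOpen_compl_singleton
  have hsub : sph n ⊆ {0}ᶜ := fun x hx => sph_ne hx
  have hc : ContinuousOn (fun x => fderiv ℝ h x (B x)) {0}ᶜ :=
    (hh.continuousOn_fderiv_of_isOpen hopen le_rfl).clm_apply B.continuous.continuousOn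
  obtain ⟨C, hC⟩ := (sph_compact n).exists_bound_of_continuousOn (hc.mono hsub)
  have hmem : ∀ s, ∀ x ∈ sph n, rotF B s x ∈ sph n := fun s x hx => by
    rw [mem_sph, rotF_norm B hB, ← mem_sph]; exact hx
  have hcs : ∀ s, CS (fun x => h (rotF B s x)) := fun s =>
    (hh.continuousOn.mono hsub).comp (rotF B s).continuous.continuousOn (hmem s)
  have key := hasDerivAt_integral_of_dominated_loc_of_deriv_le (μ := muS n) (𝕜 := ℝ)
    (F := fun s x => h (rotF B s x)) (F' := fun s x => fderiv ℝ h (rotF B s x) (B (rotF B s x)))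
    (x₀ := 0) (s := Set.univ) (bound := fun _ => C) univ_mem
    (Eventually.of_forall fun s => (hcs s).int.1) (hcs 0).int
    (by simp only [rotF_zero]
        exact (CS.int (hc.mono hsub)).1)
    (muS_ae fun x hx s _ => hC _ (hmem s x hx)) (integrable_const _)
    (muS_ae fun x hx s _ => by
      have h1 : DifferentiableAt ℝ h (rotF B s x) :=
        (hh.contDiffAt (hopen.mem_nhds (hsub (hmem s x hx)))).differentiableAt one_ne_zero
      exact h1.hasFDerivAt.comp_hasDerivAt s (rotF_deriv B s x))
  have h2 := key.2
  simp only [rotF_zero, rotF_mp B hB] at h2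
  exact h2.unique (hasDerivAt_const _ _)

/-- punctured space -/
abbrev Oc (n : ℕ) : Set (Eu n) := {0}ᶜ

theorem Oc_open (n : ℕ) : IsOpen (Oc n) := isOpen_compl_singleton

theorem sph_sub (n : ℕ) : sph n ⊆ Oc n := fun _ hx => sph_ne hx

/-- basis vectors -/
def ee {n : ℕ} (i : Fin (n + 1)) : Eu n := EuclideanSpace.single i 1

/-- partial derivative -/
def pd {n : ℕ} (i : Fin (n + 1)) (V : Eu n → ℝ) (y : Eu n) : ℝ := fderiv ℝ V y (ee i)

abbrev CD {n : ℕ} (r : WithTop ℕ∞) (V : Eu n → ℝ) : Prop := ContDiffOn ℝ r V (Oc n)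

theorem sum_ee {n : ℕ} (z : Eu n) : z = ∑ i, z i • ee i := by
  ext j
  simp [ee, Pi.single_apply]

theorem fderiv_eq_sum {n : ℕ} (V : Eu n → ℝ) (y z : Eu n) :
    fderiv ℝ V y z = ∑ i, z i * pd i V y := by
  conv_lhs => rw [sum_ee z]
  simp [pd]

theorem CD.at {n : ℕ} {r : WithTop ℕ∞} {V : Eu n → ℝ} (h : CD r V) {y : Eu n} (hy : y ∈ Oc n) :
    ContDiffAt ℝ r V y := h.contDiffAt ((Oc_open n).mem_nhds hy)

theorem CD.diff {n : ℕ} {V : Eu n → ℝ} (h : CD 1 V) {y : Eu n} (hy : y ∈ Oc n) :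
    DifferentiableAt ℝ V y := (CD.at h hy).differentiableAt one_ne_zero

theorem CD.le1 {n : ℕ} {V : Eu n → ℝ} (h : CD 2 V) : CD 1 V := h.of_le one_le_two
theorem CD.le2 {n : ℕ} {V : Eu n → ℝ} (h : CD 3 V) : CD 2 V := h.of_le (by exact_mod_cast (by norm_num : 2 ≤ 3))

theorem CD.pd' {n : ℕ} {r s : WithTop ℕ∞} (hrs : s + 1 ≤ r) {V : Eu n → ℝ} (h : CD r V) (i : Fin (n + 1)) :
    CD s (pd i V) :=
  (h.fderiv_of_isOpen (Oc_open n) hrs).clm_apply contDiffOn_const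

theorem CD.pd1 {n : ℕ} {V : Eu n → ℝ} (h : CD 2 V) (i : Fin (n + 1)) : CD 1 (pd i V) :=
  CD.pd' (by norm_num [one_add_one_eq_two]) h i
theorem CD.pd2 {n : ℕ} {V : Eu n → ℝ} (h : CD 3 V) (i : Fin (n + 1)) : CD 2 (pd i V) :=
  CD.pd' (by exact_mod_cast (by norm_num : 2 + 1 ≤ 3)) h i
theorem CD.pd0 {n : ℕ} {V : Eu n → ℝ} (h : CD 1 V) (i : Fin (n + 1)) : ContinuousOn (pd i V) (Oc n) :=
  (CD.pd' (s := 0) (by simp) h i).continuousOn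

theorem pd_congr {n : ℕ} {A B : Eu n → ℝ} (h : ∀ y ∈ Oc n, A y = B y) (i : Fin (n + 1)) :
    ∀ y ∈ Oc n, pd i A y = pd i B y := by
  intro y hy
  have : A =ᶠ[𝓝 y] B := by
    filter_upwards [(Oc_open n).mem_nhds hy] with z hz using h z hz
  rw [pd, this.fderiv_eq, pd]

theorem pd_mul {n : ℕ} {A B : Eu n → ℝ} (hA : CD 1 A) (hB : CD 1 B) (i : Fin (n + 1)) {y : Eu n}
    (hy : y ∈ Oc n) : pd i (fun y => A y * B y) y = A y * pd i B y + pd i A y * B y := by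
  rw [pd, fderiv_fun_mul (CD.diff hA hy) (CD.diff hB hy)]
  simp [pd, mul_comm]

theorem pd_add {n : ℕ} {A B : Eu n → ℝ} (hA : CD 1 A) (hB : CD 1 B) (i : Fin (n + 1)) {y : Eu n}
    (hy : y ∈ Oc n) : pd i (fun y => A y + B y) y = pd i A y + pd i B y := by
  rw [pd, fderiv_fun_add (CD.diff hA hy) (CD.diff hB hy)]
  simp [pd]

theorem pd_sub {n : ℕ} {A B : Eu n → ℝ} (hA : CD 1 A) (hB : CD 1 B) (i : Fin (n + 1)) {y : Eu n}
    (hy : y ∈ Oc n) : pd i (fun y => A y - B y) y = pd i A y - pd i B y := by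
  rw [pd, fderiv_fun_sub (CD.diff hA hy) (CD.diff hB hy)]
  simp [pd]

theorem pd_sum {n : ℕ} {ι : Type*} (s : Finset ι) {A : ι → Eu n → ℝ} (hA : ∀ a, CD 1 (A a))
    (i : Fin (n + 1)) {y : Eu n}
    (hy : y ∈ Oc n) : pd i (fun y => ∑ a ∈ s, A a y) y = ∑ a ∈ s, pd i (A a) y := by
  rw [pd, fderiv_fun_sum (fun a _ => CD.diff (hA a) hy)]
  simp [pd]

theorem pd_const {n : ℕ} (c : ℝ) (i : Fin (n + 1)) (y : Eu n) : pd i (fun _ => c) y = 0 := by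
  simp [pd]

theorem CD.coord {n : ℕ} {r : WithTop ℕ∞} (a : Fin (n + 1)) : CD (n := n) r (fun y => y a) :=
  (EuclideanSpace.proj a : Eu n →L[ℝ] ℝ).contDiff.contDiffOn

theorem pd_coord {n : ℕ} (a i : Fin (n + 1)) (y : Eu n) :
    pd i (fun y : Eu n => y a) y = if a = i then 1 else 0 := by
  have : fderiv ℝ (fun y : Eu n => y a) y = (EuclideanSpace.proj a : Eu n →L[ℝ] ℝ) :=
    (EuclideanSpace.proj a : Eu n →L[ℝ] ℝ).fderiv
  rw [pd, this]
  simp [ee, Pi.single_apply]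

/-- coordinate Hessian -/
def Hs {n : ℕ} (V : Eu n → ℝ) (y : Eu n) : Mt (n + 1) := Matrix.of fun i j => pd j (pd i V) y

theorem Hs_symm {n : ℕ} {V : Eu n → ℝ} (h : CD 2 V) {y : Eu n} (hy : y ∈ Oc n) : (Hs V y).IsSymm := by
  have h1 : IsSymmSndFDerivAt ℝ V y := (CD.at h hy).isSymmSndFDerivAt (by simp)
  have h2 : ∀ i j, pd j (pd i V) y = fderiv ℝ (fderiv ℝ V) y (ee j) (ee i) := by
    intro i j
    have h3 : DifferentiableAt ℝ (fderiv ℝ V) y :=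
      ((h.fderiv_of_isOpen (Oc_open n) (m := 1) (by norm_num [one_add_one_eq_two])).contDiffAt
        ((Oc_open n).mem_nhds hy)).differentiableAt one_ne_zero
    have := (h3.hasFDerivAt.clm_apply (hasFDerivAt_const (ee i) y)).fderiv
    show fderiv ℝ (fun z => fderiv ℝ V z (ee i)) y (ee j) = _
    rw [this]; simp
  ext i j
  simp only [Matrix.transpose_apply, Hs, Matrix.of_apply]
  rw [h2, h2]
  exact h1 _ _

theorem Hs_cont {n : ℕ} {V : Eu n → ℝ} (h : CD 2 V) : ContinuousOn (Hs V) (Oc n) := by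
  refine continuousOn_pi.2 fun i => continuousOn_pi.2 fun j => ?_
  exact CD.pd0 (CD.pd1 h i) j

theorem hessOp_eq {n : ℕ} {u : Eu n → ℝ} (h : CD 2 (homExt u)) {y : Eu n} (hy : y ∈ Oc n) :
    opM (hessOp u y).toLinearMap = Hs (homExt u) y := by
  have hg : ∀ z i, gradient (homExt u) z i = pd i (homExt u) z := by
    intro z i
    have : gradient (homExt u) z i = ⟪gradient (homExt u) z, ee i⟫ := by
      rw [ee, EuclideanSpace.inner_single_right]; simp
    rw [this, gradient, InnerProductSpace.toDual_symm_apply, pd]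
  have hd : DifferentiableAt ℝ (gradient (homExt u)) y := by
    have h3 : DifferentiableAt ℝ (fderiv ℝ (homExt u)) y :=
      ((h.fderiv_of_isOpen (Oc_open n) (m := 1) (by norm_num [one_add_one_eq_two])).contDiffAt
        ((Oc_open n).mem_nhds hy)).differentiableAt one_ne_zero
    exact ((InnerProductSpace.toDual ℝ (Eu n)).symm.differentiable.differentiableAt).comp y h3
  ext i j
  rw [opM_apply]
  simp only [Hs, Matrix.of_apply, hessOp]
  have h1 : fderiv ℝ (fun z => gradient (homExt u) z i) y (ee j) =
      (fderiv ℝ (gradient (homExt u)) y (ee j)) i := by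
    have := ((EuclideanSpace.proj i : Eu n →L[ℝ] ℝ).hasFDerivAt.comp y hd.hasFDerivAt).fderiv
    have h5 : ((EuclideanSpace.proj i : Eu n →L[ℝ] ℝ) ∘ gradient (homExt u)) = fun z => gradient (homExt u) z i := rfl
    rw [h5] at this
    rw [this]; rfl
  have h2 : (fun z => gradient (homExt u) z i) = pd i (homExt u) := funext fun z => hg z i
  rw [h2] at h1
  exact h1.symm

/-! homogeneity -/
theorem homExt_smul {n : ℕ} (u : Eu n → ℝ) {t : ℝ} (ht : 0 < t) (y : Eu n) :
    homExt u (t • y) = t * homExt u y := by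
  simp only [homExt, norm_smul, Real.norm_eq_abs, abs_of_pos ht]
  have : (t * ‖y‖)⁻¹ • t • y = ‖y‖⁻¹ • y := by
    rw [smul_smul]; congr 1; field_simp
  rw [this]; ring

theorem homExt_sph {n : ℕ} (u : Eu n → ℝ) {x : Eu n} (hx : x ∈ sph n) : homExt u x = u x := by
  simp [homExt, mem_sph.1 hx]

theorem homExt_of_eq {n : ℕ} {u : Eu n → ℝ} {V : Eu n → ℝ}
    (hV : ∀ t > 0, ∀ y ∈ Oc n, V (t • y) = t * V y) (h : ∀ x ∈ sph n, u x = V x) :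
    ∀ y ∈ Oc n, homExt u y = V y := by
  intro y hy
  have h0 : 0 < ‖y‖ := norm_pos_iff.2 hy
  rw [homExt, h, hV _ (inv_pos.2 h0) _ hy]
  · field_simp
  · rw [mem_sph, norm_smul, norm_inv, norm_norm, inv_mul_cancel₀ h0.ne']

theorem euler1 {n : ℕ} {V : Eu n → ℝ} (h : CD 1 V) (hV : ∀ t > 0, ∀ y ∈ Oc n, V (t • y) = t * V y)
    {y : Eu n} (hy : y ∈ Oc n) : ∑ i, y i * pd i V y = V y := by
  rw [← fderiv_eq_sum]
  have h1 : HasDerivAt (fun t : ℝ => t • y) y 1 := by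
    simpa using (hasDerivAt_id (1 : ℝ)).smul_const y
  have h2 : HasFDerivAt V (fderiv ℝ V y) ((1 : ℝ) • y) := by
    rw [one_smul]; exact (CD.diff h hy).hasFDerivAt
  have h3 := h2.comp_hasDerivAt 1 h1
  have h4 : HasDerivAt (fun t : ℝ => t * V y) (V y) 1 := by
    simpa using (hasDerivAt_id (1 : ℝ)).mul_const (V y)
  have h5 : (V ∘ fun t : ℝ => t • y) =ᶠ[𝓝 1] fun t => t * V y := by
    filter_upwards [lt_mem_nhds (show (0 : ℝ) < 1 by norm_num)] with t ht using hV t ht y hy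
  exact (h3.congr_of_eventuallyEq h5.symm).unique h4

theorem euler2 {n : ℕ} {V : Eu n → ℝ} (h : CD 2 V) (hV : ∀ t > 0, ∀ y ∈ Oc n, V (t • y) = t * V y)
    {y : Eu n} (hy : y ∈ Oc n) : (Hs V y).mulVec y.ofLp = 0 := by
  rw [← (Hs_symm h hy)]
  ext j
  simp only [Matrix.mulVec, dotProduct, Matrix.transpose_apply, Hs, Matrix.of_apply, Pi.zero_apply]
  have h1 := pd_congr (fun z hz => euler1 (CD.le1 h) hV hz) j y hy
  rw [pd_sum _ (fun a => (CD.coord a).mul (CD.pd1 h a)) _ hy] at h1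
  have h2 : ∀ a, pd j (fun y : Eu n => y a * pd a V y) y =
      y a * pd j (pd a V) y + (if a = j then 1 else 0) * pd a V y := fun a => by
    rw [pd_mul (CD.coord a) (CD.pd1 h a) _ hy, pd_coord]
  simp only [h2, Finset.sum_add_distrib, ite_mul, one_mul, zero_mul, Finset.sum_ite_eq',
    Finset.mem_univ, if_true] at h1
  have h3 : ∑ a, y a * pd j (pd a V) y = 0 := by linarith
  rw [← h3]
  exact Finset.sum_congr rfl fun a _ => mul_comm _ _

/-- C² on the sphere -/
def C2 {n : ℕ} (u : Eu n → ℝ) : Prop := CD 2 (homExt u)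

/-- the Hessian matrix of the extension -/
def HH {n : ℕ} (u : Eu n → ℝ) (x : Eu n) : Mt (n + 1) := Hs (homExt u) x

theorem HH_symm {n : ℕ} {u : Eu n → ℝ} (h : C2 u) {x : Eu n} (hx : x ∈ sph n) : (HH u x).IsSymm :=
  Hs_symm h (sph_ne hx)

theorem HH_rad {n : ℕ} {u : Eu n → ℝ} (h : C2 u) {x : Eu n} (hx : x ∈ sph n) :
    (HH u x).mulVec x.ofLp = 0 := euler2 h (fun _ ht _ _ => homExt_smul u ht _) (sph_ne hx)

theorem HH_cont {n : ℕ} {u : Eu n → ℝ} (h : C2 u) : ContinuousOn (HH u) (sph n) :=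
  (Hs_cont h).mono (sph_sub n)

theorem C2.cs {n : ℕ} {u : Eu n → ℝ} (h : C2 u) : CS u :=
  (h.continuousOn.mono (sph_sub n)).congr fun _ hx => (homExt_sph u hx).symm

theorem Hs_congr {n : ℕ} {A B : Eu n → ℝ} (h : ∀ y ∈ Oc n, A y = B y) {y : Eu n} (hy : y ∈ Oc n) :
    Hs A y = Hs B y := by
  ext i j
  exact pd_congr (pd_congr h i) j y hy

theorem Hs_add {n : ℕ} {A B : Eu n → ℝ} (hA : CD 2 A) (hB : CD 2 B) {y : Eu n} (hy : y ∈ Oc n) :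
    Hs (fun y => A y + B y) y = Hs A y + Hs B y := by
  ext i j
  simp only [Hs, Matrix.of_apply, Matrix.add_apply]
  rw [pd_congr (fun z hz => pd_add (CD.le1 hA) (CD.le1 hB) i hz) j y hy,
    pd_add (CD.pd1 hA i) (CD.pd1 hB i) j hy]

theorem CD.cmul {n : ℕ} {r : WithTop ℕ∞} {A : Eu n → ℝ} (c : ℝ) (hA : CD r A) : CD r (fun y => c * A y) :=
  contDiffOn_const.mul hA

theorem pd_cmul {n : ℕ} {A : Eu n → ℝ} (c : ℝ) (hA : CD 1 A) (i : Fin (n + 1)) {y : Eu n} (hy : y ∈ Oc n) :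
    pd i (fun y => c * A y) y = c * pd i A y := by
  rw [pd_mul contDiffOn_const hA i hy, pd_const]; ring

theorem Hs_cmul {n : ℕ} {A : Eu n → ℝ} (c : ℝ) (hA : CD 2 A) {y : Eu n} (hy : y ∈ Oc n) :
    Hs (fun y => c * A y) y = c • Hs A y := by
  ext i j
  simp only [Hs, Matrix.of_apply, Matrix.smul_apply, smul_eq_mul]
  rw [pd_congr (fun z hz => pd_cmul c (CD.le1 hA) i hz) j y hy, pd_cmul c (CD.pd1 hA i) j hy]

theorem homExt_add {n : ℕ} (u v : Eu n → ℝ) :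
    homExt (fun x => u x + v x) = fun y => homExt u y + homExt v y := by
  funext y; simp only [homExt]; ring

theorem homExt_cmul {n : ℕ} (c : ℝ) (u : Eu n → ℝ) :
    homExt (fun x => c * u x) = fun y => c * homExt u y := by
  funext y; simp only [homExt]; ring

theorem C2.add {n : ℕ} {u v : Eu n → ℝ} (hu : C2 u) (hv : C2 v) : C2 (fun x => u x + v x) := by
  rw [C2, homExt_add]; exact ContDiffOn.add hu hv

theorem C2.cmul {n : ℕ} {u : Eu n → ℝ} (c : ℝ) (hu : C2 u) : C2 (fun x => c * u x) := by
  rw [C2, homExt_cmul]; exact CD.cmul c hu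

theorem HH_add {n : ℕ} {u v : Eu n → ℝ} (hu : C2 u) (hv : C2 v) {x : Eu n} (hx : x ∈ sph n) :
    HH (fun x => u x + v x) x = HH u x + HH v x := by
  rw [HH, homExt_add]; exact Hs_add hu hv (sph_ne hx)

theorem HH_cmul {n : ℕ} {u : Eu n → ℝ} (c : ℝ) (hu : C2 u) {x : Eu n} (hx : x ∈ sph n) :
    HH (fun x => c * u x) x = c • HH u x := by
  rw [HH, homExt_cmul]; exact Hs_cmul c hu (sph_ne hx)

theorem homExt_congr {n : ℕ} {u v : Eu n → ℝ} (h : ∀ x ∈ sph n, u x = v x) :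
    ∀ y ∈ Oc n, homExt u y = homExt v y :=
  homExt_of_eq (fun _ ht _ _ => homExt_smul v ht _) fun x hx => by rw [h x hx, homExt_sph v hx]

theorem C2.congr {n : ℕ} {u v : Eu n → ℝ} (h : ∀ x ∈ sph n, u x = v x) (hv : C2 v) : C2 u :=
  ContDiffOn.congr hv (homExt_congr h)

theorem HH_congr {n : ℕ} {u v : Eu n → ℝ} (h : ∀ x ∈ sph n, u x = v x) {x : Eu n} (hx : x ∈ sph n) :
    HH u x = HH v x := Hs_congr (homExt_congr h) (sph_ne hx)

/-- gradient vector -/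
def gr {n : ℕ} (V : Eu n → ℝ) (y : Eu n) : Fin (n + 1) → ℝ := fun i => pd i V y

theorem Hs_mul {n : ℕ} {A B : Eu n → ℝ} (hA : CD 2 A) (hB : CD 2 B) {y : Eu n} (hy : y ∈ Oc n) :
    Hs (fun y => A y * B y) y = A y • Hs B y + B y • Hs A y + Matrix.vecMulVec (gr A y) (gr B y) +
      Matrix.vecMulVec (gr B y) (gr A y) := by
  ext i j
  simp only [Hs, Matrix.of_apply, Matrix.add_apply, Matrix.smul_apply, Matrix.vecMulVec_apply, gr,
    smul_eq_mul]
  rw [pd_congr (fun z hz => pd_mul (CD.le1 hA) (CD.le1 hB) i hz) j y hy,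
    pd_add ((CD.le1 hA).mul (CD.pd1 hB i)) ((CD.pd1 hA i).mul (CD.le1 hB)) j hy,
    pd_mul (CD.le1 hA) (CD.pd1 hB i) j hy, pd_mul (CD.pd1 hA i) (CD.le1 hB) j hy]
  ring

/-- quotient (0-homogeneous) -/
def quo {n : ℕ} (f u : Eu n → ℝ) (y : Eu n) : ℝ := homExt f y / homExt u y

theorem homExt_pos {n : ℕ} {u : Eu n → ℝ} (hu : PosOnSphere u) {y : Eu n} (hy : y ∈ Oc n) :
    0 < homExt u y := by
  have h0 : 0 < ‖y‖ := norm_pos_iff.2 hy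
  refine mul_pos h0 (hu _ ?_)
  rw [mem_sph, norm_smul, norm_inv, norm_norm, inv_mul_cancel₀ h0.ne']

theorem quo_CD {n : ℕ} {f u : Eu n → ℝ} (hf : C2 f) (hu : C2 u) (hp : PosOnSphere u) : CD 2 (quo f u) :=
  ContDiffOn.div hf hu fun _ hy => (homExt_pos hp hy).ne'

theorem homExt_sqdiv {n : ℕ} {f u : Eu n → ℝ} (hp : PosOnSphere u) :
    ∀ y ∈ Oc n, homExt (fun x => f x ^ 2 / u x) y = homExt f y * quo f u y := by
  intro y hy
  have h0 : ‖y‖ ≠ 0 := (norm_pos_iff.2 hy).ne'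
  have h1 := (homExt_pos hp hy).ne'
  simp only [homExt, quo] at *
  have h2 : u (‖y‖⁻¹ • y) ≠ 0 := fun h => h1 (by rw [h, mul_zero])
  field_simp

theorem C2_sqdiv {n : ℕ} {f u : Eu n → ℝ} (hf : C2 f) (hu : C2 u) (hp : PosOnSphere u) :
    C2 (fun x => f x ^ 2 / u x) :=
  ContDiffOn.congr (ContDiffOn.mul hf (quo_CD hf hu hp)) (homExt_sqdiv hp)

theorem HH_sqdiv {n : ℕ} {f u : Eu n → ℝ} (hf : C2 f) (hu : C2 u) (hp : PosOnSphere u) {x : Eu n}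
    (hx : x ∈ sph n) :
    HH (fun x => f x ^ 2 / u x) x = (2 * (f x / u x)) • HH f x - (f x / u x) ^ 2 • HH u x +
      (2 * u x) • Matrix.vecMulVec (gr (quo f u) x) (gr (quo f u) x) := by
  have hy := sph_ne hx
  have hG := quo_CD hf hu hp
  have hGU : ∀ y ∈ Oc n, homExt f y = homExt u y * quo f u y := fun y hy => by
    have h1 := (homExt_pos hp hy).ne'
    simp only [quo]; field_simp
  have hgr : gr (homExt f) x = u x • gr (quo f u) x + (f x / u x) • gr (homExt u) x := by
    funext i
    simp only [gr, Pi.add_apply, Pi.smul_apply, smul_eq_mul]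
    rw [pd_congr hGU i x hy, pd_mul (CD.le1 hu) (CD.le1 hG) i hy, homExt_sph u hx, quo, homExt_sph u hx,
      homExt_sph f hx]
    ring
  have hF : HH f x = Hs (fun y => homExt u y * quo f u y) x := Hs_congr hGU hy
  rw [Hs_mul hu hG hy, homExt_sph u hx] at hF
  rw [HH, Hs_congr (homExt_sqdiv hp) hy, Hs_mul hf hG hy, hgr, homExt_sph f hx]
  have hq : quo f u x = f x / u x := by rw [quo, homExt_sph u hx, homExt_sph f hx]
  rw [hq] at hF ⊢
  have hux := (hp x hx).ne'
  have hF' := hF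
  rw [HH] at hF'
  rw [hF']
  ext i j
  have hij := congrFun (congrFun hF i) j
  simp only [Matrix.add_apply, Matrix.smul_apply, Matrix.sub_apply, Matrix.vecMulVec_apply, smul_eq_mul,
    Pi.add_apply, Pi.smul_apply] at hij ⊢
  rw [hij]
  simp only [HH]
  field_simp
  ring

/-- radial projection -/
def nu {n : ℕ} (y : Eu n) : Eu n := ‖y‖⁻¹ • y

theorem nu_sph {n : ℕ} {y : Eu n} (hy : y ∈ Oc n) : nu y ∈ sph n := by
  have h0 : 0 < ‖y‖ := norm_pos_iff.2 hy
  rw [nu, mem_sph, norm_smul, norm_inv, norm_norm, inv_mul_cancel₀ h0.ne']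

theorem nu_of_sph {n : ℕ} {y : Eu n} (hy : y ∈ sph n) : nu y = y := by
  rw [nu, mem_sph.1 hy]; simp

theorem CD_norm {n : ℕ} {r : WithTop ℕ∞} : CD (n := n) r (fun y => ‖y‖) :=
  fun y hy => (contDiffAt_norm ℝ hy).contDiffWithinAt

theorem nu_CD {n : ℕ} {r : WithTop ℕ∞} : ContDiffOn ℝ r (nu (n := n)) (Oc n) :=
  ContDiffOn.smul (ContDiffOn.inv CD_norm fun _ hy => (norm_pos_iff.2 hy).ne') contDiffOn_id

theorem comp_nu_CD {n : ℕ} {r : WithTop ℕ∞} {V : Eu n → ℝ} (h : CD r V) : CD r (fun y => V (nu y)) :=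
  ContDiffOn.comp h nu_CD fun _ hy => sph_ne (nu_sph hy)

theorem homExt_CD {n : ℕ} {r : WithTop ℕ∞} {V : Eu n → ℝ} (h : CD r V) : CD r (homExt V) :=
  ContDiffOn.mul CD_norm (comp_nu_CD h)

theorem pd_norm {n : ℕ} (i : Fin (n + 1)) {y : Eu n} (hy : y ∈ Oc n) :
    pd i (fun y => ‖y‖) y = nu y i := by
  have h0 : ‖y‖ ≠ 0 := (norm_pos_iff.2 hy).ne'
  have h1 : pd i (fun y => ‖y‖ * ‖y‖) y = pd i (fun y : Eu n => ∑ a, y a * y a) y := by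
    refine pd_congr (fun z _ => ?_) i y hy
    rw [← real_inner_self_eq_norm_mul_norm, PiLp.inner_apply]
    simp [sq]
  rw [pd_mul CD_norm CD_norm _ hy, pd_sum _ (fun a => (CD.coord a).mul (CD.coord a)) _ hy] at h1
  simp only [pd_mul (CD.coord _) (CD.coord _) _ hy, pd_coord] at h1
  simp only [mul_ite, mul_one, mul_zero, ite_mul, one_mul, zero_mul, Finset.sum_add_distrib, Finset.sum_ite_eq',
    Finset.mem_univ, if_true] at h1
  simp only [nu, PiLp.smul_apply, smul_eq_mul]
  field_simp
  linarith

theorem pd_nu {n : ℕ} (i a : Fin (n + 1)) {y : Eu n} (hy : y ∈ Oc n) :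
    pd i (fun y => nu y a) y = ‖y‖⁻¹ * ((if a = i then 1 else 0) - nu y i * nu y a) := by
  have h0 : ‖y‖ ≠ 0 := (norm_pos_iff.2 hy).ne'
  have hc : CD 1 (fun y : Eu n => nu y a) := (CD.coord (r := 1) a).comp nu_CD fun _ hy => sph_ne (nu_sph hy)
  have h1 : pd i (fun y : Eu n => ‖y‖ * nu y a) y = pd i (fun y : Eu n => y a) y := by
    refine pd_congr (fun z hz => ?_) i y hy
    have h0 : ‖z‖ ≠ 0 := (norm_pos_iff.2 hz).ne'
    simp only [nu, PiLp.smul_apply, smul_eq_mul]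
    field_simp
  rw [pd_mul CD_norm hc _ hy, pd_coord, pd_norm i hy] at h1
  rw [eq_inv_mul_iff_mul_eq₀ h0]
  linarith

theorem pd_comp_nu {n : ℕ} {V : Eu n → ℝ} (h : CD 1 V) (i : Fin (n + 1)) {y : Eu n} (hy : y ∈ Oc n) :
    pd i (fun y => V (nu y)) y =
      ‖y‖⁻¹ * (pd i V (nu y) - nu y i * ∑ a, nu y a * pd a V (nu y)) := by
  have hd : DifferentiableAt ℝ (nu (n := n)) y :=
    ((nu_CD (r := 1)).contDiffAt ((Oc_open n).mem_nhds hy)).differentiableAt one_ne_zero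
  have h1 := ((CD.diff h (sph_ne (nu_sph hy))).hasFDerivAt.comp y hd.hasFDerivAt).fderiv
  have h2 : ∀ a, (fderiv ℝ nu y (ee i)) a = pd i (fun y => nu y a) y := by
    intro a
    have h3 := ((EuclideanSpace.proj a : Eu n →L[ℝ] ℝ).hasFDerivAt.comp y hd.hasFDerivAt).fderiv
    have h5 : ((EuclideanSpace.proj a : Eu n →L[ℝ] ℝ) ∘ nu) = fun z => nu z a := rfl
    rw [h5] at h3
    rw [pd, h3]; rfl
  have h3 : pd i (fun y => V (nu y)) y = fderiv ℝ V (nu y) (fderiv ℝ nu y (ee i)) := by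
    rw [pd]
    have h5 : (V ∘ nu) = fun z => V (nu z) := rfl
    rw [h5] at h1
    rw [h1]; rfl
  rw [h3, fderiv_eq_sum]
  simp only [h2, pd_nu _ _ hy]
  have : ∀ a, ‖y‖⁻¹ * ((if a = i then 1 else 0) - nu y i * nu y a) * pd a V (nu y) =
    ‖y‖⁻¹ * ((if a = i then pd a V (nu y) else 0) - nu y i * (nu y a * pd a V (nu y))) := by
    intro a; split_ifs <;> ring
  simp only [this]
  rw [← Finset.mul_sum, Finset.sum_sub_distrib, ← Finset.mul_sum]
  simp

/-- tangential projection matrix -/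
def PiM {n : ℕ} (x : Eu n) : Mt (n + 1) := 1 - Matrix.vecMulVec x.ofLp x.ofLp

theorem HH_formula {n : ℕ} {V : Eu n → ℝ} (h : CD 2 V) {x : Eu n} (hx : x ∈ sph n) :
    HH V x = (PiM x * Hs V x + (V x - ∑ a, x a * pd a V x) • 1) * PiM x := by
  set P : Fin (n + 1) → Eu n → ℝ := fun i z => z i * V z + pd i V z - z i * ∑ a, z a * pd a V z with hP
  have hsumC : CD 1 (fun z : Eu n => ∑ a, z a * pd a V z) :=
    ContDiffOn.sum fun a _ => (CD.coord a).mul (CD.pd1 h a)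
  have hPC : ∀ i, CD 1 (P i) := fun i =>
    (((CD.coord i).mul (CD.le1 h)).add (CD.pd1 h i)).sub ((CD.coord i).mul hsumC)
  have h1 : ∀ i, ∀ y ∈ Oc n, pd i (homExt V) y = P i (nu y) := by
    intro i y hy
    have h0 : ‖y‖ ≠ 0 := (norm_pos_iff.2 hy).ne'
    have : homExt V = fun y => ‖y‖ * V (nu y) := rfl
    rw [this, pd_mul CD_norm (comp_nu_CD (CD.le1 h)) _ hy, pd_norm i hy, pd_comp_nu (CD.le1 h) i hy]
    simp only [hP]
    rw [← mul_assoc, mul_inv_cancel₀ h0]; ring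
  have hxO := sph_ne hx
  have h2 : ∀ b i, pd b (P i) x = (if i = b then 1 else 0) * (V x - ∑ a, x a * pd a V x) + pd b (pd i V) x -
      x i * ∑ a, x a * pd b (pd a V) x := by
    intro b i
    simp only [hP]
    rw [pd_sub (((CD.coord i).mul (CD.le1 h)).add (CD.pd1 h i)) ((CD.coord i).mul hsumC) _ hxO,
      pd_add ((CD.coord i).mul (CD.le1 h)) (CD.pd1 h i) _ hxO, pd_mul (CD.coord i) (CD.le1 h) _ hxO,
      pd_mul (CD.coord i) hsumC _ hxO, pd_sum _ (fun a => (CD.coord a).mul (CD.pd1 h a)) _ hxO]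
    simp only [pd_mul (CD.coord _) (CD.pd1 h _) _ hxO, pd_coord]
    simp only [ite_mul, one_mul, zero_mul, Finset.sum_add_distrib, Finset.sum_ite_eq',
      Finset.mem_univ, if_true]
    split_ifs <;> ring
  ext i j
  rw [HH, Hs, Matrix.of_apply, pd_congr (h1 i) j x hxO, pd_comp_nu (hPC i) j hxO, nu_of_sph hx,
    mem_sph.1 hx, inv_one, one_mul, Matrix.mul_apply]
  have hPi : ∀ a b, PiM x a b = (if a = b then 1 else 0) - x a * x b := by
    intro a b; simp [PiM, Matrix.one_apply, Matrix.vecMulVec_apply]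
  have h3 : ∀ b, (PiM x * Hs V x + (V x - ∑ a, x a * pd a V x) • (1 : Mt (n + 1))) i b = pd b (P i) x := by
    intro b
    rw [h2, Matrix.add_apply, Matrix.mul_apply]
    simp only [hPi, Hs, Matrix.of_apply, Matrix.smul_apply, Matrix.one_apply, smul_eq_mul, sub_mul, ite_mul, one_mul, zero_mul,
      Finset.sum_sub_distrib, Finset.sum_ite_eq, Finset.mem_univ, if_true, mul_assoc, ← Finset.mul_sum]
    split_ifs <;> ring
  simp only [h3, hPi, mul_sub, mul_ite, mul_one, mul_zero, Finset.sum_sub_distrib, Finset.sum_ite_eq', Finset.mem_univ, if_true]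
  rw [Finset.mul_sum]
  congr 1
  exact Finset.sum_congr rfl fun a _ => by ring

theorem PiM_mul_self {n : ℕ} {x : Eu n} (hx : x ∈ sph n) : PiM x * PiM x = PiM x := by
  have h : x.ofLp ⬝ᵥ x.ofLp = 1 := by
    have := real_inner_self_eq_norm_sq x
    rw [mem_sph.1 hx, PiLp.inner_apply] at this
    simpa [dotProduct, sq] using this
  simp only [PiM, sub_mul, mul_sub, one_mul, mul_one, Matrix.vecMulVec_mul_vecMulVec, h]
  simp

theorem C2_const {n : ℕ} (c : ℝ) : C2 (n := n) (fun _ => c) := homExt_CD contDiffOn_const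

theorem Hs_const {n : ℕ} (c : ℝ) (y : Eu n) : Hs (fun _ => c) y = 0 := by
  ext i j
  have : pd i (fun _ : Eu n => c) = fun _ => 0 := funext fun z => pd_const c i z
  simp only [Hs, Matrix.of_apply, this, pd_const, Matrix.zero_apply]

theorem HH_one {n : ℕ} {x : Eu n} (hx : x ∈ sph n) : HH (fun _ => 1) x = PiM x := by
  rw [HH_formula contDiffOn_const hx, Hs_const]
  simp [pd_const]

theorem inner_eq_sum {n : ℕ} (w y : Eu n) : ⟪w, y⟫ = ∑ a, w a * y a := by
  rw [PiLp.inner_apply]; simp [mul_comm]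

theorem CD_inner {n : ℕ} {r : WithTop ℕ∞} (w : Eu n) : CD r (fun y => ⟪w, y⟫) :=
  (contDiff_const.inner ℝ contDiff_id).contDiffOn

theorem pd_inner {n : ℕ} (w : Eu n) (i : Fin (n + 1)) (y : Eu n) : pd i (fun y => ⟪w, y⟫) y = w i := by
  have : fderiv ℝ (fun y => ⟪w, y⟫) y = innerSL ℝ w := (innerSL ℝ w).fderiv
  rw [pd, this]
  simp [ee, EuclideanSpace.inner_single_right]

theorem C2_inner {n : ℕ} (w : Eu n) : C2 (fun y => ⟪w, y⟫) := homExt_CD (CD_inner w)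

theorem HH_inner {n : ℕ} (w : Eu n) {x : Eu n} (hx : x ∈ sph n) : HH (fun y => ⟪w, y⟫) x = 0 := by
  rw [HH_formula (CD_inner w) hx]
  have h1 : Hs (fun y => ⟪w, y⟫) x = 0 := by
    ext i j
    have : pd i (fun y => ⟪w, y⟫) = fun _ => w i := funext fun z => pd_inner w i z
    simp only [Hs, Matrix.of_apply, this, pd_const, Matrix.zero_apply]
  have h2 : ∑ a, x a * w a = ⟪w, x⟫ := by
    rw [inner_eq_sum]; exact Finset.sum_congr rfl fun _ _ => mul_comm _ _
  simp [h1, pd_inner, h2]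

theorem C2_pow {n : ℕ} (w : Eu n) (l : ℕ) : C2 (fun y => ⟪w, y⟫ ^ l) := homExt_CD ((CD_inner w).pow l)

theorem pd_pow {n : ℕ} (w : Eu n) (l : ℕ) (i : Fin (n + 1)) (y : Eu n) :
    pd i (fun y => ⟪w, y⟫ ^ l) y = (l * w i) * ⟪w, y⟫ ^ (l - 1) := by
  have h0 : HasFDerivAt (fun y => ⟪w, y⟫) (innerSL ℝ w) y := (innerSL ℝ w).hasFDerivAt
  have := (h0.pow l).fderiv
  rw [pd, this]
  simp [ee, EuclideanSpace.inner_single_right]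
  ring

theorem tr_HH {n : ℕ} {V : Eu n → ℝ} (h : CD 2 V) {x : Eu n} (hx : x ∈ sph n) :
    (HH V x).trace = (Hs V x).trace - x.ofLp ⬝ᵥ (Hs V x).mulVec x.ofLp + n * (V x - ∑ a, x a * pd a V x) := by
  rw [HH_formula h hx, add_mul, Matrix.trace_add, Matrix.mul_assoc, Matrix.trace_mul_comm, Matrix.mul_assoc,
    PiM_mul_self hx, smul_mul_assoc, one_mul, Matrix.trace_smul]
  have hn : x.ofLp ⬝ᵥ x.ofLp = 1 := by
    have := real_inner_self_eq_norm_sq x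
    rw [mem_sph.1 hx, PiLp.inner_apply] at this
    simpa [dotProduct, sq] using this
  have h1 : (PiM x).trace = n := by
    rw [PiM, Matrix.trace_sub, Matrix.trace_vecMulVec, hn]; simp
  rw [h1, PiM, mul_sub, mul_one, Matrix.trace_sub, Matrix.mul_vecMulVec, Matrix.trace_vecMulVec, dotProduct_comm, smul_eq_mul]
  ring

theorem tr_pow {n : ℕ} (w : Eu n) (l : ℕ) {x : Eu n} (hx : x ∈ sph n) :
    (HH (fun y => ⟪w, y⟫ ^ l) x).trace =
      l * (l - 1 : ℕ) * ‖w‖ ^ 2 * ⟪w, x⟫ ^ (l - 2) - (l * (l - 1 : ℕ) - n + n * l) * ⟪w, x⟫ ^ l := by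
  rw [tr_HH ((CD_inner w).pow l) hx]
  have h1 : ∀ i j, Hs (fun y => ⟪w, y⟫ ^ l) x i j = l * w i * ((l - 1 : ℕ) * w j * ⟪w, x⟫ ^ (l - 2)) := by
    intro i j
    have : pd i (fun y => ⟪w, y⟫ ^ l) = fun y => (l * w i) * ⟪w, y⟫ ^ (l - 1) := funext fun z => pd_pow w l i z
    simp only [Hs, Matrix.of_apply, this]
    rw [pd_cmul _ ((CD_inner w).pow _) _ (sph_ne hx), pd_pow]
    rfl
  have h2 : ∑ a, x a * w a = ⟪w, x⟫ := by
    rw [inner_eq_sum]; exact Finset.sum_congr rfl fun _ _ => mul_comm _ _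
  have hw : ∑ a, w a * w a = ‖w‖ ^ 2 := by rw [← inner_eq_sum, real_inner_self_eq_norm_sq]
  have hp : ∑ a, x a * pd a (fun y => ⟪w, y⟫ ^ l) x = l * ⟪w, x⟫ ^ l := by
    simp only [pd_pow]
    have : ∀ a, x a * (l * w a * ⟪w, x⟫ ^ (l - 1)) = (l * ⟪w, x⟫ ^ (l - 1)) * (x a * w a) := fun a => by ring
    simp only [this]
    rw [← Finset.mul_sum, h2]
    rcases l with _ | l
    · simp
    · rw [Nat.add_sub_cancel, mul_assoc, ← pow_succ]
  have ht : (Hs (fun y => ⟪w, y⟫ ^ l) x).trace = l * (l - 1 : ℕ) * ‖w‖ ^ 2 * ⟪w, x⟫ ^ (l - 2) := by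
    simp only [Matrix.trace, Matrix.diag, h1]
    have : ∀ a, l * w a * ((l - 1 : ℕ) * w a * ⟪w, x⟫ ^ (l - 2)) = (l * (l - 1 : ℕ) * ⟪w, x⟫ ^ (l - 2)) * (w a * w a) :=
      fun a => by ring
    simp only [this]
    rw [← Finset.mul_sum, hw]; ring
  have hq : x.ofLp ⬝ᵥ (Hs (fun y => ⟪w, y⟫ ^ l) x).mulVec x.ofLp = l * (l - 1 : ℕ) * ⟪w, x⟫ ^ l := by
    simp only [Matrix.mulVec, dotProduct, h1]
    have : ∀ a, ∑ b, l * w a * ((l - 1 : ℕ) * w b * ⟪w, x⟫ ^ (l - 2)) * x b =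
        (l * (l - 1 : ℕ) * ⟪w, x⟫ ^ (l - 2)) * ⟪w, x⟫ * w a := by
      intro a
      generalize ⟪w, x⟫ ^ (l - 2) = q
      rw [← h2, Finset.mul_sum, Finset.sum_mul]
      exact Finset.sum_congr rfl fun _ _ => by ring
    simp only [this]
    have h4 : ∀ a, x a * (l * (l - 1 : ℕ) * ⟪w, x⟫ ^ (l - 2) * ⟪w, x⟫ * w a) = (l * (l - 1 : ℕ) * ⟪w, x⟫ ^ (l - 2) * ⟪w, x⟫) * (x a * w a) :=
      fun a => by ring
    simp only [h4]
    rw [← Finset.mul_sum, h2]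
    rcases l with _ | _ | l
    · simp
    · simp
    · rw [show l + 1 + 1 - 2 = l by omega]; ring
  rw [ht, hq, hp]; ring

/-! rigidity -/
theorem pd_hom {n : ℕ} {V : Eu n → ℝ} (h : CD 1 V) {t s : ℝ} (ht : 0 < t)
    (hV : ∀ y ∈ Oc n, V (t • y) = s * V y) (i : Fin (n + 1)) {y : Eu n} (hy : y ∈ Oc n) :
    t * pd i V (t • y) = s * pd i V y := by
  have hty : t • y ∈ Oc n := by simpa using ⟨ht.ne', hy⟩
  have h1 := pd_congr hV i y hy
  rw [pd_cmul s h i hy] at h1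
  rw [← h1, pd]
  have h2 : HasFDerivAt (fun y : Eu n => t • y) (t • ContinuousLinearMap.id ℝ (Eu n)) y :=
    (hasFDerivAt_id y).const_smul t
  have h3 := ((CD.diff h hty).hasFDerivAt.comp y h2).fderiv
  have h5 : (V ∘ fun y : Eu n => t • y) = fun z => V (t • z) := rfl
  rw [h5] at h3
  rw [pd, h3]; simp

theorem HH_zero {n : ℕ} (hn : 1 ≤ n) {u : Eu n → ℝ} (hu : C2 u) (h : ∀ x ∈ sph n, HH u x = 0) :
    ∃ w : Eu n, ∀ x ∈ sph n, u x = ⟪w, x⟫ := by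
  have h1 : ∀ t : ℝ, t > 0 → ∀ i, ∀ y ∈ Oc n, pd i (homExt u) (t • y) = 1 * pd i (homExt u) y := by
    intro t ht i y hy
    have := pd_hom (CD.le1 hu) ht (fun y _ => homExt_smul u ht y) i hy
    rw [one_mul]
    exact mul_left_cancel₀ ht.ne' this
  have h2 : ∀ i, ∀ y ∈ Oc n, fderiv ℝ (pd i (homExt u)) y = 0 := by
    intro i y hy
    have h0 : 0 < ‖y‖ := norm_pos_iff.2 hy
    ext z
    rw [fderiv_eq_sum]
    refine Finset.sum_eq_zero fun j _ => ?_
    have h3 := pd_hom (CD.pd1 hu i) (inv_pos.2 h0) (h1 _ (inv_pos.2 h0) i) j hy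
    have h4 : pd j (pd i (homExt u)) (‖y‖⁻¹ • y) = 0 :=
      congrFun (congrFun (h _ (nu_sph hy)) i) j
    rw [h4, mul_zero, one_mul] at h3
    rw [← h3, mul_zero]
  have hpre : IsPreconnected (Oc n) := by
    refine (isConnected_compl_singleton_of_one_lt_rank ?_ 0).isPreconnected
    rw [← Module.finrank_eq_rank, finrank_euclideanSpace_fin]
    exact_mod_cast (by omega : 1 < n + 1)
  have h3 : ∀ i, ∃ c, ∀ y ∈ Oc n, pd i (homExt u) y = c := by
    intro i
    refine ⟨pd i (homExt u) (ee 0), fun y hy => ?_⟩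
    exact (Oc_open n).is_const_of_fderiv_eq_zero hpre
      (fun z hz => (CD.diff (CD.pd1 hu i) hz).differentiableWithinAt) (h2 i) hy
      (sph_ne (sph_nonempty n))
  choose c hc using h3
  refine ⟨WithLp.toLp 2 c, fun x hx => ?_⟩
  have h4 := euler1 (CD.le1 hu) (fun _ ht _ _ => homExt_smul u ht _) (sph_ne hx)
  rw [homExt_sph u hx] at h4
  rw [← h4, inner_eq_sum]
  refine Finset.sum_congr rfl fun i _ => ?_
  rw [hc i x (sph_ne hx)]; exact mul_comm _ _

/-- mdisc as a continuous multilinear map on curried functions -/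
def mdC (N : ℕ) : ContinuousMultilinearMap ℝ (fun _ : Fin N => Fin N → Fin N → ℝ) ℝ :=
  { toMultilinearMap := (mdisc ℝ N : MultilinearMap ℝ (fun _ : Fin N => Fin N → Fin N → ℝ) ℝ)
    cont := mdisc_continuous (N := N) (fun A => A) (fun i => continuous_apply i) }

theorem mdC_eq (N : ℕ) (A : Fin N → Mt N) : mdC N A = mdisc ℝ N A := rfl

theorem mdisc_CD {n N : ℕ} {r : WithTop ℕ∞} (A : Fin N → Eu n → Mt N) (hA : ∀ i a b, CD r (fun y => A i y a b)) :
    CD r (fun y => mdisc ℝ N (fun i => A i y)) := by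
  have h1 : ContDiffOn ℝ r (fun y => (fun i a b => A i y a b : Fin N → Fin N → Fin N → ℝ)) (Oc n) :=
    contDiffOn_pi.2 fun i => contDiffOn_pi.2 fun a => contDiffOn_pi.2 fun b => hA i a b
  exact (mdC N).contDiff.comp_contDiffOn h1

/-- entrywise derivative -/
def pdM {n N : ℕ} (c : Fin (n + 1)) (M : Eu n → Mt N) (y : Eu n) : Mt N :=
  Matrix.of fun a b => pd c (fun z => M z a b) y

theorem pd_mdisc {n N : ℕ} (A : Fin N → Eu n → Mt N) (hA : ∀ i a b, CD 1 (fun y => A i y a b))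
    (c : Fin (n + 1)) {y : Eu n} (hy : y ∈ Oc n) :
    pd c (fun y => mdisc ℝ N (fun i => A i y)) y =
      ∑ i, mdisc ℝ N (Function.update (fun i => A i y) i (pdM c (A i) y)) := by
  have h1 : ∀ i a b, HasFDerivAt (fun y => A i y a b) (fderiv ℝ (fun y => A i y a b) y) y :=
    fun i a b => (CD.diff (hA i a b) hy).hasFDerivAt
  have h2 : HasFDerivAt (fun y => (fun i a b => A i y a b : Fin N → Fin N → Fin N → ℝ))
      (ContinuousLinearMap.pi fun i => ContinuousLinearMap.pi fun a => ContinuousLinearMap.pi fun b =>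
        fderiv ℝ (fun y => A i y a b) y) y :=
    hasFDerivAt_pi.2 fun i => hasFDerivAt_pi.2 fun a => hasFDerivAt_pi.2 fun b => h1 i a b
  have h3 := (((mdC N).hasFDerivAt (fun i a b => A i y a b)).comp y h2).fderiv
  have h4 : pd c (fun y => mdisc ℝ N (fun i => A i y)) y = fderiv ℝ (⇑(mdC N) ∘ fun y => (fun i a b => A i y a b : Fin N → Fin N → Fin N → ℝ)) y (ee c) := rfl
  rw [h4, h3, ContinuousLinearMap.comp_apply, ContinuousMultilinearMap.linearDeriv_apply]
  rfl

theorem pdM_const {n N : ℕ} (c : Fin (n + 1)) (M : Mt N) (y : Eu n) : pdM c (fun _ => M) y = 0 := by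
  ext a b; simp [pdM, pd_const]

/-- slots -/
def sl {n : ℕ} (k : ℕ) (w : ℕ → Eu n → ℝ) (y : Eu n) (i : Fin (n + 1)) : Mt (n + 1) :=
  if (i : ℕ) < k then HH (w i) y else 1

/-- mixed discriminant with first slot free -/
def Dm {n : ℕ} (k : ℕ) (w : ℕ → Eu n → ℝ) (y : Eu n) (B : Mt (n + 1)) : ℝ :=
  mdisc ℝ (n + 1) (Function.update (sl k w y) 0 B)

theorem Dm_add {n : ℕ} (k : ℕ) (w : ℕ → Eu n → ℝ) (y : Eu n) (B C : Mt (n + 1)) :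
    Dm k w y (B + C) = Dm k w y B + Dm k w y C := by simp [Dm]

theorem Dm_smul {n : ℕ} (k : ℕ) (w : ℕ → Eu n → ℝ) (y : Eu n) (c : ℝ) (B : Mt (n + 1)) :
    Dm k w y (c • B) = c * Dm k w y B := by simp [Dm]

theorem Dm_sum {n : ℕ} {ι : Type*} (s : Finset ι) (k : ℕ) (w : ℕ → Eu n → ℝ) (y : Eu n) (B : ι → Mt (n + 1)) :
    Dm k w y (∑ i ∈ s, B i) = ∑ i ∈ s, Dm k w y (B i) := by simp [Dm, MultilinearMap.map_update_sum]

/-- elementary matrix -/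
def Em {N : ℕ} (a b : Fin N) : Mt N := Matrix.vecMulVec (Pi.single a 1) (Pi.single b 1)

theorem sum_Em {N : ℕ} (B : Mt N) : B = ∑ a, ∑ b, B a b • Em a b := by
  ext i j
  simp [Matrix.sum_apply, Em, Matrix.vecMulVec_apply, Pi.single_apply]

theorem Dm_expand {n : ℕ} (k : ℕ) (w : ℕ → Eu n → ℝ) (y : Eu n) (B : Mt (n + 1)) :
    Dm k w y B = ∑ a, ∑ b, B a b * Dm k w y (Em a b) := by
  conv_lhs => rw [sum_Em B]
  simp only [Dm_sum, Dm_smul]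

theorem mdisc_transpose {N : ℕ} (A : Fin N → Mt N) : mdisc ℝ N (fun i => (A i).transpose) = mdisc ℝ N A := by
  rw [mdisc_apply, mdisc_apply]
  simp only [Matrix.det_apply, Matrix.of_apply, Matrix.transpose_apply]
  rw [Finset.sum_comm]
  conv_rhs => rw [Finset.sum_comm]
  refine Fintype.sum_equiv (Equiv.inv _) _ _ fun τ => ?_
  refine Fintype.sum_equiv (Equiv.mulRight τ) _ _ fun σ => ?_
  simp only [Equiv.inv_apply, Equiv.Perm.sign_inv, Equiv.coe_mulRight, Equiv.Perm.mul_apply]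
  congr 1
  rw [← Equiv.prod_comp τ⁻¹]
  refine Finset.prod_congr rfl fun i _ => ?_
  simp

theorem sphInt_sum {n : ℕ} {ι : Type*} (s : Finset ι) {f : ι → Eu n → ℝ} (hf : ∀ i ∈ s, CS (f i)) :
    sphInt n (fun x => ∑ i ∈ s, f i x) = ∑ i ∈ s, sphInt n (f i) := by
  simp only [sphInt_def]
  exact integral_finset_sum s fun i hi => CS.int (hf i hi)

/-- rotation field -/
def rotE {n : ℕ} (a b : Fin (n + 1)) : Eu n →L[ℝ] Eu n :=
  (EuclideanSpace.proj a : Eu n →L[ℝ] ℝ).smulRight (ee b) - (EuclideanSpace.proj b : Eu n →L[ℝ] ℝ).smulRight (ee a)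

theorem rotE_apply {n : ℕ} (a b : Fin (n + 1)) (x : Eu n) : rotE a b x = x a • ee b - x b • ee a := rfl

theorem rotE_skew {n : ℕ} (a b : Fin (n + 1)) (x : Eu n) : ⟪rotE a b x, x⟫ = 0 := by
  rw [rotE_apply, inner_sub_left, inner_smul_left, inner_smul_left]
  simp [ee, EuclideanSpace.inner_single_left]
  ring

theorem div_int {n : ℕ} (X : Fin (n + 1) → Eu n → ℝ) (hX : ∀ b, CD 1 (X b))
    (ht : ∀ y ∈ Oc n, ∑ b, y b * X b y = 0) : sphInt n (fun x => ∑ b, pd b (X b) x) = 0 := by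
  have hh : ∀ a b, CD 1 (fun y : Eu n => y a * X b y) := fun a b => ContDiffOn.mul (CD.coord a) (hX b)
  have key : ∀ x ∈ sph n, ∑ b, pd b (X b) x =
      ∑ a, ∑ b, fderiv ℝ (fun y : Eu n => y a * X b y) x (rotE a b x) := by
    intro x hx
    have hy := sph_ne hx
    have h1 : ∀ a b, fderiv ℝ (fun y : Eu n => y a * X b y) x (rotE a b x) =
        x a ^ 2 * pd b (X b) x + (if a = b then x a * X b x else 0) - x a * (x b * pd a (X b) x) - x b * X b x := by
      intro a b
      rw [rotE_apply, map_sub, map_smul, map_smul]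
      change x a * pd b (fun y : Eu n => y a * X b y) x - x b * pd a (fun y : Eu n => y a * X b y) x = _
      rw [pd_mul (CD.coord a) (hX b) b hy, pd_mul (CD.coord a) (hX b) a hy, pd_coord, pd_coord]
      split_ifs <;> simp_all <;> ring
    have h2 : ∀ a, ∑ b, x b * pd a (X b) x = - X a x := by
      intro a
      have := pd_congr (B := fun _ => 0) ht a x hy
      rw [pd_const, pd_sum _ (fun b => hh b b) a hy] at this
      have h3 : ∀ b, pd a (fun y : Eu n => y b * X b y) x = x b * pd a (X b) x + if b = a then X b x else 0 := by
        intro b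
        rw [pd_mul (CD.coord b) (hX b) a hy, pd_coord]
        split_ifs <;> simp
      simp only [h3, Finset.sum_add_distrib, Finset.sum_ite_eq', Finset.mem_univ, if_true] at this
      linarith
    have h4 : ∑ a, x a ^ 2 = 1 := by
      have := EuclideanSpace.real_norm_sq_eq x
      rw [mem_sph.1 hx] at this
      simpa using this.symm
    simp only [h1, Finset.sum_sub_distrib, Finset.sum_add_distrib, ← Finset.mul_sum, h2,
      ← Finset.sum_mul, h4, Finset.sum_ite_eq, Finset.mem_univ, if_true, ht x hy, mul_neg, Finset.sum_neg_distrib]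
    simp
  have hcs : ∀ a b, CS (fun x => fderiv ℝ (fun y : Eu n => y a * X b y) x (rotE a b x)) := by
    intro a b
    exact (((hh a b).continuousOn_fderiv_of_isOpen (Oc_open n) le_rfl).clm_apply
      (rotE a b).continuous.continuousOn).mono (sph_sub n)
  rw [sphInt_congr key, sphInt_sum _ (fun a _ => continuousOn_finset_sum _ fun b _ => hcs a b)]
  refine Finset.sum_eq_zero fun a _ => ?_
  rw [sphInt_sum _ (fun b _ => hcs a b)]
  exact Finset.sum_eq_zero fun b _ => rot_int _ (rotE_skew a b) _ (hh a b)

theorem mdisc_anti {N : ℕ} (S : Fin N → Mt N) {i j : Fin N} (hij : i ≠ j) (p q y z : Fin N → ℝ) :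
    mdisc ℝ N (Function.update (Function.update S i (Matrix.vecMulVec p y)) j (Matrix.vecMulVec q z)) =
    - mdisc ℝ N (Function.update (Function.update S i (Matrix.vecMulVec p z)) j (Matrix.vecMulVec q y)) := by
  have h0 : ∀ v : Fin N → ℝ, mdisc ℝ N (Function.update (Function.update S i (Matrix.vecMulVec p v)) j
      (Matrix.vecMulVec q v)) = 0 := by
    intro v
    refine mdisc_vecMul_zero (i := i) (j := j) (x := p) (y := v) (z := q) _ hij ?_ ?_
    · rw [Function.update_of_ne hij, Function.update_self]
    · rw [Function.update_self]
  have h1 := h0 (y + z)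
  rw [Matrix.vecMulVec_add, Matrix.vecMulVec_add, MultilinearMap.map_update_add,
    Function.update_comm hij, Function.update_comm hij, MultilinearMap.map_update_add,
    MultilinearMap.map_update_add, Function.update_comm hij.symm, Function.update_comm hij.symm,
    Function.update_comm hij.symm, Function.update_comm hij.symm, h0, h0] at h1
  linarith

section smooth
variable {n k : ℕ} {w : ℕ → Eu n → ℝ}

theorem sl_symm (hw : ∀ i, i < k → C2 (w i)) {y : Eu n} (hy : y ∈ Oc n) (i : Fin (n + 1)) :
    (sl k w y i).IsSymm := by
  unfold sl; split_ifs with h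
  · exact Hs_symm (hw _ h) hy
  · exact Matrix.isSymm_one

theorem Dm_Em_symm (hw : ∀ i, i < k → C2 (w i)) {y : Eu n} (hy : y ∈ Oc n) (a b : Fin (n + 1)) :
    Dm k w y (Em a b) = Dm k w y (Em b a) := by
  unfold Dm
  rw [← mdisc_transpose]
  congr 1
  funext i
  by_cases hi : i = 0
  · subst hi; simp [Em, Matrix.transpose_vecMulVec]
  · rw [Function.update_of_ne hi, Function.update_of_ne hi]
    exact sl_symm hw hy i

theorem sl_rad (hw : ∀ i, i < k → C2 (w i)) {x : Eu n} (hx : x ∈ sph n) (i : Fin (n + 1)) :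
    sl k w x i = 1 ∨ ((sl k w x i).IsSymm ∧ (sl k w x i).mulVec x.ofLp = 0) := by
  unfold sl; split_ifs with h
  · exact Or.inr ⟨HH_symm (hw _ h) hx, HH_rad (hw _ h) hx⟩
  · exact Or.inl rfl

theorem CD_ent (hw : ∀ i, i < k → CD 3 (homExt (w i))) (i : Fin (n + 1)) (a b : Fin (n + 1)) :
    CD 1 (fun y => sl k w y i a b) := by
  unfold sl; split_ifs with h
  · exact CD.pd1 (CD.pd2 (hw _ h) a) b
  · exact contDiffOn_const

theorem upd_ent (hw : ∀ i, i < k → CD 3 (homExt (w i))) (M : Mt (n + 1)) (i : Fin (n + 1)) (c d : Fin (n + 1)) :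
    CD 1 (fun y => Function.update (sl k w y) 0 M i c d) := by
  by_cases hi : i = 0
  · subst hi; simp only [Function.update_self]; exact contDiffOn_const
  · simp only [Function.update_of_ne hi]; exact CD_ent hw i c d

theorem Dm_CD (hw : ∀ i, i < k → CD 3 (homExt (w i))) (M : Mt (n + 1)) :
    CD 1 (fun y => Dm k w y M) :=
  mdisc_CD (fun i y => Function.update (sl k w y) 0 M i) (upd_ent hw M)

theorem div_N (hw : ∀ i, i < k → CD 3 (homExt (w i))) (a : Fin (n + 1)) {y : Eu n} (hy : y ∈ Oc n) :
    ∑ b, pd b (fun y => Dm k w y (Em a b)) y = 0 := by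
  have h1 : ∀ b, pd b (fun y => Dm k w y (Em a b)) y = ∑ i, mdisc ℝ (n+1) (Function.update
      (Function.update (sl k w y) 0 (Em a b)) i (pdM b (fun y => Function.update (sl k w y) 0 (Em a b) i) y)) :=
    fun b => pd_mdisc (fun i y => Function.update (sl k w y) 0 (Em a b) i) (upd_ent hw (Em a b)) b hy
  simp only [h1]
  rw [Finset.sum_comm]
  refine Finset.sum_eq_zero fun i _ => ?_
  by_cases hi : i = 0
  · subst hi
    refine Finset.sum_eq_zero fun b _ => ?_
    simp only [Function.update_self]
    rw [pdM_const, MultilinearMap.map_update_zero]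
  simp only [Function.update_of_ne hi]
  by_cases hk : (i : ℕ) < k
  swap
  · refine Finset.sum_eq_zero fun b _ => ?_
    have : (fun y => sl k w y i) = fun _ => 1 := by funext z; simp [sl, hk]
    rw [this, pdM_const, MultilinearMap.map_update_zero]
  set T : Fin (n+1) → Fin (n+1) → Fin (n+1) → ℝ := fun b c d => pd b (pd d (pd c (homExt (w i)))) y
  have hT : ∀ b c d, T b c d = T d c b := by
    intro b c d
    exact (congrFun (congrFun (Hs_symm (CD.pd2 (hw i hk) c) hy) b) d)
  set M : Fin (n+1) → Fin (n+1) → Fin (n+1) → ℝ := fun b c d => mdisc ℝ (n+1) (Function.update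
      (Function.update (sl k w y) 0 (Em a b)) i (Em c d))
  have hM : ∀ b c d, M b c d = - M d c b := fun b c d => mdisc_anti _ (Ne.symm hi) _ _ _ _
  have h2 : ∀ b, mdisc ℝ (n+1) (Function.update (Function.update (sl k w y) 0 (Em a b)) i
      (pdM b (fun y => sl k w y i) y)) = ∑ c, ∑ d, T b c d * M b c d := by
    intro b
    rw [sum_Em (pdM b (fun y => sl k w y i) y)]
    simp only [MultilinearMap.map_update_sum, MultilinearMap.map_update_smul, smul_eq_mul]
    refine Finset.sum_congr rfl fun c _ => Finset.sum_congr rfl fun d _ => ?_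
    congr 1
    simp [pdM, sl, hk, HH, Hs, T]
  simp only [h2]
  have h3 : ∑ b, ∑ c, ∑ d, T b c d * M b c d = - ∑ b, ∑ c, ∑ d, T b c d * M b c d := by
    conv_lhs =>
      rw [Finset.sum_comm]
      enter [2, c]
      rw [Finset.sum_comm]
    conv_rhs => rw [Finset.sum_comm]
    simp only [← Finset.sum_neg_distrib]
    refine Finset.sum_congr rfl fun c _ => Finset.sum_congr rfl fun d _ => Finset.sum_congr rfl fun b _ => ?_
    rw [hT b c d, hM b c d]; ring
  linarith

theorem sym_smooth (hw : ∀ i, i < k → CD 3 (homExt (w i))) {f g : Eu n → ℝ} (hf : C2 f) (hg : C2 g) :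
    sphInt n (fun x => f x * Dm k w x (HH g x) - g x * Dm k w x (HH f x)) = 0 := by
  have hw2 : ∀ i, i < k → C2 (w i) := fun i hi => CD.le2 (hw i hi)
  set F := homExt f
  set G := homExt g
  set p : Fin (n+1) → Eu n → ℝ := fun a y => F y * pd a G y - G y * pd a F y with hp
  have hpC : ∀ a, CD 1 (p a) := fun a =>
    ContDiffOn.sub (ContDiffOn.mul (CD.le1 hf) (CD.pd1 hg a)) (ContDiffOn.mul (CD.le1 hg) (CD.pd1 hf a))
  have hN : ∀ a b, CD 1 (fun y => Dm k w y (Em a b)) := fun a b => Dm_CD hw _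
  set X : Fin (n+1) → Eu n → ℝ := fun b y => ∑ a, p a y * Dm k w y (Em a b) with hX
  have hm : ∀ a b, CD 1 (fun y => p a y * Dm k w y (Em a b)) := fun a b => ContDiffOn.mul (hpC a) (hN a b)
  have hXC : ∀ b, CD 1 (X b) := fun b => ContDiffOn.sum fun a _ => hm a b
  have htan : ∀ y ∈ Oc n, ∑ b, y b * X b y = 0 := by
    intro y hy
    have e1 : ∑ b, y b * X b y = Dm k w y (Matrix.vecMulVec (fun a => p a y) y.ofLp) := by
      rw [Dm_expand, Finset.sum_comm]
      refine Finset.sum_congr rfl fun b _ => ?_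
      simp only [hX, Finset.mul_sum, Matrix.vecMulVec_apply]
      refine Finset.sum_congr rfl fun a _ => by ring
    have hr : 0 < ‖y‖ := norm_pos_iff.2 hy
    have e2 : Matrix.vecMulVec (fun a => p a y) y.ofLp = ‖y‖ • Matrix.vecMulVec (fun a => p a y) (‖y‖⁻¹ • y.ofLp) := by
      rw [Matrix.vecMulVec_smul, smul_smul, mul_inv_cancel₀ hr.ne', one_smul]
    have hyy : y.ofLp ⬝ᵥ y.ofLp = ‖y‖ ^ 2 := by
      rw [EuclideanSpace.real_norm_sq_eq]; simp [dotProduct, sq]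
    rw [e1, e2, Dm_smul]
    refine mul_eq_zero_of_right _ ?_
    refine mdisc_rad _ 0 _ _ ?_ ?_ (Function.update_self _ _ _) ?_
    · rw [smul_dotProduct, dotProduct_smul, hyy]; simp only [smul_eq_mul]; field_simp
    · rw [dotProduct_smul]
      refine smul_eq_zero_of_right _ ?_
      have e3 := euler1 (CD.le1 hf) (fun _ ht _ _ => homExt_smul f ht _) hy
      have e4 := euler1 (CD.le1 hg) (fun _ ht _ _ => homExt_smul g ht _) hy
      have : (fun a => p a y) ⬝ᵥ y.ofLp = F y * (∑ i, y i * pd i G y) - G y * (∑ i, y i * pd i F y) := by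
        rw [Finset.mul_sum, Finset.mul_sum, ← Finset.sum_sub_distrib]
        refine Finset.sum_congr rfl fun a _ => ?_
        simp only [hp]; ring
      rw [this, e3, e4]; ring
    · intro j hj
      rw [Function.update_of_ne hj]
      unfold sl; split_ifs with h
      · right
        refine ⟨Hs_symm (hw2 _ h) hy, ?_⟩
        rw [Matrix.mulVec_smul, HH, euler2 (hw2 _ h) (fun _ ht _ _ => homExt_smul _ ht _) hy, smul_zero]
      · exact Or.inl rfl
  rw [← div_int X hXC htan]
  refine sphInt_congr fun x hx => ?_
  have hy := sph_ne hx
  have h1 : ∀ b, pd b (X b) x = ∑ a, (p a x * pd b (fun y => Dm k w y (Em a b)) x + pd b (p a) x * Dm k w x (Em a b)) := by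
    intro b
    rw [hX]
    change pd b (fun y => ∑ a, p a y * Dm k w y (Em a b)) x = _
    rw [pd_sum _ (fun a => hm a b) b hy]
    exact Finset.sum_congr rfl fun a _ => pd_mul (hpC a) (hN a b) b hy
  have h2 : ∀ a b, pd b (p a) x = F x * Hs G x a b - G x * Hs F x a b + (pd b F x * pd a G x - pd a F x * pd b G x) := by
    intro a b
    rw [hp]
    change pd b (fun y => F y * pd a G y - G y * pd a F y) x = _
    rw [pd_sub (ContDiffOn.mul (CD.le1 hf) (CD.pd1 hg a)) (ContDiffOn.mul (CD.le1 hg) (CD.pd1 hf a)) b hy,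
      pd_mul (CD.le1 hf) (CD.pd1 hg a) b hy, pd_mul (CD.le1 hg) (CD.pd1 hf a) b hy]
    simp only [Hs, Matrix.of_apply]; ring
  have h3 : ∑ b, ∑ a, (pd b F x * pd a G x - pd a F x * pd b G x) * Dm k w x (Em a b) = 0 := by
    have : ∑ b, ∑ a, (pd b F x * pd a G x - pd a F x * pd b G x) * Dm k w x (Em a b) =
       - ∑ b, ∑ a, (pd b F x * pd a G x - pd a F x * pd b G x) * Dm k w x (Em a b) := by
      conv_lhs => rw [Finset.sum_comm]
      simp only [← Finset.sum_neg_distrib]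
      refine Finset.sum_congr rfl fun c _ => Finset.sum_congr rfl fun d _ => ?_
      rw [Dm_Em_symm hw2 hy c d]; ring
    linarith
  have h4 : ∑ b, ∑ a, p a x * pd b (fun y => Dm k w y (Em a b)) x = 0 := by
    rw [Finset.sum_comm]
    refine Finset.sum_eq_zero fun a _ => ?_
    rw [← Finset.mul_sum, div_N hw a hy, mul_zero]
  simp only [h1, h2, Finset.sum_add_distrib, add_mul, h4, h3, zero_add, add_zero]
  rw [← homExt_sph f hx, ← homExt_sph g hx, Dm_expand, Dm_expand k w x (HH f x), Finset.sum_comm]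
  rw [Finset.sum_comm (f := fun a b => HH f x a b * Dm k w x (Em a b))]
  simp only [Finset.mul_sum]
  rw [← Finset.sum_sub_distrib]
  refine Finset.sum_congr rfl fun b _ => ?_
  rw [← Finset.sum_sub_distrib]
  refine Finset.sum_congr rfl fun a _ => ?_
  simp only [HH]; ring
end smooth

open scoped Convolution in
theorem moll {n : ℕ} (φ : ContDiffBump (0 : Eu n)) {g : Eu n → ℝ} (hg : ContDiff ℝ 1 g) (hc : HasCompactSupport g)
    (i : Fin (n + 1)) (x : Eu n) :
    pd i (φ.normed volume ⋆[ContinuousLinearMap.lsmul ℝ ℝ, volume] g) x =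
      (φ.normed volume ⋆[ContinuousLinearMap.lsmul ℝ ℝ, volume] (pd i g)) x := by
  have hli : LocallyIntegrable (φ.normed volume) (volume : Measure (Eu n)) :=
    φ.continuous_normed.locallyIntegrable
  rw [pd, (hc.hasFDerivAt_convolution_right (ContinuousLinearMap.lsmul ℝ ℝ) hli hg x).fderiv,
    convolution_precompR_apply _ hli (hc.fderiv ℝ) (hg.continuous_fderiv one_ne_zero)]
  rfl

theorem pd_ContDiff {n : ℕ} {r s : WithTop ℕ∞} {g : Eu n → ℝ} (hg : ContDiff ℝ r g) (h : s + 1 ≤ r) (i : Fin (n + 1)) :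
    ContDiff ℝ s (pd i g) := (hg.fderiv_right h).clm_apply contDiff_const

theorem pd_compact {n : ℕ} {g : Eu n → ℝ} (hc : HasCompactSupport g) (i : Fin (n + 1)) :
    HasCompactSupport (pd i g) := hc.fderiv_apply ℝ _

open scoped Convolution in
theorem moll_near {n : ℕ} {g : Eu n → ℝ} (hg : Continuous g) (hc : HasCompactSupport g) {ε : ℝ} (hε : 0 < ε) :
    ∃ δ > 0, ∀ φ : ContDiffBump (0 : Eu n), φ.rOut ≤ δ → ∀ x,
      |(φ.normed volume ⋆[ContinuousLinearMap.lsmul ℝ ℝ, volume] g) x - g x| ≤ ε := by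
  obtain ⟨δ, hδ, h⟩ := Metric.uniformContinuous_iff.1 (hc.uniformContinuous_of_continuous hg) ε hε
  refine ⟨δ, hδ, fun φ hφ x => ?_⟩
  exact φ.dist_normed_convolution_le hg.aestronglyMeasurable fun y hy =>
    (h (lt_of_lt_of_le (Metric.mem_ball.1 hy) hφ)).le

theorem smooth_near {n : ℕ} {g : Eu n → ℝ} (hg : ContDiff ℝ 2 g) (hc : HasCompactSupport g) {ε : ℝ} (hε : 0 < ε) :
    ∃ V : Eu n → ℝ, ContDiff ℝ 3 V ∧ ∀ x, |V x - g x| ≤ ε ∧ (∀ i, |pd i V x - pd i g x| ≤ ε) ∧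
      ∀ i j, |Hs V x i j - Hs g x i j| ≤ ε := by
  have h1 : ∀ i, ContDiff ℝ 1 (pd i g) := pd_ContDiff hg (by norm_num [one_add_one_eq_two])
  have h2 : ∀ i j, Continuous (pd j (pd i g)) := fun i j => (pd_ContDiff (s := 0) (h1 i) (by simp) j).continuous
  obtain ⟨δ0, hδ0, H0⟩ := moll_near hg.continuous hc hε
  choose δ1 hδ1 H1 using fun i => moll_near (h1 i).continuous (pd_compact hc i) hε
  choose δ2 hδ2 H2 using fun p : Fin (n+1) × Fin (n+1) => moll_near (h2 p.1 p.2) (pd_compact (pd_compact hc p.1) p.2) hε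
  obtain ⟨δ, hδ, hδa, hδb, hδc⟩ : ∃ δ > 0, δ ≤ δ0 ∧ (∀ i, δ ≤ δ1 i) ∧ ∀ p, δ ≤ δ2 p := by
    have e1 : ∀ᶠ δ in 𝓝[>] (0:ℝ), δ ≤ δ0 := nhdsWithin_le_nhds (eventually_le_nhds hδ0)
    have e2 : ∀ᶠ δ in 𝓝[>] (0:ℝ), ∀ i, δ ≤ δ1 i :=
      eventually_all.2 fun i => nhdsWithin_le_nhds (eventually_le_nhds (hδ1 i))
    have e3 : ∀ᶠ δ in 𝓝[>] (0:ℝ), ∀ i, δ ≤ δ2 i :=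
      eventually_all.2 fun i => nhdsWithin_le_nhds (eventually_le_nhds (hδ2 i))
    obtain ⟨δ, ⟨⟨ha, hb⟩, hc⟩, hd⟩ := (((e1.and e2).and e3).and self_mem_nhdsWithin).exists
    exact ⟨δ, hd, ha, hb, hc⟩
  let φ : ContDiffBump (0 : Eu n) := ⟨δ / 2, δ, by linarith, by linarith⟩
  have hφ : φ.rOut = δ := rfl
  have m1 : ∀ i, pd i (MeasureTheory.convolution (φ.normed volume) g (ContinuousLinearMap.lsmul ℝ ℝ) volume) =
      MeasureTheory.convolution (φ.normed volume) (pd i g) (ContinuousLinearMap.lsmul ℝ ℝ) volume :=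
    fun i => funext fun x => moll φ (hg.of_le one_le_two) hc i x
  refine ⟨MeasureTheory.convolution (φ.normed volume) g (ContinuousLinearMap.lsmul ℝ ℝ) volume, ?_, fun x => ⟨?_, ?_, ?_⟩⟩
  · exact_mod_cast HasCompactSupport.contDiff_convolution_left (n := 3) (ContinuousLinearMap.lsmul ℝ ℝ) φ.hasCompactSupport_normed
      (by exact_mod_cast φ.contDiff_normed) hg.continuous.locallyIntegrable
  · exact H0 φ (by rw [hφ]; exact hδa) x
  · intro i
    rw [m1]
    exact H1 i φ (by rw [hφ]; exact hδb i) x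
  · intro i j
    simp only [Hs, Matrix.of_apply]
    rw [m1, moll φ (h1 i) (pd_compact hc i)]
    exact H2 (i, j) φ (by rw [hφ]; exact hδc (i, j)) x

theorem cutoff {n : ℕ} {u : Eu n → ℝ} (hu : C2 u) :
    ∃ g : Eu n → ℝ, ContDiff ℝ 2 g ∧ HasCompactSupport g ∧ ∀ x ∈ sph n, g x = u x := by
  let a : ContDiffBump (0 : Eu n) := ⟨4, 8, by norm_num, by norm_num⟩
  let b : ContDiffBump (0 : Eu n) := ⟨1/4, 1/2, by norm_num, by norm_num⟩
  refine ⟨fun y => (a y - b y) * homExt u y, ?_, ?_, ?_⟩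
  · rw [contDiff_iff_contDiffAt]
    intro y
    by_cases hy : y = 0
    · have : (fun y => (a y - b y) * homExt u y) =ᶠ[𝓝 y] fun _ => 0 := by
        filter_upwards [Metric.ball_mem_nhds y (by norm_num : (0:ℝ) < 1/4)] with z hz
        rw [hy] at hz
        have e1 : a z = 1 := a.one_of_mem_closedBall (by
          have : dist z 0 < 1/4 := hz
          change dist z 0 ≤ 4; linarith)
        have e2 : b z = 1 := b.one_of_mem_closedBall (by
          have : dist z 0 < 1/4 := hz
          change dist z 0 ≤ 1/4; linarith)
        simp [e1, e2]
      exact contDiffAt_const.congr_of_eventuallyEq this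
    · exact (a.contDiff.contDiffAt.sub b.contDiff.contDiffAt).mul (CD.at hu hy)
  · have : HasCompactSupport (fun y => a y - b y) := a.hasCompactSupport.sub b.hasCompactSupport
    exact this.mul_right
  · intro x hx
    have h := mem_sph.1 hx
    have e1 : a x = 1 := a.one_of_mem_closedBall (by
      change dist x 0 ≤ 4; rw [dist_zero_right, h]; norm_num)
    have e2 : b x = 0 := b.zero_of_le_dist (by
      change 1/2 ≤ dist x 0; rw [dist_zero_right, h]; norm_num)
    simp [e1, e2, homExt_sph u hx]

theorem PiM_bd {n : ℕ} {x : Eu n} (hx : x ∈ sph n) (a b : Fin (n + 1)) : |PiM x a b| ≤ 2 := by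
  have h1 : ∀ a, |x a| ≤ 1 := fun a => by
    rw [← mem_sph.1 hx]; exact PiLp.norm_apply_le x a
  have h2 : |x a * x b| ≤ 1 := by rw [abs_mul]; exact mul_le_one₀ (h1 a) (abs_nonneg _) (h1 b)
  have h3 : |(1 : Mt (n+1)) a b| ≤ 1 := by rw [Matrix.one_apply]; split_ifs <;> simp
  simp only [PiM, Matrix.sub_apply, Matrix.vecMulVec_apply]
  calc _ ≤ |(1 : Mt (n+1)) a b| + |x a * x b| := abs_sub _ _
    _ ≤ 2 := by linarith

theorem ent_mul_bd {N : ℕ} {A B : Mt N} {s t : ℝ} (hs : 0 ≤ s) (hA : ∀ a b, |A a b| ≤ s) (hB : ∀ a b, |B a b| ≤ t) (a b : Fin N) :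
    |(A * B) a b| ≤ N * (s * t) := by
  rw [Matrix.mul_apply]
  refine (Finset.abs_sum_le_sum_abs _ _).trans ?_
  calc _ ≤ ∑ _c : Fin N, s * t := Finset.sum_le_sum fun c _ => by
        rw [abs_mul]; exact mul_le_mul (hA _ _) (hB _ _) (abs_nonneg _) hs
    _ = N * (s * t) := by simp

theorem HH_near {n : ℕ} {u : Eu n → ℝ} (hu : C2 u) {ε : ℝ} (hε : 0 < ε) :
    ∃ V : Eu n → ℝ, CD 3 (homExt V) ∧ ∀ x ∈ sph n, ∀ a b, |HH V x a b - HH u x a b| ≤ ε := by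
  obtain ⟨g, hg, hc, hgu⟩ := cutoff hu
  set N : ℝ := ((n + 1 : ℕ) : ℝ)
  have hN : 0 ≤ N := Nat.cast_nonneg _
  set C : ℝ := N * ((N * (2 * 1) + (1 + N)) * 2) with hC
  have hC0 : 0 ≤ C := by positivity
  obtain ⟨V, hV, h⟩ := smooth_near hg hc (ε := ε / (C + 1)) (by positivity)
  set η := ε / (C + 1) with hη
  have hη0 : 0 ≤ η := by positivity
  refine ⟨V, homExt_CD hV.contDiffOn, fun x hx a b => ?_⟩
  obtain ⟨h1, h2, h3⟩ := h x
  have hV2 : CD 2 V := CD.le2 hV.contDiffOn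
  rw [← HH_congr hgu hx, HH_formula hV2 hx, HH_formula hg.contDiffOn hx, ← Matrix.sub_apply, ← sub_mul]
  have e1 : (PiM x * Hs V x + (V x - ∑ a, x a * pd a V x) • (1 : Mt (n+1)) -
      (PiM x * Hs g x + (g x - ∑ a, x a * pd a g x) • 1)) =
      PiM x * (Hs V x - Hs g x) + ((V x - g x) - ∑ a, x a * (pd a V x - pd a g x)) • 1 := by
    simp only [mul_sub, Finset.sum_sub_distrib]; module
  rw [e1]
  have hxa : ∀ a, |x a| ≤ 1 := fun a => by
    rw [← mem_sph.1 hx]; exact PiLp.norm_apply_le x a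
  have e2 : |(V x - g x) - ∑ a, x a * (pd a V x - pd a g x)| ≤ (1 + N) * η := by
    have : |∑ a, x a * (pd a V x - pd a g x)| ≤ N * η := by
      refine (Finset.abs_sum_le_sum_abs _ _).trans ?_
      calc _ ≤ ∑ _c : Fin (n+1), 1 * η := Finset.sum_le_sum fun c _ => by
            rw [abs_mul]; exact mul_le_mul (hxa _) (h2 _) (abs_nonneg _) zero_le_one
        _ = N * η := by simp [N]
    calc _ ≤ |V x - g x| + |∑ a, x a * (pd a V x - pd a g x)| := abs_sub _ _
      _ ≤ _ := by linarith
  have e3 : ∀ c d, |(PiM x * (Hs V x - Hs g x) + ((V x - g x) - ∑ a, x a * (pd a V x - pd a g x)) • (1 : Mt (n+1))) c d| ≤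
      N * (2 * η) + (1 + N) * η := by
    intro c d
    rw [Matrix.add_apply, Matrix.smul_apply, smul_eq_mul]
    refine (abs_add_le _ _).trans (add_le_add ?_ ?_)
    · exact ent_mul_bd zero_le_two (PiM_bd hx) (fun a b => h3 a b) c d
    · rw [abs_mul]
      have : |(1 : Mt (n+1)) c d| ≤ 1 := by rw [Matrix.one_apply]; split_ifs <;> simp
      calc _ ≤ ((1 + N) * η) * 1 := mul_le_mul e2 this (abs_nonneg _) (by positivity)
        _ = _ := by ring
  refine (ent_mul_bd (by positivity) e3 (PiM_bd hx) a b).trans ?_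
  have : C * η ≤ ε := by
    rw [hη, mul_div_assoc', div_le_iff₀ (by positivity)]; nlinarith
  calc _ = C * η := by rw [hC]; ring
    _ ≤ ε := this

section
variable {n k : ℕ} {w : ℕ → Eu n → ℝ}

theorem CS.mul' {f g : Eu n → ℝ} (hf : CS f) (hg : CS g) : CS (fun x => f x * g x) := ContinuousOn.mul hf hg
theorem CS.add' {f g : Eu n → ℝ} (hf : CS f) (hg : CS g) : CS (fun x => f x + g x) := ContinuousOn.add hf hg
theorem CS.sub' {f g : Eu n → ℝ} (hf : CS f) (hg : CS g) : CS (fun x => f x - g x) := ContinuousOn.sub hf hg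

theorem mdisc_contOn {X : Type*} [TopologicalSpace X] {N : ℕ} {s : Set X} (A : X → Fin N → Mt N)
    (hA : ∀ i, ContinuousOn (fun x => A x i) s) : ContinuousOn (fun x => mdisc ℝ N (A x)) s :=
  (mdisc_continuous (N := N) (fun A => A) (fun i => continuous_apply i)).comp_continuousOn (continuousOn_pi.2 hA)

theorem sl_cont (hw : ∀ i, i < k → C2 (w i)) (i : Fin (n + 1)) : ContinuousOn (fun x => sl k w x i) (sph n) := by
  unfold sl; split_ifs with h
  · exact HH_cont (hw _ h)
  · exact continuousOn_const

theorem Dm_cont (hw : ∀ i, i < k → C2 (w i)) {B : Eu n → Mt (n + 1)} (hB : ContinuousOn B (sph n)) :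
    CS (fun x => Dm k w x (B x)) := by
  refine mdisc_contOn _ fun i => ?_
  by_cases hi : i = 0
  · subst hi; simpa only [Function.update_self] using hB
  · simpa only [Function.update_of_ne hi] using sl_cont hw i

theorem mt_bd (hB : ContinuousOn (B : Eu n → Mt (n + 1)) (sph n)) : ∃ C, ∀ x ∈ sph n, ∀ a b, |B x a b| ≤ C := by
  have h : ∀ p : Fin (n+1) × Fin (n+1), ∃ C, ∀ x ∈ sph n, |B x p.1 p.2| ≤ C := fun p =>
    (sph_compact n).exists_bound_of_continuousOn (continuousOn_pi.1 (continuousOn_pi.1 hB p.1) p.2)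
  choose C hC using h
  obtain ⟨M, hM⟩ := Finite.bddAbove_range C
  exact ⟨M, fun x hx a b => (hC (a, b) x hx).trans (hM ⟨(a,b), rfl⟩)⟩

theorem mdisc_bd (N : ℕ) (R : ℝ) : ∃ C, ∀ A : Fin N → Mt N, (∀ i a b, |A i a b| ≤ R) → |mdisc ℝ N A| ≤ C := by
  obtain ⟨C, hC⟩ := (isCompact_closedBall (0 : Fin N → Fin N → Fin N → ℝ) (max R 0)).exists_bound_of_continuousOn
    (f := fun A => mdC N A) (mdC N).cont.continuousOn
  have h0 := le_max_right R 0
  have key : ∀ A : Fin N → Fin N → Fin N → ℝ, (∀ i a b, |A i a b| ≤ R) → |mdC N A| ≤ C := by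
    intro A hA
    refine hC A ?_
    rw [mem_closedBall_zero_iff]
    exact (pi_norm_le_iff_of_nonneg h0).2 fun i => (pi_norm_le_iff_of_nonneg h0).2 fun a =>
    (pi_norm_le_iff_of_nonneg h0).2 fun b => (hA i a b).trans (le_max_left _ _)
  exact ⟨C, fun A hA => key A hA⟩

theorem Dm_lim (hw : ∀ i, i < k → C2 (w i)) (W : ℕ → ℕ → Eu n → ℝ) (hW2 : ∀ m i, i < k → C2 (W m i))
    (hW : ∀ m i, i < k → ∀ x ∈ sph n, ∀ a b, |HH (W m i) x a b - HH (w i) x a b| ≤ 1 / ((m : ℝ) + 1))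
    {f : Eu n → ℝ} (hf : CS f) {B : Eu n → Mt (n + 1)} (hB : ContinuousOn B (sph n)) :
    Tendsto (fun m => sphInt n (fun x => f x * Dm k (W m) x (B x))) atTop
      (𝓝 (sphInt n (fun x => f x * Dm k w x (B x)))) := by
  obtain ⟨Cf, hCf⟩ := (sph_compact n).exists_bound_of_continuousOn hf
  obtain ⟨CB, hCB⟩ := mt_bd hB
  choose CS' hCS using fun i => mt_bd (sl_cont hw i)
  obtain ⟨M, hM⟩ := Finite.bddAbove_range CS'
  obtain ⟨C, hC⟩ := mdisc_bd (n+1) (max CB (M + 1))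
  simp only [sphInt_def]
  refine tendsto_integral_of_dominated_convergence (fun _ => Cf * C) ?_ (integrable_const _) ?_ ?_
  · intro m
    exact (hf.mul (Dm_cont (hW2 m) hB)).aestronglyMeasurable (sph_meas n)
  · intro m
    refine muS_ae fun x hx => ?_
    rw [norm_mul]
    refine mul_le_mul (hCf x hx) (hC _ fun i a b => ?_) (norm_nonneg _) ((norm_nonneg _).trans (hCf x hx))
    by_cases hi : i = 0
    · subst hi; rw [Function.update_self]; exact (hCB x hx a b).trans (le_max_left _ _)
    · rw [Function.update_of_ne hi]
      refine le_trans ?_ (le_max_right _ _)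
      have h1 := (hCS i x hx a b).trans (hM ⟨i, rfl⟩)
      unfold sl at h1 ⊢
      split_ifs at h1 ⊢ with h
      · have h2 := hW m i h x hx a b
        have h3 : 1 / ((m:ℝ) + 1) ≤ 1 := by
          rw [div_le_one (by positivity)]; linarith [(Nat.cast_nonneg m : (0:ℝ) ≤ m)]
        have := abs_sub_abs_le_abs_sub (HH (W m i) x a b) (HH (w i) x a b)
        linarith
      · linarith
  · refine muS_ae fun x hx => Tendsto.const_mul _ ?_
    refine ((mdisc_continuous (N := n+1) (fun A => A) (fun i => continuous_apply i)).tendsto _).comp ?_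
    refine tendsto_pi_nhds.2 fun i => ?_
    by_cases hi : i = 0
    · subst hi; simp only [Function.update_self]; exact tendsto_const_nhds
    · simp only [Function.update_of_ne hi]
      unfold sl
      split_ifs with h
      · refine tendsto_pi_nhds.2 fun a => tendsto_pi_nhds.2 fun b => ?_
        refine tendsto_iff_norm_sub_tendsto_zero.2 ?_
        exact squeeze_zero (fun _ => norm_nonneg _) (fun m => hW m i h x hx a b) tendsto_one_div_add_atTop_nhds_zero_nat
      · exact tendsto_const_nhds

theorem sym_int (hw : ∀ i, i < k → C2 (w i)) {f g : Eu n → ℝ} (hf : C2 f) (hg : C2 g) :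
    sphInt n (fun x => f x * Dm k w x (HH g x)) = sphInt n (fun x => g x * Dm k w x (HH f x)) := by
  have h : ∀ m i : ℕ, ∃ V : Eu n → ℝ, i < k → CD 3 (homExt V) ∧ ∀ x ∈ sph n, ∀ a b,
      |HH V x a b - HH (w i) x a b| ≤ 1 / ((m : ℝ) + 1) := by
    intro m i
    by_cases hi : i < k
    · obtain ⟨V, h1, h2⟩ := HH_near (hw i hi) (ε := 1 / ((m : ℝ) + 1)) (by positivity)
      exact ⟨V, fun _ => ⟨h1, h2⟩⟩
    · exact ⟨0, fun h => absurd h hi⟩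
  choose W hW using h
  have hW2 : ∀ m i, i < k → C2 (W m i) := fun m i hi => CD.le2 (hW m i hi).1
  refine tendsto_nhds_unique (Dm_lim hw W hW2 (fun m i hi => (hW m i hi).2) hf.cs (HH_cont hg)) ?_
  refine (Dm_lim hw W hW2 (fun m i hi => (hW m i hi).2) hg.cs (HH_cont hf)).congr fun m => ?_
  have := sym_smooth (fun i hi => (hW m i hi).1) hf hg
  rw [sphInt_sub (CS.mul' hf.cs (Dm_cont (hW2 m) (HH_cont hg))) (CS.mul' hg.cs (Dm_cont (hW2 m) (HH_cont hf)))] at this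
  linarith
end

theorem mdisc_two' {N : ℕ} (hN : 2 ≤ N) : ∃ c : ℝ, 0 < c ∧ ∀ (A : Fin N → Mt N) (p q : Fin N), p ≠ q →
    (∀ i, i ≠ p → i ≠ q → A i = 1) → mdisc ℝ N A = c * ((A p).trace * (A q).trace - (A p * A q).trace) := by
  obtain ⟨c, hc, h⟩ := mdisc_two hN
  refine ⟨c, hc, fun A p q hpq hA => ?_⟩
  let i0 : Fin N := ⟨0, by omega⟩
  let i1 : Fin N := ⟨1, by omega⟩
  have h01 : i0 ≠ i1 := by simp [i0, i1, Fin.ext_iff]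
  let τ := Equiv.swap i0 p
  let σ := (Equiv.swap i1 (τ q)).trans τ
  have hτq : τ q ≠ i0 := by
    intro h1
    apply hpq
    have : τ q = τ p := by rw [h1]; simp [τ]
    exact (τ.injective this).symm
  have s0 : σ i0 = p := by
    simp only [σ, Equiv.trans_apply]
    rw [Equiv.swap_apply_of_ne_of_ne h01 hτq.symm]; simp [τ]
  have s1 : σ i1 = q := by
    simp only [σ, Equiv.trans_apply, Equiv.swap_apply_left]
    simp [τ]
  have h2 := h (A ∘ σ) (fun i hi => by
    apply hA
    · rw [← s0]; intro he
      have := congrArg Fin.val (σ.injective he); simp [i0] at this; omega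
    · rw [← s1]; intro he
      have := congrArg Fin.val (σ.injective he); simp [i1] at this; omega)
  rw [mdisc_perm] at h2
  rw [h2]
  change c * ((A (σ i0)).trace * (A (σ i1)).trace - (A (σ i0) * A (σ i1)).trace) = _
  rw [s0, s1]

section
variable {n : ℕ} {x : Eu n}

theorem dot_sph (hx : x ∈ sph n) : x.ofLp ⬝ᵥ x.ofLp = 1 := by
  have := EuclideanSpace.real_norm_sq_eq x
  rw [mem_sph.1 hx] at this
  simp only [dotProduct, ← sq]; simpa using this.symm

theorem PiM_exp (j : ℕ) (hj : j + 1 ≤ n + 1) (a : Fin (n + 1) → Mt (n + 1)) :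
    mdisc ℝ (n + 1) (tup (j + 1) (PiM x) a) = mdisc ℝ (n + 1) (tup (j + 1) 1 a) -
      (j + 1) * mdisc ℝ (n + 1) (tup j 1 (tup (j + 1) (Matrix.vecMulVec x.ofLp x.ofLp) a)) := by
  have e : PiM x = 1 + (-1 : ℝ) • Matrix.vecMulVec x.ofLp x.ofLp := by rw [PiM]; module
  rw [e, tup_binom _ _ _ _ hj, Finset.sum_range_succ', Finset.sum_range_succ']
  rw [Finset.sum_eq_zero]
  · simp only [zero_add, Nat.choose_one_right, pow_one, Nat.add_sub_cancel, Nat.choose_zero_right, pow_zero, Nat.sub_zero]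
    have e2 : tup (j+1) (1 : Mt (n+1)) (tup (j+1) (Matrix.vecMulVec x.ofLp x.ofLp) a) = tup (j+1) 1 a := by
      funext i; simp only [tup]; split_ifs <;> rfl
    rw [e2]; push_cast; ring
  · intro m hm
    have hm := Finset.mem_range.1 hm
    refine mul_eq_zero_of_right _ ?_
    refine mdisc_vecMul_zero (i := ⟨j, by omega⟩) (j := ⟨j - 1, by omega⟩) (x := x.ofLp) (y := x.ofLp) (z := x.ofLp) _ ?_ ?_ ?_
    · simp only [ne_eq, Fin.mk.injEq]; omega
    · simp only [tup]; rw [if_neg (by omega), if_pos (by omega)]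
    · simp only [tup]; rw [if_neg (by omega), if_pos (by omega)]

theorem tr_vv (hx : x ∈ sph n) : (Matrix.vecMulVec x.ofLp x.ofLp).trace = 1 := by
  rw [Matrix.trace_vecMulVec, dot_sph hx]

theorem PiM_tr (hx : x ∈ sph n) : (PiM x).trace = n := by
  rw [PiM, Matrix.trace_sub, tr_vv hx, Matrix.trace_one, Fintype.card_fin]; push_cast; ring

theorem PiM_symm : (PiM x).IsSymm := by
  rw [PiM]; ext i j; simp [Matrix.vecMulVec_apply, Matrix.one_apply, eq_comm, mul_comm]

theorem PiM_Gam (hn : 2 ≤ n) {k : ℕ} (hk : k ≤ n) (hx : x ∈ sph n) : PiM x ∈ Gam (n + 1) k := by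
  refine ⟨PiM_symm, fun j hj1 hjk => ?_⟩
  obtain ⟨j, rfl⟩ : ∃ i, j = i + 1 := ⟨j - 1, by omega⟩
  obtain ⟨c, hc, h⟩ := mdisc_two' (N := n + 1) (by omega)
  rw [PiM_exp j (by omega), tup_self, h (fun _ => 1) ⟨0, by omega⟩ ⟨1, by omega⟩ (by simp [Fin.ext_iff]) (fun _ _ _ => rfl)]
  obtain ⟨q, hq⟩ : ∃ q : Fin (n+1), (⟨j, by omega⟩ : Fin (n+1)) ≠ q := by
    by_cases h0 : j = 0
    · exact ⟨⟨1, by omega⟩, by simp [Fin.ext_iff, h0]⟩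
    · exact ⟨⟨0, by omega⟩, by simp [Fin.ext_iff, h0]⟩
  have e1 : ∀ i : Fin (n+1), i ≠ ⟨j, by omega⟩ → tup j 1 (tup (j + 1) (Matrix.vecMulVec x.ofLp x.ofLp) fun _ => 1) i = (1 : Mt (n+1)) := by
    intro i hi
    have : (i : ℕ) ≠ j := fun h => hi (Fin.ext h)
    simp only [tup]; split_ifs <;> first | rfl | omega
  have e2 : tup j 1 (tup (j + 1) (Matrix.vecMulVec x.ofLp x.ofLp) fun _ => 1) (⟨j, by omega⟩ : Fin (n+1)) = Matrix.vecMulVec x.ofLp x.ofLp := by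
    simp [tup]
  rw [h _ ⟨j, by omega⟩ q hq (fun i hi _ => e1 i hi), e2, e1 q hq.symm]
  simp only [Matrix.mul_one, tr_vv hx, Matrix.trace_one, Fintype.card_fin]
  have h1 : (j:ℝ) + 1 ≤ n := by exact_mod_cast hjk.trans hk
  have h2 : (2:ℝ) ≤ n := by exact_mod_cast hn
  push_cast
  have : c * (((n:ℝ)+1)*((n:ℝ)+1) - ((n:ℝ)+1)) - ((j:ℝ)+1)*(c*(1*((n:ℝ)+1)-1)) = c * n * (n + 1 - (j+1)) := by ring
  rw [this]
  have : (0:ℝ) < n + 1 - (j + 1) := by linarith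
  positivity

/-- trace formula for round slots -/
theorem Dm_round (hn : 2 ≤ n) {k : ℕ} (hk1 : 1 ≤ k) (hk : k ≤ n) : ∃ c : ℝ, 0 < c ∧ ∀ x ∈ sph n, ∀ B : Mt (n + 1),
    B.mulVec x.ofLp = 0 → Dm k (fun _ _ => 1) x B = c * (n - k + 1) * B.trace := by
  obtain ⟨c, hc, h⟩ := mdisc_two' (N := n + 1) (by omega)
  refine ⟨c, hc, fun x hx B hB => ?_⟩
  obtain ⟨j, rfl⟩ : ∃ i, k = i + 1 := ⟨k - 1, by omega⟩
  let J : Fin (n+1) := ⟨j, by omega⟩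
  set a : Fin (n+1) → Mt (n+1) := Function.update (fun _ => 1) J B with ha
  have e0 : Dm (j+1) (fun _ _ => 1) x B = mdisc ℝ (n+1) (tup j (PiM x) a) := by
    rw [Dm, ← mdisc_perm _ (Equiv.swap 0 J)]
    congr 1
    funext i
    simp only [Function.comp, Function.update_apply, tup, ha, sl, HH_one hx, Equiv.swap_apply_def]
    rcases eq_or_ne i J with h | h
    · subst h
      by_cases h0 : J = 0
      · simp [J, h0]
      · simp [J, h0]
    · have h1 : (i:ℕ) ≠ j := fun h' => h (Fin.ext h')
      by_cases h0 : i = 0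
      · subst h0
        have hj0 : 0 < j := by
          have : ((0 : Fin (n+1)) : ℕ) = 0 := rfl
          omega
        have hJ0 : J ≠ 0 := fun h' => by
          have := congrArg Fin.val h'; simp [J] at this; omega
        simp [J, hJ0, hj0]
      · simp only [h0, h, if_false]
        by_cases h2 : (i:ℕ) < j
        · simp [h2, show (i:ℕ) < j + 1 by omega]
        · simp [h2, show ¬ (i:ℕ) < j + 1 by omega]
  have a1 : ∀ i, i ≠ J → a i = 1 := fun i hi => Function.update_of_ne hi _ _
  have aJ : a J = B := Function.update_self _ _ _
  obtain ⟨q, hq⟩ : ∃ q : Fin (n+1), J ≠ q := by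
    by_cases h0 : j = 0
    · exact ⟨⟨1, by omega⟩, by simp [J, Fin.ext_iff, h0]⟩
    · exact ⟨⟨0, by omega⟩, by simp [J, Fin.ext_iff, h0]⟩
  have ea : mdisc ℝ (n+1) a = c * (B.trace * (n + 1) - B.trace) := by
    rw [h a J q hq (fun i hi _ => a1 i hi), aJ, a1 q hq.symm]
    simp [Matrix.trace_one]
  rw [e0]
  rcases Nat.eq_zero_or_pos j with hj | hj
  · subst hj
    rw [tup_zero, ea]; push_cast; ring
  obtain ⟨m, rfl⟩ : ∃ m, j = m + 1 := ⟨j - 1, by omega⟩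
  rw [PiM_exp m (by omega)]
  have e1 : tup (m+1) (1 : Mt (n+1)) a = a := by
    funext i; simp only [tup]; split_ifs with hi
    · rw [a1]; intro h'; rw [h'] at hi; simp [J] at hi
    · rfl
  let M : Fin (n+1) := ⟨m, by omega⟩
  have hMJ : M ≠ J := by simp [M, J, Fin.ext_iff]
  rw [e1, ea, h _ M J hMJ]
  · have e2 : tup m 1 (tup (m + 1) (Matrix.vecMulVec x.ofLp x.ofLp) a) M = Matrix.vecMulVec x.ofLp x.ofLp := by
      simp [tup, M]
    have e3 : tup m 1 (tup (m + 1) (Matrix.vecMulVec x.ofLp x.ofLp) a) J = B := by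
      rw [← aJ]; simp [tup, J]
    rw [e2, e3, tr_vv hx, Matrix.trace_mul_comm, Matrix.mul_vecMulVec, hB]
    simp; ring
  · intro i hi hi'
    have h1 : (i:ℕ) ≠ m := fun h' => hi (Fin.ext h')
    simp only [tup]
    split_ifs
    · rfl
    · omega
    · exact a1 i hi'
end

/-- L2 inner product on the sphere -/
def ip {n : ℕ} (f g : Eu n → ℝ) : ℝ := sphInt n (fun x => f x * g x)

section
variable {n : ℕ} {f g h : Eu n → ℝ}

theorem CS.neg' (hf : CS f) : CS (fun x => - f x) := ContinuousOn.neg hf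
theorem CS.pow' (hf : CS f) (m : ℕ) : CS (fun x => f x ^ m) := ContinuousOn.pow hf m
theorem CS.cmul' (c : ℝ) (hf : CS f) : CS (fun x => c * f x) := CS.mul' continuousOn_const hf
theorem CS.const (c : ℝ) : CS (n := n) (fun _ => c) := continuousOn_const
theorem CS.div' (hf : CS f) (hg : CS g) (h : ∀ x ∈ sph n, g x ≠ 0) : CS (fun x => f x / g x) :=
  ContinuousOn.div hf hg h

theorem ip_comm (f g : Eu n → ℝ) : ip f g = ip g f := by simp only [ip, mul_comm]

theorem ip_congr {f' g' : Eu n → ℝ} (h1 : ∀ x ∈ sph n, f x = f' x) (h2 : ∀ x ∈ sph n, g x = g' x) : ip f g = ip f' g' :=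
  sphInt_congr fun x hx => by rw [h1 x hx, h2 x hx]

theorem ip_add_left (hf : CS f) (hg : CS g) (hh : CS h) : ip (fun x => f x + g x) h = ip f h + ip g h := by
  simp only [ip, add_mul]; exact sphInt_add (hf.mul' hh) (hg.mul' hh)

theorem ip_sub_left (hf : CS f) (hg : CS g) (hh : CS h) : ip (fun x => f x - g x) h = ip f h - ip g h := by
  simp only [ip, sub_mul]; exact sphInt_sub (hf.mul' hh) (hg.mul' hh)

theorem ip_smul_left (c : ℝ) (f h : Eu n → ℝ) : ip (fun x => c * f x) h = c * ip f h := by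
  simp only [ip, mul_assoc]; exact sphInt_smul _ _

theorem ip_add_right (hf : CS f) (hg : CS g) (hh : CS h) : ip h (fun x => f x + g x) = ip h f + ip h g := by
  rw [ip_comm, ip_add_left hf hg hh, ip_comm f, ip_comm g]

theorem ip_sub_right (hf : CS f) (hg : CS g) (hh : CS h) : ip h (fun x => f x - g x) = ip h f - ip h g := by
  rw [ip_comm, ip_sub_left hf hg hh, ip_comm f, ip_comm g]

theorem ip_smul_right (c : ℝ) (f h : Eu n → ℝ) : ip h (fun x => c * f x) = c * ip h f := by
  rw [ip_comm, ip_smul_left, ip_comm]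

theorem ip_nonneg (f : Eu n → ℝ) : 0 ≤ ip f f := sphInt_nonneg fun x _ => mul_self_nonneg _

theorem ip_sq (f : Eu n → ℝ) : sphInt n (fun x => f x ^ 2) = ip f f := by simp only [ip, sq]

theorem ip_one (f : Eu n → ℝ) : ip f (fun _ => 1) = sphInt n f := by simp only [ip, mul_one]

theorem ip_sub_sub (hf : CS f) (hg : CS g) : ip (fun x => f x - g x) (fun x => f x - g x) = ip f f - 2 * ip f g + ip g g := by
  rw [ip_sub_left hf hg (hf.sub' hg), ip_sub_right hf hg hf, ip_sub_right hf hg hg, ip_comm g f]; ring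

theorem ip_add_add (hf : CS f) (hg : CS g) : ip (fun x => f x + g x) (fun x => f x + g x) = ip f f + 2 * ip f g + ip g g := by
  rw [ip_add_left hf hg (hf.add' hg), ip_add_right hf hg hf, ip_add_right hf hg hg, ip_comm g f]; ring

theorem ip_eq_zero (hf : CS f) (h : ip f f = 0) : ∀ x ∈ sph n, f x = 0 := fun x hx =>
  mul_self_eq_zero.1 (sphInt_eq_zero (hf.mul' hf) (fun x _ => mul_self_nonneg _) h x hx)

theorem ip_zero_left (hf : ∀ x ∈ sph n, f x = 0) : ip f g = 0 := by
  rw [ip, sphInt_congr (g := fun x => 0 * g x) (fun x hx => by rw [hf x hx]), sphInt_smul, zero_mul]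

theorem ip_cs (hf : CS f) (hg : CS g) : ip f g ^ 2 ≤ ip f f * ip g g := by
  have h1 := ip_nonneg (fun x => ip g g * f x - ip f g * g x)
  rw [ip_sub_sub (hf.cmul' _) (hg.cmul' _), ip_smul_left, ip_smul_left, ip_smul_left, ip_smul_right, ip_smul_right,
    ip_smul_right] at h1
  rcases (ip_nonneg g).eq_or_lt with h0 | h0
  · have : ip f g = 0 := by rw [ip_comm]; exact ip_zero_left (ip_eq_zero hg h0.symm)
    rw [this, ← h0]; norm_num
  · have : 0 ≤ ip g g * (ip f f * ip g g - ip f g ^ 2) := by nlinarith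
    have := nonneg_of_mul_nonneg_right this h0
    linarith

theorem ip_two (hf : CS f) (hg : CS g) : ip (fun x => f x + g x) (fun x => f x + g x) ≤ 2 * ip f f + 2 * ip g g := by
  have := ip_nonneg (fun x => f x - g x)
  rw [ip_sub_sub hf hg] at this
  rw [ip_add_add hf hg]; linarith

theorem ip_two' (hf : CS f) (hg : CS g) : ip (fun x => f x - g x) (fun x => f x - g x) ≤ 2 * ip f f + 2 * ip g g := by
  have := ip_nonneg (fun x => f x + g x)
  rw [ip_add_add hf hg] at this
  rw [ip_sub_sub hf hg]; linarith
end

/-- admissible slots -/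
structure Adm (n k : ℕ) (w : ℕ → Eu n → ℝ) : Prop where
  c2 : ∀ i, C2 (w i)
  pos : ∀ i, PosOnSphere (w i)
  gam : ∀ i, ∀ x ∈ sph n, HH (w i) x ∈ Gam (n + 1) k

/-- the operator L -/
def Lo {n : ℕ} (k : ℕ) (w : ℕ → Eu n → ℝ) (f : Eu n → ℝ) (x : Eu n) : ℝ := Dm k w x (HH f x)
/-- rho -/
def rho {n : ℕ} (k : ℕ) (w : ℕ → Eu n → ℝ) (x : Eu n) : ℝ := Lo k w (w 1) x / w 1 x
/-- the operator D -/
def Do {n : ℕ} (k : ℕ) (w : ℕ → Eu n → ℝ) (f : Eu n → ℝ) (x : Eu n) : ℝ := rho k w x * f x - Lo k w f x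
/-- the operator T -/
def To {n : ℕ} (k : ℕ) (w : ℕ → Eu n → ℝ) (f : Eu n → ℝ) (x : Eu n) : ℝ := Do k w f x + sphInt n f

section
variable {n k : ℕ} (hk2 : 2 ≤ k) (hkn : k ≤ n) {w : ℕ → Eu n → ℝ} (hw : Adm n k w) {f g v : Eu n → ℝ}

theorem Adm.sl (hw : Adm n k w) {x : Eu n} (hx : x ∈ sph n) : Sl (n + 1) k (sl k w x) where
  h1 := fun i _ h => by unfold _root_.sl; rw [if_pos h]; exact hw.gam _ x hx
  h2 := fun i h => by unfold _root_.sl; rw [if_neg (by omega)]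

theorem Dm_bq (hk2 : 2 ≤ k) (hkn : k ≤ n) (w : ℕ → Eu n → ℝ) (x : Eu n) (B : Mt (n + 1)) :
    Dm k w x B = bq (sl k w x) B (HH (w 1) x) := by
  rw [bq, bq_upd (by omega), Dm]
  congr 2
  funext i
  simp only [Function.update_apply]
  split_ifs with h
  · subst h; simp only [sl]; rw [if_pos (show 1 < k by omega)]
  · rfl

theorem Dm_bq' (hk2 : 2 ≤ k) (hkn : k ≤ n) (w : ℕ → Eu n → ℝ) (f : Eu n → ℝ) (x : Eu n) (B : Mt (n + 1)) :
    Dm k (Function.update w 1 f) x B = bq (sl k w x) B (HH f x) := by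
  rw [bq, bq_upd (by omega), Dm]
  congr 2
  funext i
  simp only [Function.update_apply, sl]
  by_cases h : i = ⟨1, by omega⟩
  · subst h; simp; omega
  · have : (i : ℕ) ≠ 1 := fun h' => h (Fin.ext h')
    simp [h, this]

theorem Lo_cont (hw : Adm n k w) (hf : C2 f) : CS (Lo k w f) := Dm_cont (fun i _ => hw.c2 i) (HH_cont hf)

theorem Lo_add (hf : C2 f) (hg : C2 g) {x : Eu n} (hx : x ∈ sph n) :
    Lo k w (fun x => f x + g x) x = Lo k w f x + Lo k w g x := by rw [Lo, HH_add hf hg hx, Dm_add]; rfl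

theorem Lo_cmul (c : ℝ) (hf : C2 f) {x : Eu n} (hx : x ∈ sph n) :
    Lo k w (fun x => c * f x) x = c * Lo k w f x := by rw [Lo, HH_cmul c hf hx, Dm_smul]; rfl

theorem Lo_symm (hw : Adm n k w) (hf : C2 f) (hg : C2 g) : ip f (Lo k w g) = ip g (Lo k w f) :=
  sym_int (fun i _ => hw.c2 i) hf hg

theorem Lo_w_pos (hk2 : 2 ≤ k) (hkn : k ≤ n) (hw : Adm n k w) (hf : ∀ x ∈ sph n, HH f x ∈ Gam (n + 1) k) {x : Eu n} (hx : x ∈ sph n) :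
    0 < Lo k w f x := by
  rw [Lo, Dm_bq hk2 hkn]
  exact bq_pos hk2 (by omega) (hw.sl hx) (hf x hx) (hw.gam 1 x hx)

theorem rho_pos (hk2 : 2 ≤ k) (hkn : k ≤ n) (hw : Adm n k w) {x : Eu n} (hx : x ∈ sph n) : 0 < rho k w x :=
  div_pos (Lo_w_pos hk2 hkn hw (hw.gam 1) hx) (hw.pos 1 x hx)

theorem rho_cont (hw : Adm n k w) : CS (rho k w) :=
  (Lo_cont hw (hw.c2 1)).div' (hw.c2 1).cs fun x hx => (hw.pos 1 x hx).ne'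

theorem rho_w (hw : Adm n k w) {x : Eu n} (hx : x ∈ sph n) : rho k w x * w 1 x = Lo k w (w 1) x :=
  div_mul_cancel₀ _ (hw.pos 1 x hx).ne'

theorem Do_cont (hw : Adm n k w) (hf : C2 f) : CS (Do k w f) := ((rho_cont hw).mul' hf.cs).sub' (Lo_cont hw hf)

theorem To_cont (hw : Adm n k w) (hf : C2 f) : CS (To k w f) := (Do_cont hw hf).add' (CS.const _)

theorem Do_add (hf : C2 f) (hg : C2 g) {x : Eu n} (hx : x ∈ sph n) :
    Do k w (fun x => f x + g x) x = Do k w f x + Do k w g x := by simp only [Do, Lo_add hf hg hx]; ring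

theorem Do_cmul (c : ℝ) (hf : C2 f) {x : Eu n} (hx : x ∈ sph n) :
    Do k w (fun x => c * f x) x = c * Do k w f x := by simp only [Do, Lo_cmul c hf hx]; ring

theorem To_add (hf : C2 f) (hg : C2 g) {x : Eu n} (hx : x ∈ sph n) :
    To k w (fun x => f x + g x) x = To k w f x + To k w g x := by
  simp only [To, Do_add hf hg hx, sphInt_add hf.cs hg.cs]; ring

theorem To_cmul (c : ℝ) (hf : C2 f) {x : Eu n} (hx : x ∈ sph n) :
    To k w (fun x => c * f x) x = c * To k w f x := by
  simp only [To, Do_cmul c hf hx, sphInt_smul]; ring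

theorem Do_w (hw : Adm n k w) {x : Eu n} (hx : x ∈ sph n) : Do k w (w 1) x = 0 := by
  rw [Do, rho_w hw hx, sub_self]

theorem ip_Do (hw : Adm n k w) (hf : C2 f) (hg : C2 g) :
    ip f (Do k w g) = ip f (fun x => rho k w x * g x) - ip f (Lo k w g) :=
  ip_sub_right ((rho_cont hw).mul' hg.cs) (Lo_cont hw hg) hf.cs

theorem ip_rho (f g : Eu n → ℝ) : ip f (fun x => rho k w x * g x) = ip g (fun x => rho k w x * f x) := by
  simp only [ip]; congr 1; funext x; ring

theorem Do_symm (hw : Adm n k w) (hf : C2 f) (hg : C2 g) : ip f (Do k w g) = ip g (Do k w f) := by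
  rw [ip_Do hw hf hg, ip_Do hw hg hf, Lo_symm hw hf hg, ip_rho]

theorem gr_cont {F : Eu n → ℝ} (hF : CD 2 F) : ContinuousOn (fun x => Matrix.vecMulVec (gr F x) (gr F x)) (sph n) := by
  refine continuousOn_pi.2 fun a => continuousOn_pi.2 fun b => ?_
  exact ((CD.pd1 hF a).continuousOn.mono (sph_sub n)).mul ((CD.pd1 hF b).continuousOn.mono (sph_sub n))

theorem E_eq (hw : Adm n k w) (hf : C2 f) : ip f (Do k w f) =
    sphInt n (fun x => w 1 x ^ 2 * Dm k w x (Matrix.vecMulVec (gr (quo f (w 1)) x) (gr (quo f (w 1)) x))) := by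
  have hc := Dm_cont (k := k) (fun i _ => hw.c2 i) (gr_cont (quo_CD hf (hw.c2 1) (hw.pos 1)))
  have h1 := Lo_symm hw (hw.c2 1) (C2_sqdiv hf (hw.c2 1) (hw.pos 1))
  have e1 : ip (fun x => f x ^ 2 / w 1 x) (Lo k w (w 1)) = ip f (fun x => rho k w x * f x) := by
    refine sphInt_congr fun x hx => ?_
    simp only [rho]; ring
  have e2 : ip (w 1) (Lo k w (fun x => f x ^ 2 / w 1 x)) = 2 * ip f (Lo k w f) - ip f (fun x => rho k w x * f x) +
      2 * sphInt n (fun x => w 1 x ^ 2 * Dm k w x (Matrix.vecMulVec (gr (quo f (w 1)) x) (gr (quo f (w 1)) x))) := by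
    have c1 := hf.cs.mul' (Lo_cont hw hf)
    have c2 := hf.cs.mul' ((rho_cont hw).mul' hf.cs)
    rw [ip, ip, ip, ← sphInt_smul, ← sphInt_smul, ← sphInt_sub (c1.cmul' 2) c2,
      ← sphInt_add ((c1.cmul' 2).sub' c2) ((((hw.c2 1).cs.pow' 2).mul' hc).cmul' 2)]
    refine sphInt_congr fun x hx => ?_
    have h0 := (hw.pos 1 x hx).ne'
    rw [Lo, HH_sqdiv hf (hw.c2 1) (hw.pos 1) hx, sub_eq_add_neg, ← neg_smul, Dm_add, Dm_add, Dm_smul, Dm_smul, Dm_smul, rho, Lo, Lo]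
    field_simp
    ring
  rw [ip_Do hw hf hf]
  rw [e1, e2] at h1
  linarith

theorem Dm_vv_nonneg (hk2 : 2 ≤ k) (hkn : k ≤ n) (hw : Adm n k w) {x : Eu n} (hx : x ∈ sph n) (y : Fin (n + 1) → ℝ) :
    0 ≤ Dm k w x (Matrix.vecMulVec y y) := by
  by_cases hy : y = 0
  · subst hy
    have := Dm_smul k w x 0 0
    simp at this
    simp [Matrix.vecMulVec_zero, this]
  · rw [Dm_bq hk2 hkn]
    exact (bq_ell hk2 (by omega) (hw.sl hx) (hw.gam 1 x hx) y hy).le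

theorem E_nonneg (hk2 : 2 ≤ k) (hkn : k ≤ n) (hw : Adm n k w) (hf : C2 f) : 0 ≤ ip f (Do k w f) := by
  rw [E_eq hw hf]
  exact sphInt_nonneg fun x hx => mul_nonneg (sq_nonneg _) (Dm_vv_nonneg hk2 hkn hw hx _)

/-- second order form -/
def Bo {n : ℕ} (k : ℕ) (w : ℕ → Eu n → ℝ) (f : Eu n → ℝ) (x : Eu n) : ℝ := bq (sl k w x) (HH f x) (HH f x)

theorem upd_c2 (hw : Adm n k w) (hf : C2 f) (i : ℕ) : C2 (Function.update w 1 f i) := by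
  by_cases h : i = 1
  · subst h; simpa using hf
  · rw [Function.update_of_ne h]; exact hw.c2 i

theorem Bo_cont (hk2 : 2 ≤ k) (hkn : k ≤ n) (hw : Adm n k w) (hf : C2 f) : CS (Bo k w f) := by
  have := Dm_cont (k := k) (fun i _ => upd_c2 hw hf i) (HH_cont hf)
  simp only [Dm_bq' hk2 hkn] at this
  exact this

theorem Bo_int (hk2 : 2 ≤ k) (hkn : k ≤ n) (hw : Adm n k w) (hf : C2 f) : ip (w 1) (Bo k w f) = ip f (Lo k w f) := by
  have := sym_int (k := k) (fun i _ => upd_c2 hw hf i) (hw.c2 1) hf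
  simp only [Dm_bq' hk2 hkn] at this
  refine this.trans (sphInt_congr fun x hx => ?_)
  rw [Lo, Dm_bq hk2 hkn, bq_symm (by omega)]

theorem bochner (hk2 : 2 ≤ k) (hkn : k ≤ n) (hw : Adm n k w) (hf : C2 f) :
    ip f (Do k w f) ≤ sphInt n (fun x => Do k w f x ^ 2 / rho k w x) := by
  have hr := fun x hx => (rho_pos hk2 hkn hw (x := x) hx).ne'
  have c1 := (hf.cs.mul' ((rho_cont hw).mul' hf.cs))
  have c2 := (hf.cs.mul' (Do_cont hw hf)).cmul' 2
  have c3 := ((Do_cont hw hf).pow' 2).div' (rho_cont hw) hr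
  have h1 : ip (w 1) (Bo k w f) ≤ ip f (fun x => rho k w x * f x) - 2 * ip f (Do k w f) +
      sphInt n (fun x => Do k w f x ^ 2 / rho k w x) := by
    rw [ip, ip, ip, ← sphInt_smul, ← sphInt_sub c1 c2, ← sphInt_add (c1.sub' c2) c3]
    refine sphInt_mono ((hw.c2 1).cs.mul' (Bo_cont hk2 hkn hw hf)) ((c1.sub' c2).add' c3) fun x hx => ?_
    have h2 := bq_cs hk2 (by omega) (hw.sl hx) (hw.gam 1 x hx) (HH_symm hf hx)
    have h3 := rho_pos hk2 hkn hw hx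
    have h4 := hw.pos 1 x hx
    rw [← Dm_bq hk2 hkn, ← Dm_bq hk2 hkn] at h2
    change Bo k w f x * Lo k w (w 1) x ≤ Lo k w f x ^ 2 at h2
    rw [← rho_w hw hx] at h2
    have h5 : Lo k w f x = rho k w x * f x - Do k w f x := by rw [Do]; ring
    rw [h5] at h2
    have h6 : f x * (rho k w x * f x) - 2 * (f x * Do k w f x) + Do k w f x ^ 2 / rho k w x =
      (rho k w x * f x - Do k w f x) ^ 2 / rho k w x := by field_simp; ring
    rw [h6, le_div_iff₀ h3]
    linarith
  rw [Bo_int hk2 hkn hw hf] at h1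
  have := ip_Do hw hf hf
  linarith

theorem lemmaM (hk2 : 2 ≤ k) (hkn : k ≤ n) (hw : Adm n k w) (hv : C2 v) (hf : C2 f) :
    ip v (Lo k w v) ≤ sphInt n (fun x => (Do k w f x - rho k w x * v x) ^ 2 / rho k w x) := by
  have hr := fun x hx => (rho_pos hk2 hkn hw (x := x) hx).ne'
  have c1 := (hv.cs.mul' ((rho_cont hw).mul' hv.cs))
  have c2 := (hv.cs.mul' (Do_cont hw hf)).cmul' 2
  have c3 := ((Do_cont hw hf).pow' 2).div' (rho_cont hw) hr
  have h1 := bochner hk2 hkn hw hf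
  have h2 : sphInt n (fun x => (Do k w f x - rho k w x * v x) ^ 2 / rho k w x) =
      ip v (fun x => rho k w x * v x) - 2 * ip v (Do k w f) + sphInt n (fun x => Do k w f x ^ 2 / rho k w x) := by
    rw [ip, ip, ← sphInt_smul, ← sphInt_sub c1 c2, ← sphInt_add (c1.sub' c2) c3]
    refine sphInt_congr fun x hx => ?_
    have := hr x hx
    field_simp
    ring
  have h3 := E_nonneg hk2 hkn hw (hv.add (hf.cmul (-1)))
  have h4 : ip (fun x => v x + -1 * f x) (Do k w (fun x => v x + -1 * f x)) =
      ip v (Do k w v) - 2 * ip v (Do k w f) + ip f (Do k w f) := by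
    have e : ∀ x ∈ sph n, Do k w (fun x => v x + -1 * f x) x = Do k w v x + -1 * Do k w f x := fun x hx => by
      rw [Do_add hv (hf.cmul _) hx, Do_cmul _ hf hx]
    rw [ip_congr (fun _ _ => rfl) e, ip_add_left hv.cs (hf.cs.cmul' _) ((Do_cont hw hv).add' ((Do_cont hw hf).cmul' _)),
      ip_add_right (Do_cont hw hv) ((Do_cont hw hf).cmul' _) hv.cs,
      ip_add_right (Do_cont hw hv) ((Do_cont hw hf).cmul' _) (hf.cs.cmul' _), ip_smul_left, ip_smul_left, ip_smul_right, ip_smul_right,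
      Do_symm hw hf hv]
    ring
  have h5 := ip_Do hw hv hv
  linarith

/-- dense range -/
def Dens {n : ℕ} (A : (Eu n → ℝ) → Eu n → ℝ) : Prop :=
  ∀ g, CS g → ∀ η > 0, ∃ h, C2 h ∧ ip (fun x => A h x - g x) (fun x => A h x - g x) < η

theorem dens_neg (hk2 : 2 ≤ k) (hkn : k ≤ n) (hw : Adm n k w) (hd : Dens (To k w)) (hv : C2 v)
    (h0 : ip v (Lo k w (w 1)) = 0) : ip v (Lo k w v) ≤ 0 := by
  obtain ⟨x0, hx0, hmin⟩ := (sph_compact n).exists_isMinOn ⟨_, sph_nonempty n⟩ (rho_cont hw)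
  have hr0 := rho_pos hk2 hkn hw hx0
  set r := rho k w x0
  have hmin : ∀ x ∈ sph n, r ≤ rho k w x := fun x hx => hmin hx
  set S := sphInt n (fun _ => 1)
  have hS : 0 ≤ S := sphInt_nonneg fun _ _ => zero_le_one
  set I := sphInt n (w 1)
  have hI : 0 < I := sphInt_pos (hw.c2 1).cs (fun x hx => (hw.pos 1 x hx).le) (sph_nonempty n) (hw.pos 1 _ (sph_nonempty n))
  have hww := ip_nonneg (w 1)
  set C := (2 + 2 * S * (ip (w 1) (w 1) / I ^ 2)) / r
  have hC : 0 < C := by positivity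
  refine le_of_forall_pos_le_add fun ε hε => ?_
  obtain ⟨h, hh, hη⟩ := hd (fun x => rho k w x * v x) ((rho_cont hw).mul' hv.cs) (ε / C) (by positivity)
  have cd : CS (fun x => To k w h x - rho k w x * v x) := (To_cont hw hh).sub' ((rho_cont hw).mul' hv.cs)
  set d := fun x => To k w h x - rho k w x * v x with hd'
  set m := sphInt n h
  have e1 : ip (w 1) d = m * I := by
    rw [hd', ip_sub_right (To_cont hw hh) ((rho_cont hw).mul' hv.cs) (hw.c2 1).cs]
    have : ip (w 1) (To k w h) = ip (w 1) (Do k w h) + ip (w 1) (fun x => m * 1) := by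
      rw [← ip_add_right (Do_cont hw hh) (CS.const _) (hw.c2 1).cs]
      simp only [To, mul_one]; rfl
    rw [this, Do_symm hw (hw.c2 1) hh, ip_smul_right, ip_one, ip_comm h, ip_zero_left (fun x hx => Do_w hw hx)]
    have : ip (w 1) (fun x => rho k w x * v x) = 0 := by
      rw [ip_rho, ip_congr (fun _ _ => rfl) (fun x hx => rho_w hw hx), h0]
    rw [this]; ring
  have e2 := ip_cs (hw.c2 1).cs cd
  rw [e1, mul_pow] at e2
  have e3 : m ^ 2 ≤ ip (w 1) (w 1) / I ^ 2 * ip d d := by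
    rw [div_mul_eq_mul_div, le_div_iff₀ (by positivity)]; exact e2
  have e4 := lemmaM hk2 hkn hw hv hh
  have c5 : CS (fun x => Do k w h x - rho k w x * v x) := (Do_cont hw hh).sub' ((rho_cont hw).mul' hv.cs)
  have e5 : sphInt n (fun x => (Do k w h x - rho k w x * v x) ^ 2 / rho k w x) ≤
      r⁻¹ * ip (fun x => d x - m * 1) (fun x => d x - m * 1) := by
    rw [ip, ← sphInt_smul]
    refine sphInt_mono ((c5.pow' 2).div' (rho_cont hw) fun x hx => (rho_pos hk2 hkn hw hx).ne')
      (((cd.sub' (CS.const _)).mul' (cd.sub' (CS.const _))).cmul' _) fun x hx => ?_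
    have : d x - m * 1 = Do k w h x - rho k w x * v x := by simp only [hd', To]; ring
    rw [this, inv_mul_eq_div, sq]
    exact div_le_div_of_nonneg_left (mul_self_nonneg _) hr0 (hmin x hx)
  have e6 := ip_two' cd ((CS.const (n := n) 1).cmul' m)
  rw [ip_smul_left, ip_smul_right, ip_one] at e6
  have e7 : r⁻¹ * ip (fun x => d x - m * 1) (fun x => d x - m * 1) ≤ C * ip d d := by
    rw [show C * ip d d = r⁻¹ * (2 * ip d d + 2 * S * (ip (w 1) (w 1) / I ^ 2 * ip d d)) by simp only [C]; field_simp]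
    refine mul_le_mul_of_nonneg_left (e6.trans ?_) (inv_nonneg.2 hr0.le)
    have := mul_le_mul_of_nonneg_left e3 hS
    nlinarith
  have e8 : C * ip d d ≤ ε := by
    have := (lt_div_iff₀ hC).1 hη
    linarith
  linarith
end

/-- linear function on the sphere -/
def pw {n : ℕ} (w : Eu n) : C(sph n, ℝ) := ⟨fun x => ⟪w, (x : Eu n)⟫, by fun_prop⟩

instance sph_cpt (n : ℕ) : CompactSpace (sph n) := isCompact_iff_compactSpace.1 (sph_compact n)

theorem pw_exp {n : ℕ} (w : Eu n) (x : sph n) : (NormedSpace.exp (pw w)) x = Real.exp ⟪w, (x : Eu n)⟫ := by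
  letI : NormedAlgebra ℚ C(sph n, ℝ) := NormedAlgebra.restrictScalars ℚ ℝ _
  have := NormedSpace.map_exp (ContinuousMap.evalAlgHom ℝ ℝ x : C(sph n, ℝ) →ₐ[ℝ] ℝ)
    (by change Continuous fun f : C(sph n, ℝ) => f x; fun_prop) (pw w)
  rw [Real.exp_eq_exp_ℝ]
  exact this

theorem dense_sub {n : ℕ} (P : Submodule ℝ C(sph n, ℝ)) (hP : ∀ w l, pw w ^ l ∈ P) :
    P.topologicalClosure = ⊤ := by
  have h1 : ∀ w : Eu n, NormedSpace.exp (pw w) ∈ P.topologicalClosure := by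
    intro w
    have := NormedSpace.exp_series_hasSum_exp' (𝕂 := ℝ) (pw w)
    refine P.isClosed_topologicalClosure.mem_of_tendsto this (Eventually.of_forall fun s => ?_)
    exact Submodule.sum_mem _ fun i _ => Submodule.smul_mem _ _ (P.le_topologicalClosure (hP w i))
  let M : Submonoid C(sph n, ℝ) :=
    { carrier := Set.range fun w => NormedSpace.exp (pw w)
      one_mem' := ⟨0, by ext x; simp [pw_exp]⟩
      mul_mem' := by
        rintro _ _ ⟨w, rfl⟩ ⟨w', rfl⟩
        exact ⟨w + w', by ext x; simp [pw_exp, inner_add_left, Real.exp_add]⟩ }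
  let A := Algebra.adjoin ℝ (M : Set C(sph n, ℝ))
  have h2 : Subalgebra.toSubmodule A ≤ P.topologicalClosure := by
    rw [Algebra.adjoin_eq_span, Submonoid.closure_eq, Submodule.span_le]
    rintro _ ⟨w, rfl⟩
    exact h1 w
  have h3 : A.SeparatesPoints := by
    intro x y hxy
    refine ⟨_, ⟨NormedSpace.exp (pw ((x : Eu n) - y)), Algebra.subset_adjoin ⟨_, rfl⟩, rfl⟩, ?_⟩
    simp only [pw_exp]
    intro h
    have h := Real.exp_injective h
    apply hxy
    have : ⟪(x : Eu n) - y, (x : Eu n) - y⟫ = 0 := by rw [inner_sub_right, h, sub_self]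
    exact Subtype.ext (sub_eq_zero.1 (inner_self_eq_zero.1 this))
  have h4 := ContinuousMap.subalgebra_topologicalClosure_eq_top_of_separatesPoints A h3
  rw [eq_top_iff]
  intro f _
  have hf : f ∈ A.topologicalClosure := by rw [h4]; trivial
  have : f ∈ closure (A : Set C(sph n, ℝ)) := hf
  exact closure_minimal h2 P.isClosed_topologicalClosure this

/-- linear operators on the sphere -/
structure LinO {n : ℕ} (A : (Eu n → ℝ) → Eu n → ℝ) : Prop where
  add : ∀ {f g : Eu n → ℝ}, C2 f → C2 g → ∀ {x}, x ∈ sph n → A (fun x => f x + g x) x = A f x + A g x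
  cmul : ∀ {f : Eu n → ℝ} (c : ℝ), C2 f → ∀ {x}, x ∈ sph n → A (fun x => c * f x) x = c * A f x
  cs : ∀ {f : Eu n → ℝ}, C2 f → CS (A f)

theorem To_lin {n k : ℕ} {w : ℕ → Eu n → ℝ} (hw : Adm n k w) : LinO (To k w) :=
  ⟨fun hf hg _ hx => To_add hf hg hx, fun c hf _ hx => To_cmul c hf hx, fun hf => To_cont hw hf⟩

theorem dens_of_pow {n : ℕ} {A : (Eu n → ℝ) → Eu n → ℝ} (hA : LinO A)
    (h : ∀ (w : Eu n) (l : ℕ), ∃ f, C2 f ∧ ∀ x ∈ sph n, A f x = ⟪w, x⟫ ^ l) : Dens A := by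
  let P : Submodule ℝ C(sph n, ℝ) :=
    { carrier := {g | ∃ f, C2 f ∧ ∀ x : sph n, A f x = g x}
      zero_mem' := ⟨fun x => 0 * 0, C2.cmul 0 (C2_const 0), fun x => by
        rw [hA.cmul 0 (C2_const 0) x.2, zero_mul]; rfl⟩
      add_mem' := by
        rintro _ _ ⟨f, hf, h1⟩ ⟨g, hg, h2⟩
        exact ⟨_, hf.add hg, fun x => by rw [hA.add hf hg x.2, h1, h2]; rfl⟩
      smul_mem' := by
        rintro c _ ⟨f, hf, h1⟩
        exact ⟨_, hf.cmul c, fun x => by rw [hA.cmul c hf x.2, h1]; rfl⟩ }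
  have hP := dense_sub P fun w l => by
    obtain ⟨f, hf, h1⟩ := h w l
    exact ⟨f, hf, fun x => by rw [h1 x x.2]; rfl⟩
  intro g hg η hη
  set S := sphInt n (fun _ => 1)
  have hS : 0 ≤ S := sphInt_nonneg fun _ _ => zero_le_one
  let G : C(sph n, ℝ) := ⟨fun x => g x, continuousOn_iff_continuous_restrict.1 hg⟩
  have hG : G ∈ closure (P : Set C(sph n, ℝ)) := by
    change G ∈ P.topologicalClosure
    rw [hP]; trivial
  set δ := Real.sqrt (η / (2 * (S + 1)))
  have hδ : 0 < δ := Real.sqrt_pos.2 (by positivity)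
  have hδ2 : δ ^ 2 = η / (2 * (S + 1)) := Real.sq_sqrt (by positivity)
  obtain ⟨F, ⟨f, hf, h1⟩, h2⟩ := Metric.mem_closure_iff.1 hG δ hδ
  refine ⟨f, hf, ?_⟩
  have h3 : ∀ x ∈ sph n, (A f x - g x) * (A f x - g x) ≤ δ ^ 2 * 1 := by
    intro x hx
    have h4 := (ContinuousMap.dist_apply_le_dist (f := G) (g := F) ⟨x, hx⟩).trans h2.le
    rw [← h1 ⟨x, hx⟩, Real.dist_eq] at h4
    change |g x - A f x| ≤ δ at h4
    rw [abs_sub_comm] at h4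
    rw [← sq, mul_one]
    exact sq_le_sq' (by linarith [(abs_le.1 h4).1]) (abs_le.1 h4).2
  have hc := (hA.cs hf).sub' hg
  have h5 := sphInt_mono (hc.mul' hc) ((CS.const (n := n) 1).cmul' (δ^2)) h3
  rw [sphInt_smul, hδ2] at h5
  refine lt_of_le_of_lt h5 ?_
  rw [div_mul_eq_mul_div, div_lt_iff₀ (by positivity)]
  change η * S < _
  nlinarith

theorem dens_id (n : ℕ) : Dens (n := n) (fun f => f) :=
  dens_of_pow ⟨fun _ _ _ _ => rfl, fun _ _ _ _ => rfl, fun h => h.cs⟩ fun w l => ⟨_, C2_pow w l, fun _ _ => rfl⟩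

section
variable {n k : ℕ}

theorem adm_one (hn : 2 ≤ n) (hk : k ≤ n) : Adm n k (fun _ _ => 1) :=
  ⟨fun _ => C2_const 1, fun _ _ _ => one_pos, fun _ x hx => by rw [HH_one hx]; exact PiM_Gam hn hk hx⟩

theorem Lo_round (hn : 2 ≤ n) (hk1 : 1 ≤ k) (hk : k ≤ n) : ∃ c : ℝ, 0 < c ∧ ∀ f, C2 f → ∀ x ∈ sph n,
    Lo k (fun _ _ => 1) f x = c * (HH f x).trace := by
  obtain ⟨c, hc, h⟩ := Dm_round hn hk1 hk
  refine ⟨c * (n - k + 1), mul_pos hc ?_, fun f hf x hx => h x hx _ (HH_rad hf hx)⟩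
  have : (k:ℝ) ≤ n := by exact_mod_cast hk
  linarith

theorem dens_round (hn : 2 ≤ n) (hk1 : 1 ≤ k) (hk : k ≤ n) : Dens (To (n := n) k (fun _ _ => 1)) := by
  obtain ⟨c, hc, hL⟩ := Lo_round hn hk1 hk
  have hlin := To_lin (adm_one hn hk)
  have hn' : (2:ℝ) ≤ n := by exact_mod_cast hn
  have hT : ∀ f, C2 f → ∀ x ∈ sph n, To k (fun _ _ => 1) f x = c * (n * f x - (HH f x).trace) + sphInt n f := by
    intro f hf x hx
    rw [To, Do, rho, hL f hf x hx, hL _ (C2_const 1) x hx, HH_one hx, PiM_tr hx]; ring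
  set S := sphInt n (fun _ => 1)
  have hS : 0 < S := sphInt_pos (CS.const 1) (fun _ _ => zero_le_one) (sph_nonempty n) one_pos
  have h1 : ∀ x ∈ sph n, To k (fun _ _ => 1) (fun _ => 1) x = S := by
    intro x hx
    rw [hT _ (C2_const 1) x hx, HH_one hx, PiM_tr hx]; ring
  refine dens_of_pow hlin fun w l => ?_
  induction l using Nat.strong_induction_on with
  | _ l ih =>
  rcases Nat.eq_zero_or_pos l with hl | hl
  · subst hl
    refine ⟨fun x => S⁻¹ * 1, (C2_const 1).cmul _, fun x hx => ?_⟩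
    rw [hlin.cmul _ (C2_const 1) hx, h1 x hx, inv_mul_cancel₀ hS.ne', pow_zero]
  · have hl' : (1:ℝ) ≤ l := by exact_mod_cast hl
    have hl1 : ((l - 1 : ℕ) : ℝ) = l - 1 := by push_cast [Nat.cast_sub hl]; ring
    set p := fun x : Eu n => ⟪w, x⟫ ^ l with hp
    have hpC : C2 p := C2_pow w l
    obtain ⟨f, hf, h2⟩ := ih (l - 2) (by omega)
    set K := c * (l * (l - 1) + n * l)
    have hK : 0 < K := by
      apply mul_pos hc
      nlinarith
    have h3 : ∀ x ∈ sph n, To k (fun _ _ => 1) p x = K * ⟪w, x⟫ ^ l - c * (l * (l - 1) * ‖w‖ ^ 2) * ⟪w, x⟫ ^ (l - 2) + sphInt n p := by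
      intro x hx
      rw [hT p hpC x hx, hp, tr_pow w l hx, hl1]
      simp only [K]; ring
    refine ⟨fun x => K⁻¹ * (p x + ((c * (l * (l - 1) * ‖w‖ ^ 2)) * f x + (-(sphInt n p) * S⁻¹) * 1)), ?_, fun x hx => ?_⟩
    · exact (hpC.add ((hf.cmul _).add ((C2_const 1).cmul _))).cmul _
    · rw [hlin.cmul _ (hpC.add ((hf.cmul _).add ((C2_const 1).cmul _))) hx, hlin.add hpC ((hf.cmul _).add ((C2_const 1).cmul _)) hx,
        hlin.add (hf.cmul _) ((C2_const 1).cmul _) hx, hlin.cmul _ hf hx, hlin.cmul _ (C2_const 1) hx, h1 x hx, h2 x hx, h3 x hx]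
      field_simp
      ring

theorem poincare (hk2 : 2 ≤ k) (hk : k ≤ n) : ∃ c : ℝ, 0 < c ∧ ∀ f, C2 f → sphInt n f = 0 →
    c * ip f f ≤ ip f (Do k (fun _ _ => 1) f) := by
  have hn : 2 ≤ n := hk2.trans hk
  obtain ⟨c, hc, hL⟩ := Lo_round hn (by omega) hk
  have hadm := adm_one hn hk
  have hn' : (0:ℝ) < n := by exact_mod_cast (by omega : 0 < n)
  refine ⟨c * n, by positivity, fun f hf h0 => ?_⟩
  have h1 := dens_neg hk2 hk hadm (dens_round hn (by omega) hk) hf (by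
    rw [ip_congr (g' := fun x => (c * n) * 1) (fun _ _ => rfl) (fun x hx => by
      rw [hL _ (C2_const 1) x hx, HH_one hx, PiM_tr hx, mul_one]), ip_smul_right, ip_one, h0, mul_zero])
  have h2 : ip f (fun x => rho k (fun _ _ => 1) x * f x) = ip f (fun x => (c * n) * f x) :=
    ip_congr (fun _ _ => rfl) (fun x hx => by
      rw [rho, hL _ (C2_const 1) x hx, HH_one hx, PiM_tr hx, div_one])
  rw [ip_Do hadm hf hf, h2, ip_smul_right]
  linarith
end

section
variable {n k : ℕ} {w : ℕ → Eu n → ℝ} {f : Eu n → ℝ}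

theorem Dm_vv (w : ℕ → Eu n → ℝ) (x : Eu n) (c : ℝ) (y : Fin (n + 1) → ℝ) :
    Dm k w x (Matrix.vecMulVec (c • y) (c • y)) = c ^ 2 * Dm k w x (Matrix.vecMulVec y y) := by
  rw [← Dm_smul]; congr 1
  ext i j; simp [Matrix.vecMulVec_apply]; ring

theorem Dm_vv_cont (hw : Adm n k w) :
    ContinuousOn (fun p : Eu n × Eu n => Dm k w p.1 (Matrix.vecMulVec p.2.ofLp p.2.ofLp)) (sph n ×ˢ sph n) := by
  have : (fun p : Eu n × Eu n => Dm k w p.1 (Matrix.vecMulVec p.2.ofLp p.2.ofLp)) =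
    fun p => ∑ a, ∑ b, p.2 a * p.2 b * Dm k w p.1 (Em a b) := by
    funext p; rw [Dm_expand]; rfl
  rw [this]
  refine continuousOn_finset_sum _ fun a _ => continuousOn_finset_sum _ fun b _ => ?_
  refine ContinuousOn.mul (by fun_prop) ?_
  exact ContinuousOn.comp (g := fun x => Dm k w x (Em a b)) (t := sph n) (Dm_cont (fun i _ => hw.c2 i) continuousOn_const)
    continuousOn_fst fun p hp => hp.1

theorem ell_cmp (hk2 : 2 ≤ k) (hkn : k ≤ n) (hw : Adm n k w) : ∃ C : ℝ, 0 < C ∧ ∀ x ∈ sph n, ∀ y : Fin (n + 1) → ℝ,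
    Dm k (fun _ _ => 1) x (Matrix.vecMulVec y y) ≤ C * Dm k w x (Matrix.vecMulVec y y) := by
  have h1 := adm_one (hk2.trans hkn) hkn
  have hpos : ∀ x ∈ sph n, ∀ y : Fin (n+1) → ℝ, y ≠ 0 → 0 < Dm k w x (Matrix.vecMulVec y y) := fun x hx y hy => by
    rw [Dm_bq hk2 hkn]
    exact bq_ell hk2 (by omega) (hw.sl hx) (hw.gam 1 x hx) y hy
  have hne : ∀ y ∈ sph n, y.ofLp ≠ 0 := fun y hy h => sph_ne hy (by ext i; simpa using congrFun h i)
  obtain ⟨C, hC⟩ := ((sph_compact n).prod (sph_compact n)).exists_bound_of_continuousOn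
    ((Dm_vv_cont h1).div (Dm_vv_cont hw) fun p hp => (hpos p.1 hp.1 _ (hne _ hp.2)).ne')
  refine ⟨|C| + 1, by positivity, fun x hx y => ?_⟩
  by_cases hy : y = 0
  · subst hy
    have e := Dm_smul k w x 0 0
    have e' := Dm_smul k (fun _ _ => 1) x 0 0
    simp at e e'
    simp [Matrix.vecMulVec_zero, e, e']
  · set Y : Eu n := WithLp.toLp 2 y
    have hY : Y ≠ 0 := fun h => hy (by
      funext i; simpa [Y] using congrArg (fun z : Eu n => z i) h)
    have hY0 : 0 < ‖Y‖ := norm_pos_iff.2 hY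
    set Z : Eu n := ‖Y‖⁻¹ • Y
    have hZ : Z ∈ sph n := by rw [mem_sph, norm_smul, norm_inv, norm_norm, inv_mul_cancel₀ hY0.ne']
    have hyZ : y = ‖Y‖ • Z.ofLp := by
      funext i; simp [Z, Y, mul_inv_cancel_left₀ hY0.ne']
    have h2 := (le_abs_self _).trans (hC (x, Z) ⟨hx, hZ⟩)
    have h3 := hpos x hx _ (hne Z hZ)
    change Dm k (fun _ _ => 1) x (Matrix.vecMulVec Z.ofLp Z.ofLp) / Dm k w x (Matrix.vecMulVec Z.ofLp Z.ofLp) ≤ C at h2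
    rw [div_le_iff₀ h3] at h2
    rw [hyZ, Dm_vv, Dm_vv]
    have h4 : C ≤ |C| + 1 := by linarith [le_abs_self C]
    have h5 : 0 ≤ ‖Y‖ ^ 2 := by positivity
    have h6 := mul_le_mul_of_nonneg_right h4 h3.le
    have h7 := mul_le_mul_of_nonneg_left (h2.trans h6) h5
    linarith

theorem homExt_div {u : Eu n → ℝ} (hp : PosOnSphere u) : ∀ y ∈ Oc n, homExt (fun x => f x / u x) y = ‖y‖ * quo f u y := by
  intro y hy
  have h0 : ‖y‖ ≠ 0 := (norm_pos_iff.2 hy).ne'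
  rw [quo, homExt, homExt, homExt, mul_div_mul_left _ _ h0]

theorem C2_div {u : Eu n → ℝ} (hf : C2 f) (hu : C2 u) (hp : PosOnSphere u) : C2 (fun x => f x / u x) :=
  ContDiffOn.congr (ContDiffOn.mul CD_norm (quo_CD hf hu hp)) (homExt_div hp)

theorem gr_shift {u : Eu n → ℝ} (hf : C2 f) (hu : C2 u) (hp : PosOnSphere u) (m : ℝ) {x : Eu n} (hx : x ∈ sph n) :
    gr (quo (fun x => f x / u x - m) (fun _ => 1)) x = gr (quo f u) x := by
  have h : ∀ y ∈ Oc n, quo (fun x => f x / u x - m) (fun _ => 1) y = quo f u y - m := by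
    intro y hy
    have h0 : ‖y‖ ≠ 0 := (norm_pos_iff.2 hy).ne'
    simp only [quo, homExt, mul_one]
    field_simp
  funext i
  simp only [gr]
  rw [pd_congr h i x (sph_ne hx), pd_sub (CD.le1 (quo_CD hf hu hp)) contDiffOn_const i (sph_ne hx), pd_const, sub_zero]

theorem CS.bd {g : Eu n → ℝ} (hg : CS g) : ∃ C : ℝ, 0 < C ∧ ∀ x ∈ sph n, |g x| ≤ C := by
  obtain ⟨C, hC⟩ := (sph_compact n).exists_bound_of_continuousOn hg
  exact ⟨|C| + 1, by positivity, fun x hx => (hC x hx).trans (by linarith [le_abs_self C])⟩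

theorem CS.lb {g : Eu n → ℝ} (hg : CS g) (h : ∀ x ∈ sph n, 0 < g x) : ∃ c : ℝ, 0 < c ∧ ∀ x ∈ sph n, c ≤ g x := by
  obtain ⟨x0, hx0, hmin⟩ := (sph_compact n).exists_isMinOn ⟨_, sph_nonempty n⟩ hg
  exact ⟨g x0, h x0 hx0, fun x hx => hmin hx⟩

theorem ip_mul_le {g h : Eu n → ℝ} (hg : CS g) (hh : CS h) {M : ℝ} (hM : ∀ x ∈ sph n, |g x| ≤ M) :
    ip (fun x => g x * h x) (fun x => g x * h x) ≤ M ^ 2 * ip h h := by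
  rw [ip, ip, ← sphInt_smul]
  refine sphInt_mono ((hg.mul' hh).mul' (hg.mul' hh)) ((hh.mul' hh).cmul' _) fun x hx => ?_
  have : g x ^ 2 ≤ M ^ 2 := sq_le_sq' (by linarith [(abs_le.1 (hM x hx)).1]) (abs_le.1 (hM x hx)).2
  nlinarith [mul_self_nonneg (h x)]

theorem gap (hk2 : 2 ≤ k) (hkn : k ≤ n) (hw : Adm n k w) : ∃ c : ℝ, 0 < c ∧ ∀ f, C2 f →
    c * ip f f ≤ ip f (To k w f) := by
  have hadm := adm_one (hk2.trans hkn) hkn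
  obtain ⟨c1, hc1, hP⟩ := poincare hk2 hkn
  obtain ⟨C2', hC2, hE⟩ := ell_cmp hk2 hkn hw
  obtain ⟨M, hM, hMb⟩ := (hw.c2 1).cs.bd
  obtain ⟨m0, hm0, hm0b⟩ := (hw.c2 1).cs.lb (hw.pos 1)
  have h1c := (hw.c2 1).cs
  set S := sphInt n (fun _ => 1)
  have hS : 0 < S := sphInt_pos (CS.const 1) (fun _ _ => zero_le_one) (sph_nonempty n) one_pos
  set I := sphInt n (w 1)
  have hI : 0 < I := sphInt_pos h1c (fun x hx => (hw.pos 1 x hx).le) (sph_nonempty n) (hw.pos 1 _ (sph_nonempty n))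
  set W := ip (w 1) (w 1)
  have hW : 0 ≤ W := ip_nonneg _
  set c3 := m0 ^ 2 / C2' * c1
  have hc3 : 0 < c3 := by positivity
  set A := 2 * M ^ 2 + 4 * W * W / I ^ 2
  have hA : 0 < A := by positivity
  set B := 4 * W / I ^ 2 + 1
  have hB : 0 < B := by positivity
  refine ⟨(A / c3 + B)⁻¹, by positivity, fun f hf => ?_⟩
  set m := sphInt n (fun x => f x / w 1 x) / S
  set g := fun x => f x / w 1 x - m with hg
  have hG := C2_div hf (hw.c2 1) (hw.pos 1)
  have hgC : C2 g := (hG.add ((C2_const 1).cmul (-m))).congr fun x _ => by simp [g]; ring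
  have hg0 : sphInt n g = 0 := by
    have := sphInt_sub hG.cs ((CS.const (n := n) 1).cmul' m)
    rw [sphInt_smul] at this
    simp only [mul_one] at this
    rw [hg, this]
    simp only [m]; field_simp; ring
  have e1 := hP g hgC hg0
  have e2 : m0 ^ 2 / C2' * ip g (Do k (fun _ _ => 1) g) ≤ ip f (Do k w f) := by
    rw [E_eq hadm hgC, E_eq hw hf, ← sphInt_smul]
    have d1 := Dm_cont (k := k) (fun i _ => hw.c2 i) (gr_cont (quo_CD hf (hw.c2 1) (hw.pos 1)))
    have d2 := Dm_cont (k := k) (fun i _ => hadm.c2 i) (gr_cont (quo_CD hgC (hadm.c2 1) (hadm.pos 1)))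
    refine sphInt_mono ((((CS.const 1).pow' 2).mul' d2).cmul' _) ((h1c.pow' 2).mul' d1) fun x hx => ?_
    rw [gr_shift hf (hw.c2 1) (hw.pos 1) m hx]
    set y := gr (quo f (w 1)) x
    have a1 := hE x hx y
    have a2 := Dm_vv_nonneg hk2 hkn hw hx y
    have a3 : m0 ^ 2 ≤ w 1 x ^ 2 := pow_le_pow_left₀ hm0.le (hm0b x hx) 2
    calc m0 ^ 2 / C2' * (1 ^ 2 * Dm k (fun _ _ => 1) x (Matrix.vecMulVec y y)) ≤
        m0 ^ 2 / C2' * (1 ^ 2 * (C2' * Dm k w x (Matrix.vecMulVec y y))) := by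
          gcongr
      _ = m0 ^ 2 * Dm k w x (Matrix.vecMulVec y y) := by field_simp
      _ ≤ _ := mul_le_mul_of_nonneg_right a3 a2
  have e3 : c3 * ip g g ≤ ip f (Do k w f) := by
    refine le_trans ?_ e2
    rw [mul_assoc]
    exact mul_le_mul_of_nonneg_left e1 (by positivity)
  have hgc := hgC.cs
  have e4 : ip f f ≤ 2 * (M ^ 2 * ip g g) + 2 * (m ^ 2 * W) := by
    have hh : ∀ x ∈ sph n, f x = w 1 x * g x + m * w 1 x := fun x hx => by
      have := (hw.pos 1 x hx).ne'
      simp only [g]; field_simp; ring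
    rw [ip_congr hh hh]
    refine (ip_two (h1c.mul' hgc) (h1c.cmul' m)).trans ?_
    rw [ip_smul_left, ip_smul_right]
    have := ip_mul_le h1c hgc hMb
    have e : m * (m * ip (w 1) (w 1)) = m ^ 2 * W := by ring
    rw [e]; linarith
  have e5 : m * I = sphInt n f - ip (w 1) g := by
    have : ip (w 1) g = sphInt n f - m * I := by
      rw [ip, ← sphInt_smul, ← sphInt_sub hf.cs (h1c.cmul' m)]
      refine sphInt_congr fun x hx => ?_
      have := (hw.pos 1 x hx).ne'
      simp only [g]; field_simp
    linarith
  have e6 := ip_cs h1c hgc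
  have e7 : m ^ 2 ≤ (2 * sphInt n f ^ 2 + 2 * (W * ip g g)) / I ^ 2 := by
    rw [le_div_iff₀ (by positivity), ← mul_pow, e5]
    nlinarith [sq_nonneg (sphInt n f + ip (w 1) g)]
  have e8 : ip f f ≤ A * ip g g + B * sphInt n f ^ 2 := by
    have := mul_le_mul_of_nonneg_right e7 hW
    have e : (2 * sphInt n f ^ 2 + 2 * (W * ip g g)) / I ^ 2 * W = 2 * W / I ^ 2 * sphInt n f ^ 2 + 2 * W * W / I ^ 2 * ip g g := by
      field_simp
    have e' : A * ip g g + B * sphInt n f ^ 2 = 2 * (M ^ 2 * ip g g) + 2 * (2 * W / I ^ 2 * sphInt n f ^ 2 + 2 * W * W / I ^ 2 * ip g g) + sphInt n f ^ 2 := by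
      simp only [A, B]; ring
    rw [e']
    have := sq_nonneg (sphInt n f)
    linarith
  have e9 : ip f (To k w f) = ip f (Do k w f) + sphInt n f ^ 2 := by
    have : ip f (To k w f) = ip f (Do k w f) + ip f (fun x => sphInt n f * 1) := by
      rw [← ip_add_right (Do_cont hw hf) (CS.const _) hf.cs]
      simp only [To, mul_one]; rfl
    rw [this, ip_smul_right, ip_one]; ring
  rw [inv_mul_le_iff₀ (by positivity), e9]
  have h0 := E_nonneg hk2 hkn hw hf
  have h1 : ip g g ≤ ip f (Do k w f) / c3 := by rw [le_div_iff₀ hc3]; linarith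
  have h2 := mul_le_mul_of_nonneg_left h1 hA.le
  have h3 : (A / c3 + B) * (ip f (Do k w f) + sphInt n f ^ 2) = A * (ip f (Do k w f) / c3) + B * sphInt n f ^ 2 + (A / c3 * sphInt n f ^ 2 + B * ip f (Do k w f)) := by
    ring
  have h4 : 0 ≤ A / c3 * sphInt n f ^ 2 + B * ip f (Do k w f) := by positivity
  linarith

end

theorem cpt_lemma {X : Type*} [TopologicalSpace X] {K : Set X} (hK : IsCompact K) {g h : X → ℝ}
    (hg : ContinuousOn g K) (hh : ContinuousOn h K) (g0 : ∀ x ∈ K, 0 ≤ g x) (hp : ∀ x ∈ K, g x = 0 → 0 < h x) :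
    ∃ C c : ℝ, 0 ≤ C ∧ 0 < c ∧ ∀ x ∈ K, c ≤ C * g x + h x := by
  have key : ∃ C : ℝ, 0 ≤ C ∧ ∀ x ∈ K, 0 < C * g x + h x := by
    by_cases hK0 : ∃ x ∈ K, h x ≤ 0
    · have hc : IsCompact (K ∩ h ⁻¹' Set.Iic 0) := by
        obtain ⟨t, ht, he⟩ := (continuousOn_iff_isClosed.1 hh) (Set.Iic 0) isClosed_Iic
        rw [Set.inter_comm, he, Set.inter_comm]
        exact hK.inter_right ht
      obtain ⟨x1, hx1, hx2⟩ := hK0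
      obtain ⟨x0, hx0, hmin⟩ := hc.exists_isMinOn ⟨x1, hx1, hx2⟩ (hg.mono Set.inter_subset_left)
      obtain ⟨M, hM⟩ := hK.exists_bound_of_continuousOn hh
      have hM0 : 0 ≤ M := (norm_nonneg _).trans (hM x1 hx1)
      have hgp : 0 < g x0 := lt_of_le_of_ne (g0 _ hx0.1) fun he => by
        have := hp x0 hx0.1 he.symm
        exact absurd hx0.2 (not_le.2 this)
      refine ⟨(M + 1) / g x0, by positivity, fun x hx => ?_⟩
      by_cases h1 : h x ≤ 0
      · have h2 : g x0 ≤ g x := hmin ⟨hx, h1⟩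
        have h3 := (abs_le.1 (hM x hx)).1
        have h4 : M + 1 ≤ (M + 1) / g x0 * g x := by
          rw [div_mul_eq_mul_div, le_div_iff₀ hgp]; nlinarith
        linarith
      · push Not at h1
        have := g0 x hx
        positivity
    · push Not at hK0
      exact ⟨0, le_rfl, fun x hx => by rw [zero_mul, zero_add]; exact hK0 x hx⟩
  obtain ⟨C, hC, h1⟩ := key
  rcases K.eq_empty_or_nonempty with he | hne
  · exact ⟨0, 1, le_rfl, one_pos, fun x hx => by rw [he] at hx; exact hx.elim⟩
  · obtain ⟨x0, hx0, hmin⟩ := hK.exists_isMinOn hne ((hg.const_smul C).add hh)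
    exact ⟨C, C * g x0 + h x0, hC, h1 x0 hx0, fun x hx => hmin hx⟩

/-- squared Frobenius norm -/
def nrm {N : ℕ} (B : Mt N) : ℝ := ∑ a, ∑ b, B a b ^ 2

theorem nrm_nonneg {N : ℕ} (B : Mt N) : 0 ≤ nrm B :=
  Finset.sum_nonneg fun _ _ => Finset.sum_nonneg fun _ _ => sq_nonneg _

theorem nrm_smul {N : ℕ} (c : ℝ) (B : Mt N) : nrm (c • B) = c ^ 2 * nrm B := by
  simp only [nrm, Matrix.smul_apply, smul_eq_mul, mul_pow, Finset.mul_sum]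

theorem nrm_le {N : ℕ} (B : Mt N) (a b : Fin N) : B a b ^ 2 ≤ nrm B :=
  (Finset.single_le_sum (f := fun b => B a b ^ 2) (fun _ _ => sq_nonneg _) (Finset.mem_univ b)).trans
    (Finset.single_le_sum (f := fun a => ∑ b, B a b ^ 2) (fun _ _ => Finset.sum_nonneg fun _ _ => sq_nonneg _) (Finset.mem_univ a))

theorem nrm_pos {N : ℕ} {B : Mt N} (h : B ≠ 0) : 0 < nrm B := by
  by_contra h0
  apply h
  ext a b
  have := nrm_le B a b
  have h1 : B a b ^ 2 = 0 := le_antisymm (by linarith) (sq_nonneg _)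
  simpa using h1

theorem nrm_cont {N : ℕ} : Continuous (nrm (N := N)) := by
  unfold nrm
  exact continuous_finset_sum _ fun a _ => continuous_finset_sum _ fun b _ => by fun_prop

theorem K_cpt (N : ℕ) : IsCompact {B : Mt N | B.IsSymm ∧ nrm B = 1} := by
  have h : IsCompact (Set.pi Set.univ fun _ : Fin N => Set.pi Set.univ fun _ : Fin N => Set.Icc (-1:ℝ) 1) :=
    isCompact_univ_pi fun _ => isCompact_univ_pi fun _ => isCompact_Icc
  refine IsCompact.of_isClosed_subset h ?_ ?_
  · refine IsClosed.inter ?_ ?_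
    · exact isClosed_eq (f := fun B : Mt N => B.transpose) (g := fun B => B) (by fun_prop) continuous_id
    · exact isClosed_eq nrm_cont continuous_const
  · rintro B ⟨_, h2⟩ a _ b _
    have := nrm_le B a b
    rw [h2] at this
    exact abs_le.1 (abs_le_one_iff_mul_self_le_one.2 (by nlinarith))

theorem bq_contOn {X : Type*} [TopologicalSpace X] {s : Set X} {N : ℕ} {a : X → Fin N → Mt N} {B C : X → Mt N}
    (ha : ∀ i, ContinuousOn (fun x => a x i) s) (hB : ContinuousOn B s) (hC : ContinuousOn C s) :
    ContinuousOn (fun x => bq (a x) (B x) (C x)) s := by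
  refine mdisc_contOn _ fun i => ?_
  simp only [tup]
  split_ifs
  · exact hB
  · exact hC
  · exact ha i

section
variable {n k : ℕ} {w : ℕ → Eu n → ℝ} {f : Eu n → ℝ}

theorem F4 (hk2 : 2 ≤ k) (hkn : k ≤ n) (hw : Adm n k w) : ∃ C c : ℝ, 0 ≤ C ∧ 0 < c ∧ ∀ x ∈ sph n, ∀ B : Mt (n + 1), B.IsSymm →
    c * nrm B ≤ C * bq (sl k w x) B (HH (w 1) x) ^ 2 - bq (sl k w x) B B := by
  have hfst : ∀ {F : Eu n → Mt (n+1)}, ContinuousOn F (sph n) → ContinuousOn (fun p : Eu n × Mt (n + 1) => F p.1)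
      (sph n ×ˢ {B : Mt (n + 1) | B.IsSymm ∧ nrm B = 1}) := fun h => h.comp continuousOn_fst fun p hp => hp.1
  have hs : ∀ i, ContinuousOn (fun p : Eu n × Mt (n + 1) => sl k w p.1 i) (sph n ×ˢ {B : Mt (n + 1) | B.IsSymm ∧ nrm B = 1}) :=
    fun i => hfst (sl_cont (fun i _ => hw.c2 i) i)
  obtain ⟨C, c, hC, hc, h⟩ := cpt_lemma ((sph_compact n).prod (K_cpt (n + 1)))
    (g := fun p => bq (sl k w p.1) p.2 (HH (w 1) p.1) ^ 2) (h := fun p => - bq (sl k w p.1) p.2 p.2)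
    ((bq_contOn hs continuousOn_snd (hfst (HH_cont (hw.c2 1)))).pow 2) (bq_contOn hs continuousOn_snd continuousOn_snd).neg
    (fun _ _ => sq_nonneg _) (fun p hp h0 => by
      by_contra h1
      have := bq_strict hk2 (by omega) (hw.sl hp.1) (hw.gam 1 _ hp.1) hp.2.1 (by simpa using h0) (by linarith)
      have h2 := hp.2.2
      rw [this] at h2
      simp [nrm] at h2)
  refine ⟨C, c, hC, hc, fun x hx B hB => ?_⟩
  by_cases hB0 : B = 0
  · subst hB0
    have e : ∀ A, bq (sl k w x) 0 A = 0 := fun A => by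
      have := bq_smul_left (by omega) (sl k w x) 0 0 A
      simpa using this
    rw [e, e]; simp [nrm]
  · set t := Real.sqrt (nrm B)
    have ht : 0 < t := Real.sqrt_pos.2 (nrm_pos hB0)
    have ht2 : t ^ 2 = nrm B := Real.sq_sqrt (nrm_nonneg B)
    have h1 := h (x, t⁻¹ • B) ⟨hx, hB.smul _, by rw [nrm_smul, inv_pow, ht2, inv_mul_cancel₀ (nrm_pos hB0).ne']⟩
    simp only [bq_smul_left (show 2 ≤ n + 1 by omega), bq_smul_right (show 2 ≤ n + 1 by omega)] at h1
    have h2 := mul_le_mul_of_nonneg_right h1 (sq_nonneg t)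
    have h3 : (C * (t⁻¹ * bq (sl k w x) B (HH (w 1) x)) ^ 2 + -(t⁻¹ * (t⁻¹ * bq (sl k w x) B B))) * t ^ 2 =
      C * bq (sl k w x) B (HH (w 1) x) ^ 2 - bq (sl k w x) B B := by field_simp; ring
    rw [h3, ht2] at h2
    exact h2

theorem nrm_cs (hf : C2 f) : CS (fun x => nrm (HH f x)) := nrm_cont.comp_continuousOn (HH_cont hf)

theorem apriori (hk2 : 2 ≤ k) (hkn : k ≤ n) (hw : Adm n k w) : ∃ C : ℝ, 0 < C ∧ ∀ f, C2 f →
    ip f f + sphInt n (fun x => nrm (HH f x)) ≤ C * ip (To k w f) (To k w f) := by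
  obtain ⟨c, hc, hgap⟩ := gap hk2 hkn hw
  obtain ⟨C, c', hC, hc', hF⟩ := F4 hk2 hkn hw
  obtain ⟨M, hM, hMb⟩ := (hw.c2 1).cs.bd
  obtain ⟨m, hm, hmb⟩ := (hw.c2 1).cs.lb (hw.pos 1)
  obtain ⟨R, hR, hRb⟩ := (rho_cont hw).bd
  have h1c := (hw.c2 1).cs
  set S := sphInt n (fun _ => 1)
  have hS : 0 < S := sphInt_pos (CS.const 1) (fun _ _ => zero_le_one) (sph_nonempty n) one_pos
  set a := (c ^ 2)⁻¹
  have ha : 0 < a := by positivity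
  set b := 2 * R ^ 2 * a + 4 + 4 * S * S * a
  set d := (C * M * b + (a + 1)) / (c' * m)
  have hd : 0 < d := by positivity
  refine ⟨a + d, by positivity, fun f hf => ?_⟩
  have hT := To_cont hw hf
  set X := ip (To k w f) (To k w f)
  have hX : 0 ≤ X := ip_nonneg _
  have hff := ip_nonneg f
  have e1 : ip f f ≤ a * X := by
    have h1 := hgap f hf
    have h2 := ip_cs hf.cs hT
    have h3 : (c * ip f f) ^ 2 ≤ ip f f * X := (pow_le_pow_left₀ (by positivity) h1 2).trans h2
    rcases hff.eq_or_lt with h0 | h0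
    · rw [← h0]; positivity
    · have h4 : c ^ 2 * ip f f ≤ X := by
        have : ip f f * (c ^ 2 * ip f f) ≤ ip f f * X := by nlinarith
        exact le_of_mul_le_mul_left this h0
      rw [inv_mul_eq_div, le_div_iff₀ (by positivity)]; linarith
  have hsum : ip f (To k w f) = ip f (Do k w f) + sphInt n f ^ 2 := by
    have : ip f (To k w f) = ip f (Do k w f) + ip f (fun x => sphInt n f * 1) := by
      rw [← ip_add_right (Do_cont hw hf) (CS.const _) hf.cs]
      simp only [To, mul_one]; rfl
    rw [this, ip_smul_right, ip_one]; ring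
  have e2 : ip f (Do k w f) ≤ (a + 1) * X := by
    have h1 := ip_nonneg (fun x => f x - To k w f x)
    rw [ip_sub_sub hf.cs hT] at h1
    have := sq_nonneg (sphInt n f)
    nlinarith
  have e3 : sphInt n f ^ 2 ≤ S * ip f f := by
    have := ip_cs hf.cs (CS.const (n := n) 1)
    rw [ip_one, ip_one] at this
    linarith
  have e4 : ip (Do k w f) (Do k w f) ≤ 2 * X + 2 * S * (S * ip f f) := by
    have h1 : ∀ x ∈ sph n, Do k w f x = To k w f x - sphInt n f * 1 := fun x _ => by rw [To]; ring
    rw [ip_congr h1 h1]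
    refine (ip_two' hT ((CS.const 1).cmul' _)).trans ?_
    rw [ip_smul_left, ip_smul_right, ip_one]
    have := mul_le_mul_of_nonneg_left e3 hS.le
    nlinarith
  have e5 : ip (Lo k w f) (Lo k w f) ≤ b * X := by
    have h1 : ∀ x ∈ sph n, Lo k w f x = rho k w x * f x - Do k w f x := fun x _ => by rw [Do]; ring
    rw [ip_congr h1 h1]
    refine (ip_two' ((rho_cont hw).mul' hf.cs) (Do_cont hw hf)).trans ?_
    have h2 := ip_mul_le (rho_cont hw) hf.cs hRb
    have h3 := mul_le_mul_of_nonneg_left e1 (show 0 ≤ 2 * R ^ 2 by positivity)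
    have h4 := mul_le_mul_of_nonneg_left e1 (show 0 ≤ 4 * S * S by positivity)
    have h5 : b * X = 2 * R ^ 2 * (a * X) + 4 * X + 4 * S * S * (a * X) := by simp only [b]; ring
    rw [h5]; nlinarith
  have e6 : c' * m * sphInt n (fun x => nrm (HH f x)) ≤ C * M * ip (Lo k w f) (Lo k w f) - ip (w 1) (Bo k w f) := by
    have l1 := Lo_cont hw hf
    have l2 := Bo_cont hk2 hkn hw hf
    rw [ip, ip, ← sphInt_smul, ← sphInt_smul, ← sphInt_sub ((l1.mul' l1).cmul' _) (h1c.mul' l2)]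
    refine sphInt_mono ((nrm_cs hf).cmul' _) (((l1.mul' l1).cmul' _).sub' (h1c.mul' l2)) fun x hx => ?_
    have h1 := hF x hx _ (HH_symm hf hx)
    rw [← Dm_bq hk2 hkn] at h1
    change c' * nrm (HH f x) ≤ C * Lo k w f x ^ 2 - Bo k w f x at h1
    have h2 := hmb x hx
    have h3 := (abs_le.1 (hMb x hx)).2
    have h4 := mul_le_mul_of_nonneg_left h1 (hw.pos 1 x hx).le
    have h5 := mul_le_mul_of_nonneg_right h2 (mul_nonneg hc'.le (nrm_nonneg (HH f x)))
    have h6 := mul_le_mul_of_nonneg_right h3 (mul_nonneg hC (sq_nonneg (Lo k w f x)))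
    nlinarith
  have e7 : -(ip (w 1) (Bo k w f)) ≤ ip f (Do k w f) := by
    rw [Bo_int hk2 hkn hw hf, ip_Do hw hf hf]
    have : 0 ≤ ip f (fun x => rho k w x * f x) := sphInt_nonneg fun x hx => by
      have := rho_pos hk2 hkn hw hx
      have h1 := mul_nonneg this.le (mul_self_nonneg (f x))
      linarith
    linarith
  have e8 : sphInt n (fun x => nrm (HH f x)) ≤ d * X := by
    rw [div_mul_eq_mul_div, le_div_iff₀ (by positivity)]
    have := mul_le_mul_of_nonneg_left e5 (show 0 ≤ C * M by positivity)
    nlinarith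
  nlinarith
end

section
variable {n : ℕ} {A B : (Eu n → ℝ) → Eu n → ℝ}

theorem dens_pert (hA : LinO A) (hB : LinO B)
    (h : ∀ f, C2 f → ip (fun x => A f x - B f x) (fun x => A f x - B f x) ≤ 1 / 16 * ip (A f) (A f))
    (hd : Dens A) : Dens B := by
  intro g hg η hη
  have key : ∀ m : ℕ, ∃ f, C2 f ∧ ip (fun x => B f x - g x) (fun x => B f x - g x) ≤ (1 / 2) ^ m * ip g g := by
    intro m
    induction m with
    | zero =>
      refine ⟨fun x => 0 * 0, (C2_const 0).cmul 0, ?_⟩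
      have : ∀ x ∈ sph n, B (fun x => 0 * 0) x - g x = -1 * g x := fun x hx => by
        rw [hB.cmul 0 (C2_const 0) hx]; ring
      rw [ip_congr this this, ip_smul_left, ip_smul_right]
      simp
    | succ m ih =>
      obtain ⟨f, hf, h1⟩ := ih
      have hr : CS (fun x => g x - B f x) := hg.sub' (hB.cs hf)
      set r := fun x => g x - B f x with hrd
      have h1' : ip (fun x => B f x - g x) (fun x => B f x - g x) = ip r r := by
        have : ∀ x ∈ sph n, B f x - g x = -1 * r x := fun x _ => by simp only [hrd]; ring
        rw [ip_congr this this, ip_smul_left, ip_smul_right]; ring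
      rw [h1'] at h1
      rcases (ip_nonneg r).eq_or_lt with h0 | h0
      · refine ⟨f, hf, ?_⟩
        rw [h1', ← h0]
        have := ip_nonneg g
        positivity
      · obtain ⟨f1, hf1, h2⟩ := hd r hr (ip r r / 16) (by positivity)
        refine ⟨_, hf.add hf1, ?_⟩
        have e : ∀ x ∈ sph n, B (fun x => f x + f1 x) x - g x = (A f1 x - r x) - (A f1 x - B f1 x) := fun x hx => by
          rw [hB.add hf hf1 hx]; simp only [hrd]; ring
        rw [ip_congr e e]
        have c1 := (hA.cs hf1).sub' hr
        have e1 := ip_two' c1 ((hA.cs hf1).sub' (hB.cs hf1))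
        have e2 := h f1 hf1
        have e3 : ip (A f1) (A f1) ≤ 2 * (ip r r / 16) + 2 * ip r r := by
          have e : ∀ x ∈ sph n, A f1 x = (A f1 x - r x) + r x := fun x hx => by ring
          rw [ip_congr e e]
          have := ip_two c1 hr
          linarith
        rw [pow_succ]
        linarith
  have hl : Tendsto (fun m : ℕ => (1 / 2 : ℝ) ^ m * ip g g) atTop (𝓝 (0 * ip g g)) :=
    (tendsto_pow_atTop_nhds_zero_of_lt_one (by norm_num) (by norm_num)).mul_const _
  rw [zero_mul] at hl
  obtain ⟨m, hm⟩ := (hl.eventually (gt_mem_nhds hη)).exists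
  obtain ⟨f, hf, h1⟩ := key m
  exact ⟨f, hf, h1.trans_lt hm⟩

theorem dens_iff (hA : LinO A) (hB : LinO B)
    (h : ∀ f, C2 f → ip (fun x => A f x - B f x) (fun x => A f x - B f x) ≤ 1 / 64 * ip (A f) (A f)) :
    Dens A ↔ Dens B := by
  refine ⟨dens_pert hA hB fun f hf => (h f hf).trans ?_, dens_pert hB hA fun f hf => ?_⟩
  · have := ip_nonneg (A f); linarith
  · have h1 := h f hf
    have e : ∀ x ∈ sph n, A f x = B f x + (A f x - B f x) := fun x _ => by ring
    have h2 : ip (A f) (A f) = _ := ip_congr e e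
    have h3 := ip_two (hB.cs hf) ((hA.cs hf).sub' (hB.cs hf))
    have e' : ∀ x ∈ sph n, B f x - A f x = -1 * (A f x - B f x) := fun x _ => by ring
    rw [ip_congr e' e', ip_smul_left, ip_smul_right]
    have := ip_nonneg (B f)
    linarith
end

/-- path of slots -/
def wt {n : ℕ} (w : ℕ → Eu n → ℝ) (t : ℝ) (i : ℕ) (x : Eu n) : ℝ := (1 - t) * 1 + t * w i x

section
variable {n k : ℕ} {w : ℕ → Eu n → ℝ} {f : Eu n → ℝ}

theorem wt_C2 (hw : Adm n k w) (t : ℝ) (i : ℕ) : C2 (wt w t i) := ((C2_const 1).cmul (1 - t)).add ((hw.c2 i).cmul t)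

theorem wt_HH (hw : Adm n k w) (t : ℝ) (i : ℕ) {x : Eu n} (hx : x ∈ sph n) :
    HH (wt w t i) x = (1 - t) • PiM x + t • HH (w i) x := by
  have := HH_add ((C2_const 1).cmul (1 - t)) ((hw.c2 i).cmul t) hx
  rw [HH_cmul _ (C2_const 1) hx, HH_cmul _ (hw.c2 i) hx, HH_one hx] at this
  exact this

theorem wt_adm (hn : 2 ≤ n) (hkn : k ≤ n) (hw : Adm n k w) {t : ℝ} (ht : t ∈ Set.Icc (0:ℝ) 1) : Adm n k (wt w t) where
  c2 := wt_C2 hw t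
  pos := fun i x hx => by
    have h := hw.pos i x hx
    simp only [wt]
    rcases ht.1.eq_or_lt with h0 | h0
    · rw [← h0]; norm_num
    · have := ht.2
      have := mul_pos h0 h
      linarith
  gam := fun i x hx => by
    rw [wt_HH hw t i hx]
    exact Gam.add_smul (by omega) (PiM_Gam hn hkn hx) (hw.gam i x hx) (by linarith [ht.2]) ht.1 (by linarith)

theorem wt_sl_cont (hw : Adm n k w) (i : Fin (n + 1)) :
    ContinuousOn (fun p : ℝ × Eu n => sl k (wt w p.1) p.2 i) (Set.Icc (0:ℝ) 1 ×ˢ sph n) := by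
  unfold sl
  split_ifs with h
  · have h1 : ContinuousOn (fun p : ℝ × Eu n => HH (w i) p.2) (Set.Icc (0:ℝ) 1 ×ˢ sph n) :=
      (HH_cont (hw.c2 i)).comp continuousOn_snd fun p hp => hp.2
    have h2 : ContinuousOn (fun p : ℝ × Eu n => HH (fun _ => 1) p.2) (Set.Icc (0:ℝ) 1 ×ˢ sph n) :=
      (HH_cont (C2_const 1)).comp continuousOn_snd fun p hp => hp.2
    have h3 : ContinuousOn (fun p : ℝ × Eu n => (1 - p.1) • HH (fun _ => 1) p.2 + p.1 • HH (w i) p.2) (Set.Icc (0:ℝ) 1 ×ˢ sph n) :=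
      ((continuousOn_const.sub continuousOn_fst).smul h2).add (continuousOn_fst.smul h1)
    refine h3.congr fun p hp => ?_
    dsimp only
    rw [wt_HH hw _ _ hp.2, HH_one hp.2]
  · exact continuousOn_const

theorem wt_Dm_cont (hw : Adm n k w) {B : ℝ × Eu n → Mt (n + 1)} (hB : ContinuousOn B (Set.Icc (0:ℝ) 1 ×ˢ sph n)) :
    ContinuousOn (fun p : ℝ × Eu n => Dm k (wt w p.1) p.2 (B p)) (Set.Icc (0:ℝ) 1 ×ˢ sph n) := by
  refine mdisc_contOn _ fun i => ?_
  by_cases hi : i = 0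
  · subst hi; simpa only [Function.update_self] using hB
  · simpa only [Function.update_of_ne hi] using wt_sl_cont hw i

theorem wt_rho_cont (hk2 : 2 ≤ k) (hkn : k ≤ n) (hw : Adm n k w) :
    ContinuousOn (fun p : ℝ × Eu n => rho k (wt w p.1) p.2) (Set.Icc (0:ℝ) 1 ×ˢ sph n) := by
  have h1 := wt_sl_cont (k := k) hw ⟨1, by omega⟩
  simp only [sl, if_pos (show 1 < k by omega)] at h1
  refine (wt_Dm_cont hw h1).div ?_ fun p hp => ((wt_adm (hk2.trans hkn) hkn hw hp.1).pos 1 _ hp.2).ne'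
  exact ((continuousOn_const.sub continuousOn_fst).mul continuousOn_const).add
    (continuousOn_fst.mul ((hw.c2 1).cs.comp continuousOn_snd fun p hp => hp.2))

theorem unif {F : ℝ × Eu n → ℝ} (hF : ContinuousOn F (Set.Icc (0:ℝ) 1 ×ˢ sph n)) {s : ℝ} (hs : s ∈ Set.Icc (0:ℝ) 1) {ε : ℝ} (hε : 0 < ε) :
    ∃ δ > 0, ∀ t ∈ Set.Icc (0:ℝ) 1, |t - s| < δ → ∀ x ∈ sph n, |F (t, x) - F (s, x)| ≤ ε := by
  have h1 := (isCompact_Icc.prod (sph_compact n)).uniformContinuousOn_of_continuous hF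
  obtain ⟨δ, hδ, h⟩ := Metric.uniformContinuousOn_iff.1 h1 ε hε
  refine ⟨δ, hδ, fun t ht hts x hx => ?_⟩
  have := h (t, x) ⟨ht, hx⟩ (s, x) ⟨hs, hx⟩ (by
    rw [Prod.dist_eq]; exact max_lt (by rwa [Real.dist_eq]) (by rwa [dist_self]))
  exact this.le

theorem To_diff (t s : ℝ) (f : Eu n → ℝ) (x : Eu n) : To k (wt w t) f x - To k (wt w s) f x =
    (rho k (wt w t) x - rho k (wt w s) x) * f x - ∑ p : Fin (n + 1) × Fin (n + 1), HH f x p.1 p.2 *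
      (Dm k (wt w t) x (Em p.1 p.2) - Dm k (wt w s) x (Em p.1 p.2)) := by
  simp only [To, Do, Lo]
  rw [Dm_expand k (wt w t), Dm_expand k (wt w s), Fintype.sum_prod_type]
  simp only [mul_sub, Finset.sum_sub_distrib]
  ring

theorem To_near (hk2 : 2 ≤ k) (hkn : k ≤ n) (hw : Adm n k w) {s : ℝ} (hs : s ∈ Set.Icc (0:ℝ) 1) {ε : ℝ} (hε : 0 < ε) :
    ∃ δ > 0, ∀ t ∈ Set.Icc (0:ℝ) 1, |t - s| < δ → ∀ f, C2 f →
      ip (fun x => To k (wt w s) f x - To k (wt w t) f x) (fun x => To k (wt w s) f x - To k (wt w t) f x) ≤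
        ε ^ 2 * (2 * ((n + 1) * (n + 1))) * (ip f f + sphInt n (fun x => nrm (HH f x))) := by
  obtain ⟨δ0, hδ0, h0⟩ := unif (wt_rho_cont hk2 hkn hw) hs hε
  choose δ hδ h1 using fun p : Fin (n + 1) × Fin (n + 1) =>
    unif (wt_Dm_cont (k := k) hw (B := fun _ => Em p.1 p.2) continuousOn_const) hs hε
  obtain ⟨δ', hδ', h2⟩ : ∃ δ' > 0, ∀ p, δ' ≤ δ p := by
    obtain ⟨p, hp⟩ := Finite.exists_min δ
    exact ⟨δ p, hδ p, hp⟩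
  refine ⟨min δ0 δ', lt_min hδ0 hδ', fun t ht hts f hf => ?_⟩
  have a0 := h0 t ht (hts.trans_le (min_le_left _ _))
  have a1 := fun p => h1 p t ht (hts.trans_le ((min_le_right _ _).trans (h2 p)))
  have hn := hk2.trans hkn
  have d := (To_cont (wt_adm hn hkn hw hs) hf).sub' (To_cont (wt_adm hn hkn hw ht) hf)
  have hff := hf.cs.mul' hf.cs
  rw [ip, ip, ← sphInt_add hff (nrm_cs hf), ← sphInt_smul]
  refine sphInt_mono (d.mul' d) ((hff.add' (nrm_cs hf)).cmul' _) fun x hx => ?_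
  have e1 : |To k (wt w t) f x - To k (wt w s) f x| ≤ ε * (|f x| + ∑ p : Fin (n + 1) × Fin (n + 1), |HH f x p.1 p.2|) := by
    rw [To_diff, mul_add]
    refine (abs_sub _ _).trans (add_le_add ?_ ?_)
    · rw [abs_mul]; exact mul_le_mul_of_nonneg_right (a0 x hx) (abs_nonneg _)
    · refine (Finset.abs_sum_le_sum_abs _ _).trans ?_
      rw [Finset.mul_sum]
      refine Finset.sum_le_sum fun p _ => ?_
      rw [abs_mul, mul_comm]
      exact mul_le_mul_of_nonneg_right (a1 p x hx) (abs_nonneg _)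
  have e2 : (∑ p : Fin (n + 1) × Fin (n + 1), |HH f x p.1 p.2|) ^ 2 ≤ (n + 1) * (n + 1) * nrm (HH f x) := by
    have := sq_sum_le_card_mul_sum_sq (s := Finset.univ) (f := fun p : Fin (n + 1) × Fin (n + 1) => |HH f x p.1 p.2|)
    simp only [sq_abs, Finset.card_univ, Fintype.card_prod, Fintype.card_fin] at this
    rw [Fintype.sum_prod_type (f := fun p : Fin (n + 1) × Fin (n + 1) => HH f x p.1 p.2 ^ 2)] at this
    push_cast at this
    exact this
  set Y := ∑ p : Fin (n + 1) × Fin (n + 1), |HH f x p.1 p.2|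
  have e3 := pow_le_pow_left₀ (abs_nonneg _) e1 2
  rw [sq_abs, mul_pow] at e3
  have e4 : (|f x| + Y) ^ 2 ≤ 2 * ((n + 1) * (n + 1)) * (f x * f x + nrm (HH f x)) := by
    have h3 : |f x| ^ 2 = f x * f x := by rw [sq_abs, sq]
    have h4 : (1:ℝ) ≤ (n + 1) * (n + 1) := by
      have : (0:ℝ) ≤ n := Nat.cast_nonneg n
      nlinarith
    have h5 := mul_le_mul_of_nonneg_right h4 (mul_self_nonneg (f x))
    nlinarith [sq_nonneg (|f x| - Y)]
  have e5 := mul_le_mul_of_nonneg_left e4 (sq_nonneg ε)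
  have e6 : (To k (wt w s) f x - To k (wt w t) f x) * (To k (wt w s) f x - To k (wt w t) f x) =
    (To k (wt w t) f x - To k (wt w s) f x) ^ 2 := by ring
  rw [e6]
  linarith

theorem dens_all (hk2 : 2 ≤ k) (hkn : k ≤ n) (hw : Adm n k w) : Dens (To k w) := by
  have hn := hk2.trans hkn
  let P : unitInterval → Prop := fun t => Dens (To k (wt w t))
  have hP : IsLocallyConstant P := by
    refine (IsLocallyConstant.iff_eventually_eq P).2 fun s => ?_
    have has := wt_adm hn hkn hw s.2
    obtain ⟨C, hC, hap⟩ := apriori hk2 hkn has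
    set K : ℝ := 2 * ((n + 1) * (n + 1))
    have hK : 0 < K := by positivity
    set ε := Real.sqrt (1 / (64 * K * C))
    have hε : 0 < ε := Real.sqrt_pos.2 (by positivity)
    have hε2 : ε ^ 2 = 1 / (64 * K * C) := Real.sq_sqrt (by positivity)
    obtain ⟨δ, hδ, h⟩ := To_near hk2 hkn hw s.2 hε
    filter_upwards [Metric.ball_mem_nhds s hδ] with t ht
    have ht' : |(t:ℝ) - s| < δ := by simpa [Subtype.dist_eq, Real.dist_eq] using ht
    refine propext (dens_iff (To_lin has) (To_lin (wt_adm hn hkn hw t.2)) fun f hf => ?_).symm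
    refine (h t t.2 ht' f hf).trans ?_
    have h1 := mul_le_mul_of_nonneg_left (hap f hf) (show 0 ≤ ε ^ 2 * K by positivity)
    refine h1.trans (le_of_eq ?_)
    rw [hε2]; field_simp
  have h01 : P 0 = P 1 := hP.apply_eq_of_preconnectedSpace 0 1
  have e0 : wt w ((0 : unitInterval) : ℝ) = fun _ _ => 1 := by funext i x; simp [wt]
  have e1 : wt w ((1 : unitInterval) : ℝ) = w := by funext i x; simp [wt]
  have h1 : P 1 := by
    rw [← h01]
    change Dens (To k (wt w ((0 : unitInterval) : ℝ)))
    rw [e0]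
    exact dens_round hn (by omega) hkn
  change Dens (To k (wt w ((1 : unitInterval) : ℝ))) at h1
  rwa [e1] at h1

theorem AF_neg (hk2 : 2 ≤ k) (hkn : k ≤ n) (hw : Adm n k w) {v : Eu n → ℝ} (hv : C2 v)
    (h0 : ip v (Lo k w (w 1)) = 0) : ip v (Lo k w v) ≤ 0 := dens_neg hk2 hkn hw (dens_all hk2 hkn hw) hv h0
end

section
variable {n k : ℕ} {w : ℕ → Eu n → ℝ} {f g h v u : Eu n → ℝ}

theorem Q_lin (hw : Adm n k w) (hf : C2 f) (hg : C2 g) (hh : C2 h) (s : ℝ) :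
    ip (fun x => f x + s * g x) (Lo k w h) = ip f (Lo k w h) + s * ip g (Lo k w h) := by
  rw [ip_add_left hf.cs (hg.cmul s).cs (Lo_cont hw hh), ip_smul_left]

theorem Q_exp (hw : Adm n k w) (hf : C2 f) (hg : C2 g) (s : ℝ) :
    ip (fun x => f x + s * g x) (Lo k w (fun x => f x + s * g x)) =
      ip f (Lo k w f) + 2 * s * ip f (Lo k w g) + s ^ 2 * ip g (Lo k w g) := by
  have hc : C2 (fun x => f x + s * g x) := hf.add (hg.cmul s)
  rw [Q_lin hw hf hg hc, Lo_symm hw hf hc, Lo_symm hw hg hc, Q_lin hw hf hg hf, Q_lin hw hf hg hg, Lo_symm hw hg hf]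
  ring

theorem Q_ker (hk2 : 2 ≤ k) (hkn : k ≤ n) (hw : Adm n k w) (hf : C2 f) (h0 : ip f (Lo k w (w 1)) = 0)
    (h1 : ip f (Lo k w f) = 0) (hg : C2 g) : ip f (Lo k w g) = 0 := by
  have hp : 0 < ip (w 1) (Lo k w (w 1)) := by
    have hx := sph_nonempty n
    exact sphInt_pos ((hw.c2 1).cs.mul' (Lo_cont hw (hw.c2 1)))
      (fun x hx => (mul_pos (hw.pos 1 x hx) (Lo_w_pos hk2 hkn hw (hw.gam 1) hx)).le) hx
      (mul_pos (hw.pos 1 _ hx) (Lo_w_pos hk2 hkn hw (hw.gam 1) hx))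
  set r := - (ip g (Lo k w (w 1)) / ip (w 1) (Lo k w (w 1))) with hr
  set g' : Eu n → ℝ := fun x => g x + r * w 1 x with hg'
  have c' : C2 g' := hg.add ((hw.c2 1).cmul r)
  have e1 : ip g' (Lo k w (w 1)) = 0 := by
    rw [hg', Q_lin hw hg (hw.c2 1) (hw.c2 1), hr]; field_simp; ring
  have e2 : ip f (Lo k w g') = ip f (Lo k w g) := by
    rw [Lo_symm hw hf c', hg', Q_lin hw hg (hw.c2 1) hf, Lo_symm hw (hw.c2 1) hf, h0, Lo_symm hw hg hf]; ring
  have e3 := AF_neg hk2 hkn hw c' e1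
  have e4 : ∀ t : ℝ, 2 * t * ip f (Lo k w g) + t ^ 2 * ip g' (Lo k w g') ≤ 0 := by
    intro t
    have := AF_neg hk2 hkn hw (hf.add (c'.cmul t)) (by rw [Q_lin hw hf c' (hw.c2 1), h0, e1]; ring)
    rw [Q_exp hw hf c', h1, e2] at this
    linarith
  set q := ip f (Lo k w g)
  set a := ip g' (Lo k w g')
  have h5 := e4 (q / (1 - a))
  have h6 : 0 < 1 - a := by linarith
  have h7 : 2 * (q / (1 - a)) * q + (q / (1 - a)) ^ 2 * a = q ^ 2 * ((2 - a) / (1 - a) ^ 2) := by field_simp; ring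
  rw [h7] at h5
  have h8 : 0 < (2 - a) / (1 - a) ^ 2 := div_pos (by linarith) (by positivity)
  by_contra hq
  have : 0 < q ^ 2 * ((2 - a) / (1 - a) ^ 2) := mul_pos (by positivity) h8
  linarith

theorem Lo_ker (hk2 : 2 ≤ k) (hkn : k ≤ n) (hw : Adm n k w) (hf : C2 f) (h0 : ip f (Lo k w (w 1)) = 0)
    (h1 : ip f (Lo k w f) = 0) : ∀ x ∈ sph n, Lo k w f x = 0 := by
  have hp := Lo_cont hw hf
  refine ip_eq_zero hp (le_antisymm (le_of_forall_pos_le_add fun η hη => ?_) (ip_nonneg _))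
  obtain ⟨h, hh, hl⟩ := dens_id n _ hp η hη
  have a1 : ip h (Lo k w f) = 0 := by rw [Lo_symm hw hh hf]; exact Q_ker hk2 hkn hw hf h0 h1 hh
  have a2 := ip_nonneg h
  rw [ip_sub_sub hh.cs hp, a1] at hl
  linarith

theorem lin_ker (hk2 : 2 ≤ k) (hkn : k ≤ n) (hw : Adm n k w) (hf : C2 f) (h0 : ip f (Lo k w (w 1)) = 0)
    (h1 : ip f (Lo k w f) = 0) : ∃ a : Eu n, ∀ x ∈ sph n, f x = ⟪a, x⟫ := by
  have hL := Lo_ker hk2 hkn hw hf h0 h1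
  have hb : ∀ x ∈ sph n, bq (sl k w x) (HH f x) (HH (w 1) x) = 0 := fun x hx => by
    rw [← Dm_bq hk2 hkn]; exact hL x hx
  have hneg : ∀ x ∈ sph n, Bo k w f x ≤ 0 := fun x hx =>
    bq_lorentz hk2 (by omega) (hw.sl hx) (hw.gam 1 x hx) (HH_symm hf hx) (hb x hx)
  have hi : sphInt n (fun x => - (w 1 x * Bo k w f x)) = 0 := by
    have := Bo_int hk2 hkn hw hf
    rw [h1, ip] at this
    have h2 := sphInt_smul (n := n) (-1) (fun x => w 1 x * Bo k w f x)
    simp only [neg_one_mul, this] at h2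
    simpa using h2
  have hz := sphInt_eq_zero ((hw.c2 1).cs.mul' (Bo_cont hk2 hkn hw hf)).neg'
    (fun x hx => by have := mul_nonneg (hw.pos 1 x hx).le (neg_nonneg.2 (hneg x hx)); linarith) hi
  refine HH_zero (by omega) hf fun x hx => ?_
  refine bq_strict hk2 (by omega) (hw.sl hx) (hw.gam 1 x hx) (HH_symm hf hx) (hb x hx) ?_
  have := hz x hx
  rw [neg_eq_zero, mul_eq_zero] at this
  exact (this.resolve_left (hw.pos 1 x hx).ne').ge

theorem core (hk2 : 2 ≤ k) (hkn : k ≤ n) (hw : Adm n k w) (hu : C2 u) (hup : PosOnSphere u)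
    (hL : ∀ x ∈ sph n, 0 < Lo k w u x) (hv : C2 v) :
    ip v (Lo k w v) * ip u (Lo k w u) ≤ ip v (Lo k w u) ^ 2 ∧
    (ip v (Lo k w u) ^ 2 = ip v (Lo k w v) * ip u (Lo k w u) ↔
      ∃ (a : ℝ) (b : Eu n), ∀ x ∈ sph n, v x = a * u x + ⟪b, x⟫) := by
  have hx0 := sph_nonempty n
  have pos : ∀ g, C2 g → PosOnSphere g → 0 < ip g (Lo k w u) := fun g hg hgp =>
    sphInt_pos (hg.cs.mul' (Lo_cont hw hu)) (fun x hx => (mul_pos (hgp x hx) (hL x hx)).le) hx0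
      (mul_pos (hgp _ hx0) (hL _ hx0))
  have p0 := pos u hu hup
  have p1 := pos _ (hw.c2 1) (hw.pos 1)
  rw [Lo_symm hw (hw.c2 1) hu] at p1
  set s := - (ip v (Lo k w (w 1)) / ip u (Lo k w (w 1))) with hs
  have cf : C2 (fun x => v x + s * u x) := hv.add (hu.cmul s)
  have e1 : ip (fun x => v x + s * u x) (Lo k w (w 1)) = 0 := by
    rw [Q_lin hw hv hu (hw.c2 1), hs]; field_simp; ring
  have e2 := AF_neg hk2 hkn hw cf e1
  have e3 := Q_exp hw hv hu s
  refine ⟨?_, ?_, ?_⟩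
  · rw [e3] at e2
    nlinarith [sq_nonneg (ip v (Lo k w u) + s * ip u (Lo k w u)), mul_nonpos_of_nonpos_of_nonneg e2 p0.le]
  · intro he
    have e4 : ip (fun x => v x + s * u x) (Lo k w (fun x => v x + s * u x)) = 0 := by
      refine le_antisymm e2 ?_
      have : 0 ≤ ip (fun x => v x + s * u x) (Lo k w (fun x => v x + s * u x)) * ip u (Lo k w u) := by
        rw [e3]; nlinarith [sq_nonneg (ip v (Lo k w u) + s * ip u (Lo k w u))]
      exact nonneg_of_mul_nonneg_left this p0
    obtain ⟨b, hb⟩ := lin_ker hk2 hkn hw cf e1 e4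
    exact ⟨-s, b, fun x hx => by rw [← hb x hx]; ring⟩
  · rintro ⟨a, b, hab⟩
    have hH : ∀ x ∈ sph n, Lo k w v x = a * Lo k w u x := fun x hx => by
      rw [Lo, HH_congr hab hx, HH_add (hu.cmul a) (C2_inner b) hx, HH_inner b hx, HH_cmul a hu hx, add_zero, Dm_smul]; rfl
    have q1 : ∀ g : Eu n → ℝ, ip g (Lo k w v) = a * ip g (Lo k w u) := fun g => by
      rw [ip_congr (fun _ _ => rfl) hH, ip_smul_right]
    rw [q1 v, Lo_symm hw hv hu, q1 u]; ring
end

section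
variable {n k : ℕ}

/-- normalising constant -/
def cnk (n k : ℕ) : ℝ := ((n+1).choose k / (n+1).factorial : ℝ)

theorem cnk_pos (hk : k ≤ n) : 0 < cnk n k :=
  div_pos (by exact_mod_cast Nat.choose_pos (by omega)) (by positivity)

theorem mv_eq (hk1 : 1 ≤ k) (hk : k ≤ n) (u : Fin k → Eu n → ℝ) (hu : ∀ i, C2 (u i)) (w : ℕ → Eu n → ℝ)
    (hwu : ∀ i : Fin k, 1 ≤ (i:ℕ) → w i = u i) (f : Eu n → ℝ) :
    mixedVol n k f u = cnk n k * ip f (Lo k w (u ⟨0, hk1⟩)) := by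
  rw [mixedVol, ip, ← sphInt_smul]
  refine sphInt_congr fun x hx => ?_
  rw [polarEsymm_eq (by omega), Lo, Dm]
  have : (app1 fun i => opM (hessOp (u i) x).toLinearMap) =
      Function.update (sl k w x) 0 (HH (u ⟨0, hk1⟩) x) := by
    funext i
    rw [Function.update_apply, app1]
    by_cases hi : i = 0
    · subst hi
      rw [if_pos rfl, dif_pos (show ((0 : Fin (n+1)) : ℕ) < k from hk1), hessOp_eq (hu _) (sph_ne hx)]
      rfl
    · have hi' : 1 ≤ (i:ℕ) := by
        rcases Nat.eq_zero_or_pos (i:ℕ) with h | h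
        · exact absurd (Fin.ext h) hi
        · exact h
      rw [if_neg hi, sl]
      split_ifs with h
      · rw [hessOp_eq (hu _) (sph_ne hx), hwu ⟨i, h⟩ hi']; rfl
      · rfl
  rw [this, cnk]; ring

theorem gam_of (hk : k ≤ n) {u : Eu n → ℝ} (hu : C2 u) {x : Eu n} (hx : x ∈ sph n)
    (h : ∀ j, 1 ≤ j → j ≤ k → 0 < esymmOp n j (hessOp u x).toLinearMap) : HH u x ∈ Gam (n + 1) k := by
  refine ⟨HH_symm hu hx, fun j h1 h2 => ?_⟩
  have := h j h1 h2
  rw [esymmOp_eq (by omega), hessOp_eq hu (sph_ne hx)] at this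
  exact pos_of_mul_pos_right this (cnk_pos (n := n) (k := j) (by omega)).le
end

theorem main_thm (n k : ℕ) (hn : 2 ≤ n) (hk1 : 1 ≤ k) (hkn : k ≤ n) (u : Fin k → Eu n → ℝ)
    (huC2 : ∀ i, C2 (u i)) (hupos : ∀ i, PosOnSphere (u i))
    (huΓ : ∀ i, ∀ x ∈ sph n, ∀ j, 1 ≤ j → j ≤ k → 0 < esymmOp n j (hessOp (u i) x).toLinearMap)
    (v : Eu n → ℝ) (hv : C2 v) :
    mixedVol n k v (Function.update u ⟨0, hk1⟩ v) * mixedVol n k (u ⟨0, hk1⟩) u ≤ mixedVol n k v u ^ 2 ∧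
    (mixedVol n k v u ^ 2 = mixedVol n k v (Function.update u ⟨0, hk1⟩ v) * mixedVol n k (u ⟨0, hk1⟩) u ↔
      ∃ (a : ℝ) (b : Eu n), ∀ x ∈ sph n, v x = a * u ⟨0, hk1⟩ x + ⟪b, x⟫) := by
  have hu0 := huC2 ⟨0, hk1⟩
  have red : ∀ (w : ℕ → Eu n → ℝ), (∀ i : Fin k, 1 ≤ (i:ℕ) → w i = u i) →
      ∀ (k' : ℕ) (w' : ℕ → Eu n → ℝ) (c : ℝ), 0 < c → 2 ≤ k' → k' ≤ n → Adm n k' w' →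
      (∀ f, C2 f → ∀ x ∈ sph n, Lo k w f x = c * Lo k' w' f x) →
      (∀ x ∈ sph n, 0 < Lo k' w' (u ⟨0, hk1⟩) x) →
      mixedVol n k v (Function.update u ⟨0, hk1⟩ v) * mixedVol n k (u ⟨0, hk1⟩) u ≤ mixedVol n k v u ^ 2 ∧
      (mixedVol n k v u ^ 2 = mixedVol n k v (Function.update u ⟨0, hk1⟩ v) * mixedVol n k (u ⟨0, hk1⟩) u ↔
      ∃ (a : ℝ) (b : Eu n), ∀ x ∈ sph n, v x = a * u ⟨0, hk1⟩ x + ⟪b, x⟫) := by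
    intro w hwu k' w' c hc hk' hkn' hw' hL hpos
    have q : ∀ g f : Eu n → ℝ, C2 f → ip g (Lo k w f) = c * ip g (Lo k' w' f) := fun g f hf => by
      rw [ip_congr (fun _ _ => rfl) (hL f hf), ip_smul_right]
    obtain ⟨c1, c2⟩ := core hk' hkn' hw' hu0 (hupos _) hpos hv
    have m1 : mixedVol n k v (Function.update u ⟨0, hk1⟩ v) = cnk n k * ip v (Lo k w v) := by
      rw [mv_eq hk1 hkn _ (fun i => ?_) w (fun i hi => ?_) v, Function.update_self]
      · by_cases h : i = ⟨0, hk1⟩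
        · subst h; simpa using hv
        · rw [Function.update_of_ne h]; exact huC2 i
      · rw [Function.update_of_ne (by intro h; subst h; simp at hi)]; exact hwu i hi
    rw [m1, mv_eq hk1 hkn u huC2 w hwu, mv_eq hk1 hkn u huC2 w hwu, q _ _ hv, q _ _ hu0, q _ _ hu0, ← c2]
    have hd : 0 < (cnk n k * c) ^ 2 := by have := cnk_pos hkn; positivity
    constructor
    · have := mul_le_mul_of_nonneg_left c1 hd.le; linarith
    · rw [← mul_right_inj' hd.ne' (b := ip v _ ^ 2)]
      constructor <;> intro h <;> linarith
  by_cases hk2 : 2 ≤ k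
  · set w : ℕ → Eu n → ℝ := fun i => if h : i < k then u ⟨i, h⟩ else fun _ => 1 with hwd
    have hw : Adm n k w := by
      have o := adm_one hn hkn
      refine ⟨fun i => ?_, fun i => ?_, fun i x hx => ?_⟩
      · simp only [hwd]; split_ifs with h; exacts [huC2 _, o.c2 0]
      · simp only [hwd]; split_ifs with h; exacts [hupos _, o.pos 0]
      · simp only [hwd]; split_ifs with h; exacts [gam_of hkn (huC2 _) hx (huΓ _ x hx), o.gam 0 x hx]
    refine red w (fun i _ => by simp [hwd]) k w 1 one_pos hk2 hkn hw (fun _ _ _ _ => by rw [one_mul]) fun x hx => ?_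
    exact Lo_w_pos hk2 hkn hw (fun x hx => gam_of hkn hu0 hx (huΓ _ x hx)) hx
  · obtain rfl : k = 1 := by omega
    obtain ⟨a, ha, hA⟩ := Lo_round hn hk1 hkn
    obtain ⟨b, hb, hB⟩ := Lo_round hn one_le_two hn
    refine red (fun _ _ => 1) (fun i hi => by omega) 2 (fun _ _ => 1) (a / b) (by positivity) le_rfl hn (adm_one hn hn)
      (fun f hf x hx => by rw [hA f hf x hx, hB f hf x hx]; field_simp) fun x hx => ?_
    have h1 := (gam_of hkn hu0 hx (huΓ _ x hx)).2 1 le_rfl le_rfl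
    have h2 : Lo 1 (fun _ _ => 1) (u ⟨0, hk1⟩) x = mdisc ℝ (n+1) (tup 1 (HH (u ⟨0, hk1⟩) x) (fun _ => 1)) := by
      rw [Lo, Dm]; congr 1; funext i
      simp only [Function.update_apply, tup, sl, Fin.ext_iff, Nat.lt_one_iff, Fin.val_zero]
      split_ifs <;> rfl
    rw [← h2, hA _ hu0 x hx] at h1
    rw [hB _ hu0 x hx]
    exact mul_pos hb (pos_of_mul_pos_right h1 ha.le)

/-- Lemma 2.1 (Alexandrov–Fenchel inequality): for positive `C²` functions `u^1,…,u^k` with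
`W_{u^i} ∈ Γ_k` and any `C²` function `v`,
`V_{k+1}(v,u^1,…,u^k)² ≥ V_{k+1}(v,v,u^2,…,u^k) V_{k+1}(u^1,u^1,u^2,…,u^k)`, with equality
iff `v = a u^1 + (linear function)` on `S^n`. -/
theorem stmt4 (n k : ℕ) (hn : 2 ≤ n) (hk1 : 1 ≤ k) (hkn : k ≤ n)
    (u : Fin k → Eu n → ℝ)
    (huC2 : ∀ i, ContDiffOn ℝ 2 (homExt (u i)) {(0 : Eu n)}ᶜ)
    (hupos : ∀ i, PosOnSphere (u i))
    (huΓ : ∀ i, ∀ x ∈ sph n, ∀ j : ℕ, 1 ≤ j → j ≤ k →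
      0 < esymmOp n j (hessOp (u i) x).toLinearMap)
    (v : Eu n → ℝ) (hv : ContDiffOn ℝ 2 (homExt v) {(0 : Eu n)}ᶜ) :
    mixedVol n k v u ^ 2 ≥
      mixedVol n k v (Function.update u ⟨0, hk1⟩ v) * mixedVol n k (u ⟨0, hk1⟩) u ∧
    (mixedVol n k v u ^ 2 =
        mixedVol n k v (Function.update u ⟨0, hk1⟩ v) * mixedVol n k (u ⟨0, hk1⟩) u ↔
      ∃ (a : ℝ) (w : Eu n), ∀ x ∈ sph n, v x = a * u ⟨0, hk1⟩ x + ⟪w, x⟫) := by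
  exact main_thm n k hn hk1 hkn u huC2 hupos huΓ v hv
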